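/- arXiv:1906.01691 — 11 statements merged into one kernel-verified Lean document; each statement's English description precedes it below -/
import Mathlib

section
/- Let (I, ≤) be a directed partially ordered set, {(X_i, τ_i), π_{i,j}, I} a projective system of Hausdorff topological spaces with projective limit X_I, and {μ_i : i ∈ I} an exact projective system of Radon probability measures. If I contains a countable cofinal subset J (i.e. for every i ∈ I there is j ∈ J with i ≤ j), then {μ_i : i ∈ I} fulfills Prokhorov's condition: for every ε > 0 there exists a compact set C_ε ⊆ X_I such that μ_i(π_i(C_ε)) ≥ 1 − ε for all i ∈ I. -/
open MeasureTheory
open scoped ENNReal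

namespace Stmt0

variable {ι : Type*} {X : ι → Type*}

/-- The projective (inverse) limit of a projective system of spaces `X i` with
connecting maps `π h : X j → X i` for `h : i ≤ j`, realized as the standard subset
of the product `∀ i, X i`. -/
def ProjLim [Preorder ι] (π : ∀ ⦃i j : ι⦄, i ≤ j → X j → X i) : Set (∀ i, X i) :=
  {x | ∀ ⦃i j : ι⦄ (h : i ≤ j), π h (x j) = x i}

/-- A Radon measure: a Borel measure which is locally finite and inner regular with
respect to compact sets. -/
def IsRadon {α : Type*} [TopologicalSpace α] [MeasurableSpace α] (μ : Measure α) : Prop :=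
  IsLocallyFiniteMeasure μ ∧ μ.InnerRegular

/-- A directed preorder with a nonempty countable cofinal set has a cofinal monotone sequence. -/
theorem exists_monotone_cofinal_seq {ι : Type*} [Preorder ι] [IsDirected ι (· ≤ ·)] [Nonempty ι]
    {J : Set ι} (hJc : J.Countable) (hJcof : ∀ i : ι, ∃ j ∈ J, i ≤ j) :
    ∃ s : ℕ → ι, Monotone s ∧ ∀ i, ∃ n, i ≤ s n := by
  have hJne : Nonempty J := by
    obtain ⟨j, hj, -⟩ := hJcof (Classical.arbitrary ι)
    exact ⟨⟨j, hj⟩⟩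
  have : Countable J := hJc.to_subtype
  let := Encodable.ofCountable J
  let : Inhabited J := Classical.inhabited_of_nonempty hJne
  have hd : Directed (· ≤ ·) (fun j : J => (j : ι)) := by
    intro a b
    obtain ⟨c, hac, hbc⟩ := exists_ge_ge (a : ι) (b : ι)
    obtain ⟨j, hj, hcj⟩ := hJcof c
    exact ⟨⟨j, hj⟩, hac.trans hcj, hbc.trans hcj⟩
  refine ⟨fun n => (hd.sequence _ n : J), hd.sequence_mono, fun i => ?_⟩
  obtain ⟨j, hj, hij⟩ := hJcof i
  exact ⟨_, hij.trans (hd.rel_sequence ⟨j, hj⟩)⟩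

/-- The points of the projective limit whose coordinates along a cofinal sequence lie in
prescribed compact sets form a compact set. -/
theorem isCompact_setOf_mem_of_cofinal [Preorder ι]
    [∀ i, TopologicalSpace (X i)] [∀ i, T2Space (X i)]
    {π : ∀ ⦃i j : ι⦄, i ≤ j → X j → X i} (hcont : ∀ ⦃i j : ι⦄ (h : i ≤ j), Continuous (π h))
    {s : ℕ → ι} (hcof : ∀ i, ∃ n, i ≤ s n) {K : ∀ n, Set (X (s n))} (hK : ∀ n, IsCompact (K n)) :
    IsCompact {x : ProjLim π | ∀ n, x.1 (s n) ∈ K n} := by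
  choose n hn using hcof
  have hcl : IsClosed (ProjLim π) := by
    have : ProjLim π = ⋂ (i : ι) (j : ι) (h : i ≤ j), {x | π h (x j) = x i} := by
      ext x; simp [ProjLim]
    rw [this]
    exact isClosed_iInter fun i => isClosed_iInter fun j => isClosed_iInter fun h =>
      isClosed_eq ((hcont h).comp (continuous_apply j)) (continuous_apply i)
  have hclK : IsClosed {x : ProjLim π | ∀ n, x.1 (s n) ∈ K n} := by
    simp only [Set.ofPred_forall]
    exact isClosed_iInter fun n =>
      (hK n).isClosed.preimage ((continuous_apply (s n)).comp continuous_subtype_val)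
  have hprod : IsCompact (Set.univ.pi fun i => π (hn i) '' K (n i)) :=
    isCompact_univ_pi fun i => (hK (n i)).image (hcont (hn i))
  refine (hcl.isClosedEmbedding_subtypeVal.isCompact_preimage hprod).of_isClosed_subset hclK ?_
  intro x hx i _
  exact ⟨x.1 (s (n i)), hx (n i), x.2 (hn i)⟩

/-- A point that lifts to every partial system of compact constraints along a cofinal sequence
lifts to the projective limit. -/
theorem exists_mem_projLim_of_forall_lift [Preorder ι]
    [∀ i, TopologicalSpace (X i)] [∀ i, T2Space (X i)] [∀ i, Nonempty (X i)]
    {π : ∀ ⦃i j : ι⦄, i ≤ j → X j → X i} (hcont : ∀ ⦃i j : ι⦄ (h : i ≤ j), Continuous (π h))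
    (hcomp : ∀ ⦃i j k : ι⦄ (hij : i ≤ j) (hjk : j ≤ k) (x : X k),
      π hij (π hjk x) = π (hij.trans hjk) x)
    {s : ℕ → ι} (hs : Monotone s) (hcof : ∀ i, ∃ n, i ≤ s n)
    {K : ∀ n, Set (X (s n))} (hK : ∀ n, IsCompact (K n))
    {i₀ : ι} {n₀ : ℕ} (hn₀ : i₀ ≤ s n₀) {y : X i₀}
    (hy : ∀ m (hm : n₀ ≤ m), ∃ z : X (s m),
      (∀ k (hk : k ≤ m), π (hs hk) z ∈ K k) ∧ π (hn₀.trans (hs hm)) z = y) :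
    ∃ x : ProjLim π, (∀ n, x.1 (s n) ∈ K n) ∧ x.1 i₀ = y := by
  classical
  have hz : ∀ m, ∃ z : X (s m), ∀ hm : n₀ ≤ m,
      (∀ k (hk : k ≤ m), π (hs hk) z ∈ K k) ∧ π (hn₀.trans (hs hm)) z = y := by
    intro m
    by_cases hm : n₀ ≤ m
    · obtain ⟨z, hz⟩ := hy m hm
      exact ⟨z, fun _ => hz⟩
    · exact ⟨Classical.arbitrary _, fun h => absurd h hm⟩
  choose z hz using hz
  let w : ∀ i, ℕ → X i := fun i m => if h : i ≤ s m then π h (z m) else Classical.arbitrary _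
  have hw : ∀ i m (h : i ≤ s m), w i m = π h (z m) := fun i m h => dif_pos h
  let U : Ultrafilter ℕ := Filter.hyperfilter ℕ
  have hU : ∀ n : ℕ, ∀ᶠ m in (U : Filter ℕ), n ≤ m := fun n =>
    (Nat.hyperfilter_le_atTop) (Filter.eventually_ge_atTop n)
  have hwK : ∀ n, ∀ᶠ m in (U : Filter ℕ), w (s n) m ∈ K n := by
    intro n
    filter_upwards [hU n, hU n₀] with m hm hm₀
    rw [hw _ _ (hs hm)]
    exact (hz m hm₀).1 n hm
  have hwπ : ∀ ⦃i j : ι⦄ (h : i ≤ j), ∀ᶠ m in (U : Filter ℕ), π h (w j m) = w i m := by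
    intro i j h
    obtain ⟨n, hn⟩ := hcof j
    filter_upwards [hU n] with m hm
    rw [hw _ _ (hn.trans (hs hm)), hw _ _ (h.trans (hn.trans (hs hm))), hcomp]
  have hlim : ∀ i, ∃ x : X i, Filter.Tendsto (w i) U (nhds x) := by
    intro i
    obtain ⟨n, hn⟩ := hcof i
    obtain ⟨x, -, hx⟩ := (hK n).ultrafilter_le_nhds (U.map (w (s n)))
      (Filter.le_principal_iff.2 (hwK n))
    exact ⟨π hn x, (((hcont hn).tendsto x).comp hx).congr' (hwπ hn)⟩
  choose x hx using hlim
  refine ⟨⟨x, fun i j h => ?_⟩, fun n => ?_, ?_⟩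
  · exact tendsto_nhds_unique ((((hcont h).tendsto _).comp (hx j)).congr' (hwπ h)) (hx i)
  · exact (hK n).isClosed.mem_of_tendsto (hx _) (hwK n)
  · refine tendsto_nhds_unique (hx i₀) (tendsto_const_nhds.congr' ?_)
    filter_upwards [hU n₀] with m hm
    rw [hw _ _ (hn₀.trans (hs hm))]
    exact (hz m hm).2.symm

/-- If the directed index set `ι` contains a countable cofinal subset `J`, then any exact
projective system of Radon probability measures fulfills Prokhorov's condition. -/
theorem prokhorov_of_countable_cofinal
    [PartialOrder ι] [IsDirected ι (· ≤ ·)]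
    [∀ i, TopologicalSpace (X i)] [∀ i, T2Space (X i)]
    [∀ i, MeasurableSpace (X i)] [∀ i, BorelSpace (X i)]
    (π : ∀ ⦃i j : ι⦄, i ≤ j → X j → X i)
    (hcont : ∀ ⦃i j : ι⦄ (h : i ≤ j), Continuous (π h))
    (hid : ∀ (i : ι) (x : X i), π (le_refl i) x = x)
    (hcomp : ∀ ⦃i j k : ι⦄ (hij : i ≤ j) (hjk : j ≤ k) (x : X k),
      π hij (π hjk x) = π (hij.trans hjk) x)
    (μ : ∀ i, Measure (X i))
    (hprob : ∀ i, IsProbabilityMeasure (μ i))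
    (hRadon : ∀ i, IsRadon (μ i))
    (hexact : ∀ ⦃i j : ι⦄ (h : i ≤ j), (μ j).map (π h) = μ i)
    (J : Set ι) (hJc : J.Countable) (hJcof : ∀ i : ι, ∃ j ∈ J, i ≤ j) :
    ∀ ε : ℝ≥0∞, 0 < ε →
      ∃ C : Set (ProjLim π), IsCompact C ∧
        ∀ i : ι, 1 - ε ≤ μ i ((fun x : ProjLim π => x.1 i) '' C) := by
  intro ε hε
  cases isEmpty_or_nonempty ι with
  | inl h => exact ⟨∅, isCompact_empty, fun i => isEmptyElim i⟩
  | inr h =>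
  obtain ⟨s, hs, hcof⟩ := exists_monotone_cofinal_seq hJc hJcof
  have hne : ∀ i, Nonempty (X i) := fun i => (μ i).nonempty_of_neZero
  obtain ⟨δ, hδ, hδε⟩ := ENNReal.exists_pos_sum_of_countable hε.ne' ℕ
  have hKex : ∀ n, ∃ K : Set (X (s n)), IsCompact K ∧ μ (s n) Kᶜ ≤ δ n := by
    intro n
    have := (hRadon (s n)).2
    obtain ⟨K, -, hK, hlt⟩ := MeasurableSet.univ.exists_isCompact_sdiff_lt
      (measure_ne_top (μ (s n)) _) (ENNReal.coe_ne_zero.2 (hδ n).ne')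
    exact ⟨K, hK, by rw [Set.compl_eq_univ_sdiff]; exact hlt.le⟩
  choose K hK hKδ using hKex
  refine ⟨_, isCompact_setOf_mem_of_cofinal hcont hcof hK, fun i => ?_⟩
  obtain ⟨n₀, hn₀⟩ := hcof i
  let L : ∀ m, Set (X (s m)) := fun m => {z | ∀ k (hk : k ≤ m), π (hs hk) z ∈ K k}
  have hLcl : ∀ m, IsClosed (L m) := by
    intro m
    simp only [L, Set.ofPred_forall]
    exact isClosed_iInter fun k => isClosed_iInter fun hk =>
      (hK k).isClosed.preimage (hcont (hs hk))
  have hLc : ∀ m, IsCompact (L m) := fun m =>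
    (hK m).of_isClosed_subset (hLcl m) fun z hz => by simpa [hid] using hz m le_rfl
  have hLμ : ∀ m, 1 - ε ≤ μ (s m) (L m) := by
    intro m
    have hcompl : (L m)ᶜ = ⋃ k : {k // k ≤ m}, π (hs k.2) ⁻¹' (K k)ᶜ := by
      ext z; simp [L]
    have hle : μ (s m) (L m)ᶜ ≤ ε := by
      rw [hcompl]
      calc _ ≤ ∑' k : {k // k ≤ m}, μ (s m) (π (hs k.2) ⁻¹' (K k)ᶜ) := measure_iUnion_le _
        _ ≤ ∑' k : {k // k ≤ m}, (δ k : ℝ≥0∞) := by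
          refine ENNReal.tsum_le_tsum fun k => ?_
          rw [← Measure.map_apply (hcont _).measurable (hK k).measurableSet.compl, hexact]
          exact hKδ k
        _ ≤ ∑' k, (δ k : ℝ≥0∞) :=
          ENNReal.tsum_comp_le_tsum_of_injective Subtype.val_injective _
        _ ≤ ε := hδε.le
    rw [← compl_compl (L m), prob_compl_eq_one_sub (hLcl m).measurableSet.compl]
    exact tsub_le_tsub_left hle 1
  let A : ℕ → Set (X i) := fun k =>
    π (hn₀.trans (hs (Nat.le_add_right n₀ k))) '' L (n₀ + k)
  have hAc : ∀ k, IsCompact (A k) := fun k => (hLc _).image (hcont _)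
  have hA : Antitone A := by
    rintro a b hab _ ⟨z, hz, rfl⟩
    have hab' : n₀ + a ≤ n₀ + b := by gcongr
    refine ⟨π (hs hab') z, fun k hk => ?_, hcomp _ _ _⟩
    rw [hcomp]
    exact hz k (hk.trans hab')
  have hAμ : ∀ k, 1 - ε ≤ μ i (A k) := by
    intro k
    refine (hLμ (n₀ + k)).trans ?_
    rw [← hexact (hn₀.trans (hs (Nat.le_add_right n₀ k))),
      Measure.map_apply (hcont _).measurable (hAc k).measurableSet]
    exact measure_mono (Set.subset_preimage_image _ _)
  have hlim := tendsto_measure_iInter_atTop (μ := μ i)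
    (fun k => (hAc k).measurableSet.nullMeasurableSet) hA ⟨0, measure_ne_top _ _⟩
  refine (ge_of_tendsto' hlim hAμ).trans (measure_mono fun y hy => ?_)
  obtain ⟨x, hx, hxy⟩ := exists_mem_projLim_of_forall_lift hcont hcomp hs hcof hK hn₀ (y := y) (by
    intro m hm
    obtain ⟨k, rfl⟩ := Nat.exists_eq_add_of_le hm
    exact Set.mem_iInter.1 hy k)
  exact ⟨x, hx, hxy⟩

end Stmt0
end

section
/- Let (I, ≤) be a directed partially ordered set, {(X_i, τ_i), π_{i,j}, I} a projective system of Hausdorff topological spaces with projective limit X_I, and {μ_i : i ∈ I} an exact projective system of Radon probability measures. The family {μ_i : i ∈ I} fulfills Prokhorov's condition if and only if for every ε > 0 and every i ∈ I there exists a compact set K_i ⊆ X_i such that μ_i(K_i) ≥ 1 − ε and π_{i,j}(K_j) ⊆ K_i for all j ∈ I with j ≥ i. -/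
open MeasureTheory
open scoped ENNReal

namespace Stmt1

variable {ι : Type*} {X : ι → Type*}

/-- The projective (inverse) limit of a projective system of spaces `X i`. -/
def ProjLim [Preorder ι] (π : ∀ ⦃i j : ι⦄, i ≤ j → X j → X i) : Set (∀ i, X i) :=
  {x | ∀ ⦃i j : ι⦄ (h : i ≤ j), π h (x j) = x i}

/-- A Radon measure: locally finite and inner regular w.r.t. compact sets. -/
def IsRadon {α : Type*} [TopologicalSpace α] [MeasurableSpace α] (μ : Measure α) : Prop :=
  IsLocallyFiniteMeasure μ ∧ μ.InnerRegular

theorem isClosed_projLim [Preorder ι] [∀ i, TopologicalSpace (X i)] [∀ i, T2Space (X i)]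
    {π : ∀ ⦃i j : ι⦄, i ≤ j → X j → X i} (hcont : ∀ ⦃i j : ι⦄ (h : i ≤ j), Continuous (π h)) :
    IsClosed (ProjLim π) := by
  simp only [ProjLim, Set.ofPred_forall]
  exact isClosed_iInter fun i => isClosed_iInter fun j => isClosed_iInter fun h =>
    isClosed_eq ((hcont h).comp (continuous_apply j)) (continuous_apply i)

/-- A point that lifts to every `K j`, `j ≥ i`, lifts to a thread in the projective limit with
coordinates in the compact sets `K`. -/
theorem exists_mem_projLim_of_forall_mem_image [Preorder ι] [IsDirected ι (· ≤ ·)]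
    [∀ i, TopologicalSpace (X i)] [∀ i, T2Space (X i)]
    {π : ∀ ⦃i j : ι⦄, i ≤ j → X j → X i} (hcont : ∀ ⦃i j : ι⦄ (h : i ≤ j), Continuous (π h))
    (hid : ∀ (i : ι) (x : X i), π (le_refl i) x = x)
    (hcomp : ∀ ⦃i j k : ι⦄ (hij : i ≤ j) (hjk : j ≤ k) (x : X k),
      π hij (π hjk x) = π (hij.trans hjk) x)
    {K : ∀ i, Set (X i)} (hK : ∀ i, IsCompact (K i))
    (hmap : ∀ ⦃i j : ι⦄ (h : i ≤ j), π h '' K j ⊆ K i)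
    {i : ι} {x : X i} (hx : ∀ ⦃j : ι⦄ (h : i ≤ j), x ∈ π h '' K j) :
    ∃ y ∈ ProjLim π, (∀ j, y j ∈ K j) ∧ y i = x := by
  classical
  have hne : ∀ k, (K k).Nonempty := fun k => by
    obtain ⟨l, hil, hkl⟩ := exists_ge_ge i k
    obtain ⟨z, hz, -⟩ := hx hil
    exact ⟨_, hmap hkl ⟨z, hz, rfl⟩⟩
  choose w hw using hne
  let F : {j // i ≤ j} → Set (∀ k, X k) := fun j =>
    Set.univ.pi K ∩ ({y | y i = x} ∩ {y | ∀ (k : ι) (h : k ≤ j.1), π h (y j.1) = y k})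
  have hpi : IsCompact (Set.univ.pi K) := isCompact_univ_pi hK
  have hclosed : ∀ j, IsClosed (F j) := fun j => by
    refine hpi.isClosed.inter ((isClosed_eq (continuous_apply i) continuous_const).inter ?_)
    simp only [Set.ofPred_forall]
    exact isClosed_iInter fun k => isClosed_iInter fun h =>
      isClosed_eq ((hcont h).comp (continuous_apply j.1)) (continuous_apply k)
  have : Nonempty {j // i ≤ j} := ⟨⟨i, le_rfl⟩⟩
  have hanti : ∀ a b : {j // i ≤ j}, a.1 ≤ b.1 → F b ⊆ F a := by
    rintro a b hab y ⟨hyK, hyx, hy⟩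
    refine ⟨hyK, hyx, fun k hk => ?_⟩
    rw [← hy a.1 hab, hcomp, hy]
  have hdir : Directed (· ⊇ ·) F := fun a b => by
    obtain ⟨c, hac, hbc⟩ := exists_ge_ge a.1 b.1
    exact ⟨⟨c, a.2.trans hac⟩, hanti _ _ hac, hanti _ _ hbc⟩
  have hFne : ∀ j, (F j).Nonempty := by
    rintro ⟨j, hij⟩
    obtain ⟨z, hz, hzx⟩ := hx hij
    refine ⟨fun k => if h : k ≤ j then π h z else w k, fun k _ => ?_, ?_, fun k hk => ?_⟩
    · dsimp only
      split_ifs with h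
      · exact hmap h ⟨z, hz, rfl⟩
      · exact hw k
    · simp [hij, hzx]
    · simp [hk, hid]
  obtain ⟨y, hy⟩ := IsCompact.nonempty_iInter_of_directed_nonempty_isCompact_isClosed F hdir hFne
    (fun j => hpi.of_isClosed_subset (hclosed j) Set.inter_subset_left) hclosed
  rw [Set.mem_iInter] at hy
  refine ⟨y, fun k l hkl => ?_, fun j => (hy ⟨i, le_rfl⟩).1 j trivial, (hy ⟨i, le_rfl⟩).2.1⟩
  obtain ⟨m, him, hlm⟩ := exists_ge_ge i l
  have h := (hy ⟨m, him⟩).2.2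
  rw [← h l hlm, hcomp, h]

/-- Continuity from above of an inner regular finite measure along a downward directed family
of compact sets. -/
theorem le_measure_iInter_of_directed_isCompact {α κ : Type*} [TopologicalSpace α] [T2Space α]
    [MeasurableSpace α] [BorelSpace α] {ν : Measure α} [IsFiniteMeasure ν] [ν.InnerRegular]
    [Nonempty κ] {L : κ → Set α} (hL : ∀ j, IsCompact (L j)) (hdir : Directed (· ⊇ ·) L)
    {c : ℝ≥0∞} (hc : ∀ j, c ≤ ν (L j)) : c ≤ ν (⋂ j, L j) := by
  by_contra! hlt
  have hcompact : IsCompact (⋂ j, L j) := (hL (Classical.arbitrary κ)).of_isClosed_subset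
    (isClosed_iInter fun j => (hL j).isClosed) (Set.iInter_subset _ _)
  obtain ⟨U, hU, hUo, hUlt⟩ := hcompact.exists_isOpen_lt_of_lt c hlt
  obtain ⟨j, hj⟩ := exists_subset_nhds_of_isCompact hdir hL fun x hx => hUo.mem_nhds (hU hx)
  exact (((hc j).trans (measure_mono hj)).trans_lt hUlt).false

/-- An exact projective system of Radon probability measures fulfills Prokhorov's condition
iff for every `ε > 0` and every `i` there is a compact `K i ⊆ X i` with `μ i (K i) ≥ 1 - ε`
and `π h '' K j ⊆ K i` for all `j ≥ i`. -/
theorem prokhorov_iff_compatible_compacts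
    [PartialOrder ι] [IsDirected ι (· ≤ ·)]
    [∀ i, TopologicalSpace (X i)] [∀ i, T2Space (X i)]
    [∀ i, MeasurableSpace (X i)] [∀ i, BorelSpace (X i)]
    (π : ∀ ⦃i j : ι⦄, i ≤ j → X j → X i)
    (hcont : ∀ ⦃i j : ι⦄ (h : i ≤ j), Continuous (π h))
    (hid : ∀ (i : ι) (x : X i), π (le_refl i) x = x)
    (hcomp : ∀ ⦃i j k : ι⦄ (hij : i ≤ j) (hjk : j ≤ k) (x : X k),
      π hij (π hjk x) = π (hij.trans hjk) x)
    (μ : ∀ i, Measure (X i))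
    (hprob : ∀ i, IsProbabilityMeasure (μ i))
    (hRadon : ∀ i, IsRadon (μ i))
    (hexact : ∀ ⦃i j : ι⦄ (h : i ≤ j), (μ j).map (π h) = μ i) :
    (∀ ε : ℝ≥0∞, 0 < ε →
        ∃ C : Set (ProjLim π), IsCompact C ∧
          ∀ i : ι, 1 - ε ≤ μ i ((fun x : ProjLim π => x.1 i) '' C)) ↔
      (∀ ε : ℝ≥0∞, 0 < ε →
        ∃ K : ∀ i, Set (X i), (∀ i, IsCompact (K i)) ∧ (∀ i, 1 - ε ≤ μ i (K i)) ∧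
          ∀ ⦃i j : ι⦄ (h : i ≤ j), π h '' K j ⊆ K i) := by
  constructor
  · intro H ε hε
    obtain ⟨C, hC, hCμ⟩ := H ε hε
    refine ⟨fun i => (fun x : ProjLim π => x.1 i) '' C, fun i =>
      hC.image ((continuous_apply i).comp continuous_subtype_val), hCμ, ?_⟩
    rintro i j h _ ⟨_, ⟨x, hx, rfl⟩, rfl⟩
    exact ⟨x, hx, (x.2 h).symm⟩
  · intro H ε hε
    obtain ⟨K, hK, hKμ, hmap⟩ := H ε hε
    refine ⟨Subtype.val ⁻¹' Set.univ.pi K,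
      (isClosed_projLim hcont).isClosedEmbedding_subtypeVal.isCompact_preimage
        (isCompact_univ_pi hK), fun i => ?_⟩
    have := hprob i
    have := (hRadon i).2
    have : Nonempty {j // i ≤ j} := ⟨⟨i, le_rfl⟩⟩
    have hL : ∀ j : {j // i ≤ j}, IsCompact (π j.2 '' K j.1) := fun j =>
      (hK j.1).image (hcont j.2)
    have hanti : ∀ a b : {j // i ≤ j}, a.1 ≤ b.1 → π b.2 '' K b.1 ⊆ π a.2 '' K a.1 := by
      rintro a b hab _ ⟨z, hz, rfl⟩
      exact ⟨π hab z, hmap hab ⟨z, hz, rfl⟩, hcomp _ _ _⟩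
    have hdir : Directed (· ⊇ ·) fun j : {j // i ≤ j} => π j.2 '' K j.1 := fun a b => by
      obtain ⟨c, hac, hbc⟩ := exists_ge_ge a.1 b.1
      exact ⟨⟨c, a.2.trans hac⟩, hanti _ _ hac, hanti _ _ hbc⟩
    refine (le_measure_iInter_of_directed_isCompact (ν := μ i) hL hdir fun j => ?_).trans
      (measure_mono fun x hx => ?_)
    · rw [← hexact j.2, Measure.map_apply (hcont j.2).measurable (hL j).measurableSet]
      exact (hKμ j.1).trans (measure_mono (Set.subset_preimage_image _ _))
    · rw [Set.mem_iInter] at hx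
      obtain ⟨y, hy, hyK, hyx⟩ := exists_mem_projLim_of_forall_mem_image hcont hid hcomp hK hmap
        fun j h => hx ⟨j, h⟩
      exact ⟨⟨y, hy⟩, fun j _ => hyK j, hyx⟩

end Stmt1
end

section
/- Let (I, ≤) be a directed partially ordered set and {(X_i, τ_i), π_{i,j}, I} a projective system of Hausdorff topological spaces with projective limit X_I. For each i ∈ I let K_i ⊆ X_i be compact such that π_{i,j}(K_j) ⊆ K_i for all j ∈ I with j ≥ i. Then K := ⋂_{i ∈ I} π_i⁻¹(K_i) is a compact subset of X_I and, for each i ∈ I, π_i(K) = ⋂_{j ≥ i} π_{i,j}(K_j). -/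
open MeasureTheory
open scoped ENNReal

namespace Stmt2

variable {ι : Type*} {X : ι → Type*}

/-- The projective (inverse) limit of a projective system of spaces `X i`. -/
def ProjLim [Preorder ι] (π : ∀ ⦃i j : ι⦄, i ≤ j → X j → X i) : Set (∀ i, X i) :=
  {x | ∀ ⦃i j : ι⦄ (h : i ≤ j), π h (x j) = x i}

theorem isClosed_projLim [Preorder ι] [∀ i, TopologicalSpace (X i)] [∀ i, T2Space (X i)]
    (π : ∀ ⦃i j : ι⦄, i ≤ j → X j → X i)
    (hcont : ∀ ⦃i j : ι⦄ (h : i ≤ j), Continuous (π h)) : IsClosed (ProjLim π) := by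
  simp only [ProjLim, Set.ofPred_forall]
  exact isClosed_iInter fun i => isClosed_iInter fun j => isClosed_iInter fun h =>
    isClosed_eq ((hcont h).comp (continuous_apply j)) (continuous_apply i)

/-- A point of `⋂ (j ≥ i), π h '' K j` is the `i`-th coordinate of a point of the projective limit
all of whose coordinates lie in the sets `K j`. -/
theorem exists_mem_projLim_of_forall_mem_image
    [PartialOrder ι] [IsDirected ι (· ≤ ·)]
    [∀ i, TopologicalSpace (X i)] [∀ i, T2Space (X i)]
    (π : ∀ ⦃i j : ι⦄, i ≤ j → X j → X i)
    (hcont : ∀ ⦃i j : ι⦄ (h : i ≤ j), Continuous (π h))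
    (hid : ∀ (i : ι) (x : X i), π (le_refl i) x = x)
    (hcomp : ∀ ⦃i j k : ι⦄ (hij : i ≤ j) (hjk : j ≤ k) (x : X k),
      π hij (π hjk x) = π (hij.trans hjk) x)
    (K : ∀ i, Set (X i)) (hK : ∀ i, IsCompact (K i))
    (hKcompat : ∀ ⦃i j : ι⦄ (h : i ≤ j), π h '' K j ⊆ K i)
    (i : ι) (y : X i) (hy : ∀ j (h : i ≤ j), y ∈ π h '' K j) :
    ∃ x ∈ ProjLim π, (∀ j, x j ∈ K j) ∧ x i = y := by
  classical
  have hne : ∀ j, (K j).Nonempty := fun j => by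
    obtain ⟨k, hik, hjk⟩ := directed_of (· ≤ ·) i j
    obtain ⟨z, hz, -⟩ := hy k hik
    exact ⟨_, hKcompat hjk ⟨z, hz, rfl⟩⟩
  choose p hp using hne
  let S : {k // i ≤ k} → Set (∀ j, X j) := fun k =>
    Set.univ.pi K ∩ ({x | x i = y} ∩ ⋂ (j) (h : j ≤ k.1), {x | π h (x k.1) = x j})
  have hclosed : ∀ k, IsClosed
      ({x : ∀ j, X j | x i = y} ∩ ⋂ (j) (h : j ≤ k), {x | π h (x k) = x j}) := fun k =>
    (isClosed_eq (continuous_apply i) continuous_const).inter <|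
      isClosed_iInter fun j => isClosed_iInter fun h =>
        isClosed_eq ((hcont h).comp (continuous_apply k)) (continuous_apply j)
  have hcompact : ∀ k, IsCompact (S k) := fun k =>
    (isCompact_univ_pi hK).inter_right (hclosed k)
  have hdir : Directed (· ⊇ ·) S := by
    have hanti : ∀ a b : {k // i ≤ k}, a.1 ≤ b.1 → S b ⊆ S a := by
      rintro a b hab x ⟨hx, hxy, hxb⟩
      simp only [Set.mem_iInter, Set.mem_ofPred_eq] at hxb
      refine ⟨hx, hxy, ?_⟩
      simp only [Set.mem_iInter, Set.mem_ofPred_eq]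
      intro j hj
      rw [← hxb a.1 hab, hcomp, hxb]
    intro a b
    obtain ⟨c, hac, hbc⟩ := directed_of (· ≤ ·) a.1 b.1
    exact ⟨⟨c, a.2.trans hac⟩, hanti _ _ hac, hanti _ _ hbc⟩
  have hSne : ∀ k, (S k).Nonempty := by
    rintro ⟨k, hik⟩
    obtain ⟨z, hz, hzy⟩ := hy k hik
    refine ⟨fun j => if h : j ≤ k then π h z else p j, fun j _ => ?_, ?_, ?_⟩
    · by_cases h : j ≤ k
      · simpa [h] using hKcompat h ⟨z, hz, rfl⟩
      · simpa [h] using hp j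
    · simpa [hik] using hzy
    · simp only [Set.mem_iInter, Set.mem_ofPred_eq]
      intro j hj
      simp [hj, hid]
  have : Nonempty {k // i ≤ k} := ⟨⟨i, le_rfl⟩⟩
  obtain ⟨x, hx⟩ := IsCompact.nonempty_iInter_of_directed_nonempty_isCompact_isClosed S hdir hSne
    hcompact fun k => (hcompact k).isClosed
  have hxS : ∀ k, x ∈ S k := Set.mem_iInter.1 hx
  have hxk : ∀ k (_ : i ≤ k) j (h : j ≤ k), π h (x k) = x j := fun k hik j h => by
    have := (hxS ⟨k, hik⟩).2.2
    simp only [Set.mem_iInter, Set.mem_ofPred_eq] at this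
    exact this j h
  refine ⟨x, fun a b hab => ?_, fun j => (hxS ⟨i, le_rfl⟩).1 j trivial, (hxS ⟨i, le_rfl⟩).2.1⟩
  obtain ⟨k, hik, hbk⟩ := directed_of (· ≤ ·) i b
  rw [← hxk k hik b hbk, hcomp, hxk k hik]

/-- For compact sets `K i ⊆ X i` with `π h '' K j ⊆ K i` for `i ≤ j`, the set
`K := ⋂ i, π i ⁻¹' (K i)` is a compact subset of the projective limit, and
`π i '' K = ⋂ (j ≥ i), π h '' K j` for each `i`. -/
theorem compact_inter_preimages
    [PartialOrder ι] [IsDirected ι (· ≤ ·)]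
    [∀ i, TopologicalSpace (X i)] [∀ i, T2Space (X i)]
    (π : ∀ ⦃i j : ι⦄, i ≤ j → X j → X i)
    (hcont : ∀ ⦃i j : ι⦄ (h : i ≤ j), Continuous (π h))
    (hid : ∀ (i : ι) (x : X i), π (le_refl i) x = x)
    (hcomp : ∀ ⦃i j k : ι⦄ (hij : i ≤ j) (hjk : j ≤ k) (x : X k),
      π hij (π hjk x) = π (hij.trans hjk) x)
    (K : ∀ i, Set (X i)) (hK : ∀ i, IsCompact (K i))
    (hKcompat : ∀ ⦃i j : ι⦄ (h : i ≤ j), π h '' K j ⊆ K i) :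
    IsCompact (⋂ i : ι, (fun x : ProjLim π => x.1 i) ⁻¹' K i) ∧
      ∀ i : ι,
        (fun x : ProjLim π => x.1 i) '' (⋂ i' : ι, (fun x : ProjLim π => x.1 i') ⁻¹' K i') =
          ⋂ (j : ι), ⋂ (h : i ≤ j), π h '' K j := by
  constructor
  · rw [Subtype.isCompact_iff]
    convert (isCompact_univ_pi hK).inter_right (isClosed_projLim π hcont) using 1
    ext x
    simp [and_comm]
  · intro i
    ext y
    simp only [Set.mem_image, Set.mem_iInter, Set.mem_preimage]
    constructor
    · rintro ⟨x, hx, rfl⟩ j h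
      exact ⟨x.1 j, hx j, x.2 h⟩
    · intro hy
      obtain ⟨x, hx, hxK, hxy⟩ := exists_mem_projLim_of_forall_mem_image π hcont hid hcomp K hK
        hKcompat i y hy
      exact ⟨⟨x, hx⟩, hxK, hxy⟩

end Stmt2
end

section
/- Let (I, ≤) be a directed partially ordered set, {(X_i, τ_i), π_{i,j}, I} a projective system of Hausdorff topological spaces with projective limit X_I, and {μ_i : i ∈ I} an exact projective system of Radon probability measures that is thick, i.e. for each i ∈ I, μ_i(M) = 0 for every Borel set M ⊆ X_i with M ∩ π_i(X_I) = ∅. Then the assignment μ(π_i⁻¹(E_i)) := μ_i(E_i) (for i ∈ I and E_i Borel in X_i) is well defined on the cylinder algebra of X_I: whenever i, j ∈ I and Borel sets E_i ⊆ X_i, E_j ⊆ X_j satisfy π_i⁻¹(E_i) = π_j⁻¹(E_j), one has μ_i(E_i) = μ_j(E_j). -/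
open MeasureTheory
open scoped ENNReal

namespace Stmt3

variable {ι : Type*} {X : ι → Type*}

/-- The projective (inverse) limit of a projective system of spaces `X i`. -/
def ProjLim [Preorder ι] (π : ∀ ⦃i j : ι⦄, i ≤ j → X j → X i) : Set (∀ i, X i) :=
  {x | ∀ ⦃i j : ι⦄ (h : i ≤ j), π h (x j) = x i}

/-- A Radon measure: locally finite and inner regular w.r.t. compact sets. -/
def IsRadon {α : Type*} [TopologicalSpace α] [MeasurableSpace α] (μ : Measure α) : Prop :=
  IsLocallyFiniteMeasure μ ∧ μ.InnerRegular

/-- For a thick exact projective system of Radon probability measures, the assignment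
`μ (π i ⁻¹' E) := μ i E` is well defined on the cylinder algebra: if two cylinder sets agree,
the corresponding measures of their bases agree. -/
theorem cylinder_quasi_measure_well_defined
    [PartialOrder ι] [IsDirected ι (· ≤ ·)]
    [∀ i, TopologicalSpace (X i)] [∀ i, T2Space (X i)]
    [∀ i, MeasurableSpace (X i)] [∀ i, BorelSpace (X i)]
    (π : ∀ ⦃i j : ι⦄, i ≤ j → X j → X i)
    (hcont : ∀ ⦃i j : ι⦄ (h : i ≤ j), Continuous (π h))
    (hid : ∀ (i : ι) (x : X i), π (le_refl i) x = x)
    (hcomp : ∀ ⦃i j k : ι⦄ (hij : i ≤ j) (hjk : j ≤ k) (x : X k),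
      π hij (π hjk x) = π (hij.trans hjk) x)
    (μ : ∀ i, Measure (X i))
    (hprob : ∀ i, IsProbabilityMeasure (μ i))
    (hRadon : ∀ i, IsRadon (μ i))
    (hexact : ∀ ⦃i j : ι⦄ (h : i ≤ j), (μ j).map (π h) = μ i)
    (hthick : ∀ (i : ι) (M : Set (X i)), MeasurableSet M →
      M ∩ Set.range (fun x : ProjLim π => x.1 i) = ∅ → μ i M = 0) :
    ∀ (i j : ι) (Ei : Set (X i)) (Ej : Set (X j)), MeasurableSet Ei → MeasurableSet Ej →
      (fun x : ProjLim π => x.1 i) ⁻¹' Ei = (fun x : ProjLim π => x.1 j) ⁻¹' Ej →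
      μ i Ei = μ j Ej := by
  intro i j Ei Ej hEi hEj h
  obtain ⟨k, hik, hjk⟩ := exists_ge_ge i j
  have hA : MeasurableSet (π hik ⁻¹' Ei) := (hcont hik).measurable hEi
  have hB : MeasurableSet (π hjk ⁻¹' Ej) := (hcont hjk).measurable hEj
  have key (x : ProjLim π) : x.1 k ∈ π hik ⁻¹' Ei ↔ x.1 k ∈ π hjk ⁻¹' Ej := by
    rw [Set.mem_preimage, Set.mem_preimage, x.2 hik, x.2 hjk]
    exact Set.ext_iff.mp h x
  rw [← hexact hik, ← hexact hjk, Measure.map_apply (hcont hik).measurable hEi,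
    Measure.map_apply (hcont hjk).measurable hEj]
  refine measure_congr (ae_eq_set.mpr ⟨hthick k _ (hA.diff hB) ?_, hthick k _ (hB.diff hA) ?_⟩)
  · rw [Set.eq_empty_iff_forall_notMem]
    rintro _ ⟨⟨ha, hb⟩, x, rfl⟩
    exact hb ((key x).mp ha)
  · rw [Set.eq_empty_iff_forall_notMem]
    rintro _ ⟨⟨hb, ha⟩, x, rfl⟩
    exact ha ((key x).mpr hb)

end Stmt3
end

section
/- Let (I, ≤) be a directed partially ordered set, {(X_i, τ_i), π_{i,j}, I} a projective system of Hausdorff topological spaces with projective limit X_I, and {μ_i : i ∈ I} an exact projective system of Radon probability measures. If I contains a countable cofinal subset, then: (a) the system is thick, i.e. for each i ∈ I, μ_i(M) = 0 for every Borel set M ⊆ X_i with M ∩ π_i(X_I) = ∅; and (b) there exists a unique probability measure ν on the Borel σ-algebra of X_I (with respect to the projective limit topology) such that (π_i)_# ν = μ_i for all i ∈ I. -/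
open MeasureTheory
open scoped ENNReal

namespace Stmt4

variable {ι : Type*} {X : ι → Type*}

/-- The projective (inverse) limit of a projective system of spaces `X i`. -/
def ProjLim [Preorder ι] (π : ∀ ⦃i j : ι⦄, i ≤ j → X j → X i) : Set (∀ i, X i) :=
  {x | ∀ ⦃i j : ι⦄ (h : i ≤ j), π h (x j) = x i}

/-- A Radon measure: locally finite and inner regular w.r.t. compact sets. -/
def IsRadon {α : Type*} [TopologicalSpace α] [MeasurableSpace α] (μ : Measure α) : Prop :=
  IsLocallyFiniteMeasure μ ∧ μ.InnerRegular

section Sequence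

variable {Y : ℕ → Type*} [∀ k, TopologicalSpace (Y k)] [∀ k, T2Space (Y k)]

/-- A point lying in the image of every later term of a compatible sequence of compact sets lifts
to a point of the projective limit contained in all these compact sets. -/
lemma exists_mem_projLim_of_forall_mem_image (ρ : ∀ ⦃k l : ℕ⦄, k ≤ l → Y l → Y k)
    (hcont : ∀ ⦃k l : ℕ⦄ (h : k ≤ l), Continuous (ρ h))
    (hcomp : ∀ ⦃k l m : ℕ⦄ (hkl : k ≤ l) (hlm : l ≤ m) (x : Y m),
      ρ hkl (ρ hlm x) = ρ (hkl.trans hlm) x)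
    (C : ∀ k, Set (Y k)) (hC : ∀ k, IsCompact (C k))
    (hmaps : ∀ ⦃k l : ℕ⦄ (h : k ≤ l), Set.MapsTo (ρ h) (C l) (C k))
    {k : ℕ} {y : Y k} (hy : ∀ ⦃m : ℕ⦄ (h : k ≤ m), y ∈ ρ h '' C m) :
    ∃ x ∈ ProjLim ρ, x k = y ∧ ∀ l, x l ∈ C l := by
  classical
  let Z : ℕ → Set (∀ l, Y l) := fun N ↦ Set.univ.pi C ∩ ({x | x k = y} ∩
    ⋂ (l) (m) (h : l ≤ m) (_ : m ≤ N + k), {x | ρ h (x m) = x l})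
  have hpi : IsCompact (Set.univ.pi C) := isCompact_univ_pi hC
  have hclosed : ∀ N, IsClosed (Z N) := fun N ↦ by
    refine hpi.isClosed.inter (IsClosed.inter ?_ ?_)
    · exact isClosed_eq (continuous_apply k) continuous_const
    · exact isClosed_iInter fun l ↦ isClosed_iInter fun m ↦ isClosed_iInter fun h ↦
        isClosed_iInter fun _ ↦ isClosed_eq ((hcont h).comp (continuous_apply m))
          (continuous_apply l)
  have hne : ∀ l, (C l).Nonempty := fun l ↦ by
    obtain ⟨z, hz, -⟩ := hy (Nat.le_add_left k l)
    exact ⟨_, hmaps (Nat.le_add_right l k) hz⟩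
  choose w hw using hne
  have hZ : ∀ N, (Z N).Nonempty := fun N ↦ by
    obtain ⟨z, hz, hzy⟩ := hy (Nat.le_add_left k N)
    refine ⟨fun l ↦ if h : l ≤ N + k then ρ h z else w l, fun l _ ↦ ?_, ?_, ?_⟩
    · by_cases h : l ≤ N + k
      · simpa [h] using hmaps h hz
      · simpa [h] using hw l
    · simpa using hzy
    · simp only [Set.mem_iInter, Set.mem_ofPred_eq]
      intro l m hlm hm
      rw [dif_pos hm, dif_pos (hlm.trans hm), hcomp]
  obtain ⟨x, hx⟩ := IsCompact.nonempty_iInter_of_sequence_nonempty_isCompact_isClosed Z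
    (fun N x hx ↦ by
      refine ⟨hx.1, hx.2.1, ?_⟩
      have := hx.2.2
      simp only [Set.mem_iInter] at this ⊢
      exact fun l m h hm ↦ this l m h (by omega))
    hZ (hpi.of_isClosed_subset (hclosed 0) Set.inter_subset_left) hclosed
  rw [Set.mem_iInter] at hx
  refine ⟨x, fun l m h ↦ ?_, (hx 0).2.1, fun l ↦ (hx 0).1 l trivial⟩
  have := (hx m).2.2
  simp only [Set.mem_iInter] at this
  exact this l m h (by omega)

variable [∀ k, MeasurableSpace (Y k)] [∀ k, BorelSpace (Y k)]

/-- Starting from a compact set of measure larger than `c`, one finds a compatible sequence of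
compact sets of measure larger than `c`. -/
lemma exists_seq_isCompact_lt_measure (ρ : ∀ ⦃k l : ℕ⦄, k ≤ l → Y l → Y k)
    (hcont : ∀ ⦃k l : ℕ⦄ (h : k ≤ l), Continuous (ρ h))
    (hid : ∀ (k : ℕ) (x : Y k), ρ (le_refl k) x = x)
    (hcomp : ∀ ⦃k l m : ℕ⦄ (hkl : k ≤ l) (hlm : l ≤ m) (x : Y m),
      ρ hkl (ρ hlm x) = ρ (hkl.trans hlm) x)
    (μ : ∀ k, Measure (Y k)) [∀ k, (μ k).InnerRegular]
    (hexact : ∀ ⦃k l : ℕ⦄ (h : k ≤ l), (μ l).map (ρ h) = μ k)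
    {K : Set (Y 0)} (hK : IsCompact K) {c : ℝ≥0∞} (hc : c < μ 0 K) :
    ∃ C : ∀ k, Set (Y k), C 0 = K ∧ (∀ k, IsCompact (C k)) ∧ (∀ k, c < μ k (C k)) ∧
      ∀ ⦃k l : ℕ⦄ (h : k ≤ l), Set.MapsTo (ρ h) (C l) (C k) := by
  have step : ∀ k (S : {S : Set (Y k) // IsCompact S ∧ c < μ k S}),
      ∃ T : {T : Set (Y (k + 1)) // IsCompact T ∧ c < μ (k + 1) T},
        Set.MapsTo (ρ k.le_succ) T.1 S.1 := by
    rintro k ⟨S, hS, hcS⟩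
    rw [← hexact k.le_succ, Measure.map_apply (hcont _).measurable hS.measurableSet] at hcS
    obtain ⟨T, hTS, hT, hcT⟩ :=
      ((hcont k.le_succ).measurable hS.measurableSet).exists_lt_isCompact hcS
    exact ⟨⟨T, hT, hcT⟩, hTS⟩
  choose next hnext using step
  let C : ∀ k, {S : Set (Y k) // IsCompact S ∧ c < μ k S} := fun k ↦
    Nat.rec ⟨K, hK, hc⟩ next k
  refine ⟨fun k ↦ (C k).1, rfl, fun k ↦ (C k).2.1, fun k ↦ (C k).2.2, fun k l h ↦ ?_⟩
  induction l, h using Nat.le_induction with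
  | base => intro x hx; rwa [hid]
  | succ l h ih =>
    intro x hx
    rw [← hcomp h l.le_succ]
    exact ih (hnext l (C l) hx)

/-- The measure of the projection of the projective limit of a compatible sequence of compact
sets is at least the infimum of their measures. -/
lemma le_measure_image_projLim (ρ : ∀ ⦃k l : ℕ⦄, k ≤ l → Y l → Y k)
    (hcont : ∀ ⦃k l : ℕ⦄ (h : k ≤ l), Continuous (ρ h))
    (hcomp : ∀ ⦃k l m : ℕ⦄ (hkl : k ≤ l) (hlm : l ≤ m) (x : Y m),
      ρ hkl (ρ hlm x) = ρ (hkl.trans hlm) x)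
    (μ : ∀ k, Measure (Y k)) [∀ k, IsFiniteMeasure (μ k)]
    (hexact : ∀ ⦃k l : ℕ⦄ (h : k ≤ l), (μ l).map (ρ h) = μ k)
    (C : ∀ k, Set (Y k)) (hC : ∀ k, IsCompact (C k))
    (hmaps : ∀ ⦃k l : ℕ⦄ (h : k ≤ l), Set.MapsTo (ρ h) (C l) (C k))
    {c : ℝ≥0∞} (hc : ∀ k, c ≤ μ k (C k)) (k : ℕ) :
    c ≤ μ k ((fun x ↦ x k) '' {x | x ∈ ProjLim ρ ∧ ∀ l, x l ∈ C l}) := by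
  let D : ℕ → Set (Y k) := fun m ↦ ρ (Nat.le_add_right k m) '' C (k + m)
  have hD : ∀ m, MeasurableSet (D m) := fun m ↦ ((hC _).image (hcont _)).measurableSet
  have hanti : Antitone D := by
    rintro m m' h - ⟨x, hx, rfl⟩
    exact ⟨ρ (Nat.add_le_add_left h k) x, hmaps _ hx, hcomp _ _ _⟩
  calc
    c ≤ ⨅ m, μ k (D m) := le_iInf fun m ↦ by
      rw [← hexact (Nat.le_add_right k m), Measure.map_apply (hcont _).measurable (hD m)]
      exact (hc _).trans (measure_mono (Set.subset_preimage_image _ _))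
    _ = μ k (⋂ m, D m) :=
      (hanti.measure_iInter (fun m ↦ (hD m).nullMeasurableSet) ⟨0, measure_ne_top _ _⟩).symm
    _ ≤ _ := measure_mono fun y hy ↦ by
      obtain ⟨x, hx, hxk, hxC⟩ := exists_mem_projLim_of_forall_mem_image ρ hcont hcomp C hC hmaps
        (k := k) (y := y) (fun m h ↦ by
          obtain ⟨d, rfl⟩ := Nat.exists_eq_add_of_le h
          exact Set.mem_iInter.1 hy d)
      exact ⟨x, ⟨hx, hxC⟩, hxk⟩

end Sequence

/-- A directed order with a countable cofinal subset has, above any element, a monotone cofinal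
sequence. -/
lemma exists_monotone_seq_cofinal [Preorder ι] [IsDirected ι (· ≤ ·)] {J : Set ι}
    (hJc : J.Countable) (hJcof : ∀ i : ι, ∃ j ∈ J, i ≤ j) (i : ι) :
    ∃ n : ℕ → ι, Monotone n ∧ n 0 = i ∧ ∀ j, ∃ k, j ≤ n k := by
  obtain ⟨j₀, hj₀, -⟩ := hJcof i
  obtain ⟨e, rfl⟩ := hJc.exists_eq_range ⟨j₀, hj₀⟩
  choose b hb₁ hb₂ using fun a a' : ι ↦ exists_ge_ge a a'
  let n : ℕ → ι := fun k ↦ Nat.rec i (fun k a ↦ b a (e k)) k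
  refine ⟨n, monotone_nat_of_le_succ fun k ↦ hb₁ _ _, rfl, fun j ↦ ?_⟩
  obtain ⟨-, ⟨k, rfl⟩, hk⟩ := hJcof j
  exact ⟨k + 1, hk.trans (hb₂ _ _)⟩

section InfImage

variable [Preorder ι] (π : ∀ ⦃i j : ι⦄, i ≤ j → X j → X i)
  [∀ i, MeasurableSpace (X i)] (μ : ∀ i, Measure (X i))

/-- The infimum of the measures of the projections of a subset of the projective limit. -/
noncomputable def infImage (K : Set (ProjLim π)) : ℝ≥0∞ :=
  ⨅ i, μ i ((fun x : ProjLim π ↦ x.1 i) '' K)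

lemma infImage_mono {K L : Set (ProjLim π)} (h : K ⊆ L) : infImage π μ K ≤ infImage π μ L :=
  iInf_mono fun _ ↦ measure_mono (Set.image_mono h)

lemma infImage_lt_top [Nonempty ι] [∀ i, IsFiniteMeasure (μ i)] (K : Set (ProjLim π)) :
    infImage π μ K < ∞ :=
  (iInf_le _ (Classical.arbitrary ι)).trans_lt (measure_lt_top _ _)

end InfImage

section Limit

variable [Preorder ι] [∀ i, TopologicalSpace (X i)]
  (π : ∀ ⦃i j : ι⦄, i ≤ j → X j → X i)

lemma continuous_projLim_apply (i : ι) : Continuous fun x : ProjLim π ↦ x.1 i :=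
  (continuous_apply i).comp continuous_subtype_val

/-- An open subset of the projective limit is a countable union of open cylinders. -/
lemma exists_eq_iUnion_cylinder [IsDirected ι (· ≤ ·)] [Nonempty ι]
    (hcont : ∀ ⦃i j : ι⦄ (h : i ≤ j), Continuous (π h)) {J : Set ι}
    (hJcof : ∀ i : ι, ∃ j ∈ J, i ≤ j) {O : Set (ProjLim π)} (hO : IsOpen O) :
    ∃ U : ∀ i, Set (X i), (∀ i, IsOpen (U i)) ∧
      O = ⋃ j ∈ J, (fun x : ProjLim π ↦ x.1 j) ⁻¹' U j := by
  refine ⟨fun i ↦ ⋃₀ {V | IsOpen V ∧ (fun x : ProjLim π ↦ x.1 i) ⁻¹' V ⊆ O},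
    fun i ↦ isOpen_sUnion fun V hV ↦ hV.1, Set.Subset.antisymm ?_ ?_⟩
  · intro x hx
    obtain ⟨O', hO', rfl⟩ := isOpen_induced_iff.1 hO
    obtain ⟨F, u, hu, hsub⟩ := isOpen_pi_iff.1 hO' x.1 hx
    obtain ⟨i, hi⟩ := F.exists_le
    obtain ⟨j, hj, hij⟩ := hJcof i
    refine Set.mem_biUnion hj ⟨⋂ (a) (h : a ∈ F), π ((hi a h).trans hij) ⁻¹' u a, ⟨?_, ?_⟩, ?_⟩
    · have : (⋂ (a) (h : a ∈ F), π ((hi a h).trans hij) ⁻¹' u a) =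
          ⋂ a : F, π ((hi a.1 a.2).trans hij) ⁻¹' u a.1 := by
        ext; simp
      rw [this]
      exact isOpen_iInter_of_finite fun a ↦ (hu a.1 a.2).1.preimage (hcont _)
    · intro z hz
      refine hsub fun a ha ↦ ?_
      have := Set.mem_iInter₂.1 hz a ha
      rwa [Set.mem_preimage, z.2] at this
    · refine Set.mem_iInter₂.2 fun a ha ↦ ?_
      rw [Set.mem_preimage, x.2]
      exact (hu a ha).2
  · refine Set.iUnion₂_subset fun j _ x ⟨V, hV, hx⟩ ↦ hV.2 hx

/-- A finite Borel measure on the projective limit is determined by its projections. -/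
lemma ext_of_map_apply_eq [IsDirected ι (· ≤ ·)] [Nonempty ι]
    [∀ i, MeasurableSpace (X i)] [∀ i, BorelSpace (X i)]
    [MeasurableSpace (ProjLim π)] [BorelSpace (ProjLim π)]
    (hcont : ∀ ⦃i j : ι⦄ (h : i ≤ j), Continuous (π h))
    {J : Set ι} (hJc : J.Countable) (hJcof : ∀ i : ι, ∃ j ∈ J, i ≤ j)
    (ν ν' : Measure (ProjLim π)) [IsFiniteMeasure ν]
    (h : ∀ i, ν.map (fun x : ProjLim π ↦ x.1 i) = ν'.map (fun x : ProjLim π ↦ x.1 i)) :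
    ν = ν' := by
  have hmeas : ∀ i, Measurable fun x : ProjLim π ↦ x.1 i := fun i ↦
    (continuous_projLim_apply π i).measurable
  have hcyl : ∀ i (B : Set (X i)), MeasurableSet B →
      ν ((fun x : ProjLim π ↦ x.1 i) ⁻¹' B) = ν' ((fun x : ProjLim π ↦ x.1 i) ⁻¹' B) :=
    fun i B hB ↦ by rw [← Measure.map_apply (hmeas i) hB, h, Measure.map_apply (hmeas i) hB]
  refine ext_of_generate_finite
    {A | ∃ (i : ι) (B : Set (X i)), MeasurableSet B ∧ (fun x : ProjLim π ↦ x.1 i) ⁻¹' B = A}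
    ?_ ?_ ?_ (hcyl (Classical.arbitrary ι) Set.univ .univ)
  · rw [BorelSpace.measurable_eq (α := ProjLim π)]
    refine le_antisymm (MeasurableSpace.generateFrom_le fun O hO ↦ ?_)
      (MeasurableSpace.generateFrom_le ?_)
    · obtain ⟨U, hU, rfl⟩ := exists_eq_iUnion_cylinder π hcont hJcof hO
      exact MeasurableSet.biUnion hJc fun j _ ↦
        MeasurableSpace.measurableSet_generateFrom ⟨j, U j, (hU j).measurableSet, rfl⟩
    · rintro - ⟨i, B, hB, rfl⟩
      rw [← BorelSpace.measurable_eq (α := ProjLim π)]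
      exact hmeas i hB
  · rintro - ⟨i, A, hA, rfl⟩ - ⟨j, B, hB, rfl⟩ -
    obtain ⟨k, hik, hjk⟩ := exists_ge_ge i j
    refine ⟨k, π hik ⁻¹' A ∩ π hjk ⁻¹' B,
      ((hcont hik).measurable hA).inter ((hcont hjk).measurable hB), ?_⟩
    ext x
    simp only [Set.mem_preimage, Set.mem_inter_iff, x.2 hik, x.2 hjk]
  · rintro - ⟨i, B, hB, rfl⟩
    exact hcyl i B hB

variable [∀ i, T2Space (X i)]

lemma isClosed_projLim (hcont : ∀ ⦃i j : ι⦄ (h : i ≤ j), Continuous (π h)) :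
    IsClosed (ProjLim π) := by
  have : ProjLim π = ⋂ (i) (j) (h : i ≤ j), {x | π h (x j) = x i} := by
    ext x; simp [ProjLim]
  rw [this]
  exact isClosed_iInter fun i ↦ isClosed_iInter fun j ↦ isClosed_iInter fun h ↦
    isClosed_eq ((hcont h).comp (continuous_apply j)) (continuous_apply i)

lemma isCompact_setOf_forall_mem (hcont : ∀ ⦃i j : ι⦄ (h : i ≤ j), Continuous (π h))
    {n : ℕ → ι} (hcof : ∀ j, ∃ k, j ≤ n k) {C : ∀ k, Set (X (n k))} (hC : ∀ k, IsCompact (C k)) :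
    IsCompact {x : ProjLim π | ∀ k, x.1 (n k) ∈ C k} := by
  choose κ hκ using hcof
  rw [Subtype.isCompact_iff]
  have hpi : IsCompact (Set.univ.pi fun j ↦ π (hκ j) '' C (κ j)) :=
    isCompact_univ_pi fun j ↦ (hC _).image (hcont _)
  refine hpi.of_isClosed_subset ?_ ?_
  · have : (Subtype.val '' {x : ProjLim π | ∀ k, x.1 (n k) ∈ C k}) =
        ProjLim π ∩ ⋂ k, (fun x : ∀ i, X i ↦ x (n k)) ⁻¹' C k := by
      ext x; simp [and_comm]
    rw [this]
    exact (isClosed_projLim π hcont).inter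
      (isClosed_iInter fun k ↦ (hC k).isClosed.preimage (continuous_apply _))
  · rintro - ⟨x, hx, rfl⟩ j -
    exact ⟨_, hx (κ j), x.2 (hκ j)⟩

/-- Disjoint compact subsets of the projective limit have disjoint projections at some index. -/
lemma exists_disjoint_image [IsDirected ι (· ≤ ·)] [Nonempty ι] {K L : Set (ProjLim π)}
    (hK : IsCompact K) (hL : IsCompact L) (hKL : Disjoint K L) :
    ∃ i, Disjoint ((fun x : ProjLim π ↦ x.1 i) '' K) ((fun x : ProjLim π ↦ x.1 i) '' L) := by
  by_contra! H
  let Z : ι → Set (ProjLim π × ProjLim π) := fun i ↦ (K ×ˢ L) ∩ {p | p.1.1 i = p.2.1 i}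
  have hclosed : ∀ i, IsClosed {p : ProjLim π × ProjLim π | p.1.1 i = p.2.1 i} := fun i ↦
    isClosed_eq ((continuous_projLim_apply π i).comp continuous_fst)
      ((continuous_projLim_apply π i).comp continuous_snd)
  have hanti : Antitone Z := fun i j h p hp ↦ ⟨hp.1, by
    have : p.1.1 j = p.2.1 j := hp.2
    change p.1.1 i = p.2.1 i
    rw [← p.1.2 h, ← p.2.2 h, this]⟩
  obtain ⟨p, hp⟩ := IsCompact.nonempty_iInter_of_directed_nonempty_isCompact_isClosed Z
    hanti.directed_ge
    (fun i ↦ by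
      obtain ⟨-, ⟨x, hx, rfl⟩, y, hy, hxy⟩ := Set.not_disjoint_iff.1 (H i)
      exact ⟨(x, y), ⟨hx, hy⟩, hxy.symm⟩)
    (fun i ↦ (hK.prod hL).inter_right (hclosed i))
    (fun i ↦ (hK.prod hL).isClosed.inter (hclosed i))
  rw [Set.mem_iInter] at hp
  have heq : p.1 = p.2 := Subtype.ext (funext fun i ↦ (hp i).2)
  have hmem := (hp (Classical.arbitrary ι)).1
  exact Set.disjoint_left.1 hKL hmem.1 (heq ▸ hmem.2)

variable [∀ i, MeasurableSpace (X i)] [∀ i, BorelSpace (X i)] (μ : ∀ i, Measure (X i))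

lemma measure_image_anti
    (hcont : ∀ ⦃i j : ι⦄ (h : i ≤ j), Continuous (π h))
    (hexact : ∀ ⦃i j : ι⦄ (h : i ≤ j), (μ j).map (π h) = μ i)
    {K : Set (ProjLim π)} (hK : IsCompact K) ⦃i j : ι⦄ (h : i ≤ j) :
    μ j ((fun x : ProjLim π ↦ x.1 j) '' K) ≤ μ i ((fun x : ProjLim π ↦ x.1 i) '' K) := by
  rw [← hexact h, Measure.map_apply (hcont h).measurable
    (hK.image (continuous_projLim_apply π i)).measurableSet]
  refine measure_mono ?_
  rintro - ⟨x, hx, rfl⟩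
  exact ⟨x, hx, (x.2 h).symm⟩

lemma infImage_union_le
    (hcont : ∀ ⦃i j : ι⦄ (h : i ≤ j), Continuous (π h))
    (hexact : ∀ ⦃i j : ι⦄ (h : i ≤ j), (μ j).map (π h) = μ i)
    [IsDirected ι (· ≤ ·)] {K L : Set (ProjLim π)} (hK : IsCompact K)
    (hL : IsCompact L) : infImage π μ (K ∪ L) ≤ infImage π μ K + infImage π μ L := by
  refine ENNReal.le_iInf_add_iInf fun i j ↦ ?_
  obtain ⟨k, hik, hjk⟩ := exists_ge_ge i j
  refine (iInf_le _ k).trans ?_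
  rw [Set.image_union]
  exact (measure_union_le _ _).trans (add_le_add
    (measure_image_anti π μ hcont hexact hK hik) (measure_image_anti π μ hcont hexact hL hjk))

lemma le_infImage_union
    (hcont : ∀ ⦃i j : ι⦄ (h : i ≤ j), Continuous (π h))
    (hexact : ∀ ⦃i j : ι⦄ (h : i ≤ j), (μ j).map (π h) = μ i)
    [IsDirected ι (· ≤ ·)] [Nonempty ι] {K L : Set (ProjLim π)}
    (hK : IsCompact K) (hL : IsCompact L) (hKL : Disjoint K L) :
    infImage π μ K + infImage π μ L ≤ infImage π μ (K ∪ L) := by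
  refine le_iInf fun j ↦ ?_
  obtain ⟨i, hi⟩ := exists_disjoint_image π hK hL hKL
  obtain ⟨k, hik, hjk⟩ := exists_ge_ge i j
  refine le_trans ?_ (measure_image_anti π μ hcont hexact (hK.union hL) hjk)
  rw [Set.image_union, measure_union _ (hL.image (continuous_projLim_apply π k)).measurableSet]
  · exact add_le_add (iInf_le _ k) (iInf_le _ k)
  · rw [Set.disjoint_left] at hi ⊢
    rintro - ⟨x, hx, rfl⟩ ⟨y, hy, hxy⟩
    refine hi ⟨x, hx, rfl⟩ ⟨y, hy, ?_⟩
    have hxy : y.1 k = x.1 k := hxy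
    change y.1 i = x.1 i
    rw [← x.2 hik, ← y.2 hik, hxy]

/-- The content on the projective limit induced by an exact projective system of measures. -/
noncomputable def limitContent
    (hcont : ∀ ⦃i j : ι⦄ (h : i ≤ j), Continuous (π h))
    (hexact : ∀ ⦃i j : ι⦄ (h : i ≤ j), (μ j).map (π h) = μ i)
    [IsDirected ι (· ≤ ·)] [Nonempty ι] [∀ i, IsFiniteMeasure (μ i)] :
    Content (ProjLim π) where
  toFun K := (infImage π μ K).toNNReal
  mono' K L h := ENNReal.toNNReal_mono (infImage_lt_top π μ _).ne (infImage_mono π μ h)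
  sup_disjoint' K L h _ _ := by
    rw [← ENNReal.toNNReal_add (infImage_lt_top π μ _).ne (infImage_lt_top π μ _).ne]
    congr 1
    exact le_antisymm (infImage_union_le π μ hcont hexact K.isCompact L.isCompact)
      (le_infImage_union π μ hcont hexact K.isCompact L.isCompact h)
  sup_le' K L := by
    rw [← ENNReal.toNNReal_add (infImage_lt_top π μ _).ne (infImage_lt_top π μ _).ne]
    exact ENNReal.toNNReal_mono
      (ENNReal.add_lt_top.2 ⟨infImage_lt_top π μ _, infImage_lt_top π μ _⟩).ne
      (infImage_union_le π μ hcont hexact K.isCompact L.isCompact)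

lemma limitContent_apply
    (hcont : ∀ ⦃i j : ι⦄ (h : i ≤ j), Continuous (π h))
    (hexact : ∀ ⦃i j : ι⦄ (h : i ≤ j), (μ j).map (π h) = μ i)
    [IsDirected ι (· ≤ ·)] [Nonempty ι] [∀ i, IsFiniteMeasure (μ i)]
    (K : TopologicalSpace.Compacts (ProjLim π)) :
    limitContent π μ hcont hexact K = infImage π μ K :=
  ENNReal.coe_toNNReal (infImage_lt_top π μ _).ne

/-- The preimage of an open set of measure larger than `c` contains a compact subset of the
projective limit all of whose projections have measure at least `c`. -/
lemma exists_isCompact_le_infImage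
    (hcont : ∀ ⦃i j : ι⦄ (h : i ≤ j), Continuous (π h))
    (hexact : ∀ ⦃i j : ι⦄ (h : i ≤ j), (μ j).map (π h) = μ i)
    [IsDirected ι (· ≤ ·)] [∀ i, IsFiniteMeasure (μ i)]
    [∀ i, (μ i).InnerRegular]
    (hid : ∀ (i : ι) (x : X i), π (le_refl i) x = x)
    (hcomp : ∀ ⦃i j k : ι⦄ (hij : i ≤ j) (hjk : j ≤ k) (x : X k),
      π hij (π hjk x) = π (hij.trans hjk) x)
    {J : Set ι} (hJc : J.Countable) (hJcof : ∀ i : ι, ∃ j ∈ J, i ≤ j)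
    {i : ι} {U : Set (X i)} (hU : IsOpen U) {c : ℝ≥0∞} (hc : c < μ i U) :
    ∃ K : Set (ProjLim π), IsCompact K ∧ K ⊆ (fun x : ProjLim π ↦ x.1 i) ⁻¹' U ∧
      c ≤ infImage π μ K := by
  obtain ⟨n, hn, rfl, hcof⟩ := exists_monotone_seq_cofinal hJc hJcof i
  obtain ⟨K₀, hK₀U, hK₀, hcK₀⟩ := hU.measurableSet.exists_lt_isCompact hc
  let ρ : ∀ ⦃k l : ℕ⦄, k ≤ l → X (n l) → X (n k) := fun k l h ↦ π (hn h)
  obtain ⟨C, rfl, hC, hcC, hmaps⟩ := exists_seq_isCompact_lt_measure (Y := fun k ↦ X (n k)) ρ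
    (fun k l h ↦ hcont (hn h)) (fun k x ↦ hid _ x) (fun k l m h h' x ↦ hcomp _ _ x)
    (fun k ↦ μ (n k)) (fun k l h ↦ hexact (hn h)) hK₀ hcK₀
  have hK := isCompact_setOf_forall_mem π hcont hcof hC
  refine ⟨_, hK, fun x hx ↦ hK₀U (hx 0), le_iInf fun j ↦ ?_⟩
  obtain ⟨k, hjk⟩ := hcof j
  refine le_trans ?_ (measure_image_anti π μ hcont hexact hK hjk)
  refine (le_measure_image_projLim (Y := fun k ↦ X (n k)) ρ (fun k l h ↦ hcont (hn h))
    (fun k l m h h' x ↦ hcomp _ _ x) (fun k ↦ μ (n k)) (fun k l h ↦ hexact (hn h)) C hC hmaps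
    (fun k ↦ (hcC k).le) k).trans (measure_mono ?_)
  rintro - ⟨x, ⟨hx, hxC⟩, rfl⟩
  choose κ hκ using hcof
  have key : ∀ {i : ι} {k : ℕ} (h : i ≤ n k), π (hκ i) (x (κ i)) = π h (x k) := by
    intro i k h
    rcases le_total k (κ i) with hle | hle
    · rw [← hx hle, hcomp]
    · rw [← hx hle, hcomp]
  have hval : ∀ k, π (hκ (n k)) (x (κ (n k))) = x k := fun k ↦ by rw [key le_rfl, hid]
  refine ⟨⟨fun i ↦ π (hκ i) (x (κ i)), fun i j h ↦ ?_⟩, fun l ↦ ?_, hval k⟩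
  · rw [hcomp, ← key]
  · change π (hκ (n l)) (x (κ (n l))) ∈ C l
    rw [hval]
    exact hxC l

/-- An exact projective system of inner regular probability measures extends to the projective
limit. -/
lemma exists_measure_map_apply_eq
    (hcont : ∀ ⦃i j : ι⦄ (h : i ≤ j), Continuous (π h))
    (hexact : ∀ ⦃i j : ι⦄ (h : i ≤ j), (μ j).map (π h) = μ i)
    [IsDirected ι (· ≤ ·)] [Nonempty ι]
    [∀ i, IsProbabilityMeasure (μ i)] [∀ i, (μ i).InnerRegular]
    [MeasurableSpace (ProjLim π)] [BorelSpace (ProjLim π)]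
    (hid : ∀ (i : ι) (x : X i), π (le_refl i) x = x)
    (hcomp : ∀ ⦃i j k : ι⦄ (hij : i ≤ j) (hjk : j ≤ k) (x : X k),
      π hij (π hjk x) = π (hij.trans hjk) x)
    {J : Set ι} (hJc : J.Countable) (hJcof : ∀ i : ι, ∃ j ∈ J, i ≤ j) :
    ∃ ν : Measure (ProjLim π), ν Set.univ = 1 ∧
      ∀ i, ν.map (fun x : ProjLim π ↦ x.1 i) = μ i := by
  have hmeas : ∀ i, Measurable fun x : ProjLim π ↦ x.1 i := fun i ↦
    (continuous_projLim_apply π i).measurable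
  let κ := limitContent π μ hcont hexact
  have hopen : ∀ i (U : Set (X i)), IsOpen U →
      κ.measure ((fun x : ProjLim π ↦ x.1 i) ⁻¹' U) = μ i U := by
    intro i U hU
    have hO := hU.preimage (continuous_projLim_apply π i)
    rw [κ.measure_apply hO.measurableSet, κ.outerMeasure_of_isOpen _ hO]
    refine le_antisymm (iSup₂_le fun K hK ↦ ?_) (le_of_forall_lt fun c hc ↦ ?_)
    · rw [limitContent_apply]
      exact (iInf_le _ i).trans (measure_mono (Set.image_subset_iff.2 hK))
    · obtain ⟨d, hcd, hd⟩ := exists_between hc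
      obtain ⟨K, hK, hKU, hle⟩ := exists_isCompact_le_infImage π μ hcont hexact hid hcomp hJc
        hJcof hU hd
      refine hcd.trans_le (hle.trans ?_)
      refine (limitContent_apply π μ hcont hexact ⟨K, hK⟩).ge.trans ?_
      exact κ.le_innerContent ⟨K, hK⟩ ⟨_, hO⟩ hKU
  have huniv : κ.measure Set.univ = 1 := by
    rw [← measure_univ (μ := μ (Classical.arbitrary ι)), ← hopen _ _ isOpen_univ, Set.preimage_univ]
  refine ⟨κ.measure, huniv, fun i ↦ ?_⟩
  refine (ext_of_generate_finite {U | IsOpen U} (BorelSpace.measurable_eq (α := X i))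
    isPiSystem_isOpen (fun U hU ↦ ?_) ?_).symm
  · rw [Measure.map_apply (hmeas i) (IsOpen.measurableSet hU), hopen i U hU]
  · rw [Measure.map_apply (hmeas i) .univ, hopen i _ isOpen_univ]

end Limit

/-- If the directed index set contains a countable cofinal subset, then any exact projective
system of Radon probability measures is thick, and there is a unique probability measure on
the Borel σ-algebra of the projective limit pushing forward to the `μ i`. -/
theorem thick_and_unique_borel_extension
    [PartialOrder ι] [IsDirected ι (· ≤ ·)]
    [∀ i, TopologicalSpace (X i)] [∀ i, T2Space (X i)]
    [∀ i, MeasurableSpace (X i)] [∀ i, BorelSpace (X i)]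
    (π : ∀ ⦃i j : ι⦄, i ≤ j → X j → X i)
    (hcont : ∀ ⦃i j : ι⦄ (h : i ≤ j), Continuous (π h))
    (hid : ∀ (i : ι) (x : X i), π (le_refl i) x = x)
    (hcomp : ∀ ⦃i j k : ι⦄ (hij : i ≤ j) (hjk : j ≤ k) (x : X k),
      π hij (π hjk x) = π (hij.trans hjk) x)
    (μ : ∀ i, Measure (X i))
    (hprob : ∀ i, IsProbabilityMeasure (μ i))
    (hRadon : ∀ i, IsRadon (μ i))
    (hexact : ∀ ⦃i j : ι⦄ (h : i ≤ j), (μ j).map (π h) = μ i)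
    (J : Set ι) (hJc : J.Countable) (hJcof : ∀ i : ι, ∃ j ∈ J, i ≤ j) :
    (∀ (i : ι) (M : Set (X i)), MeasurableSet M →
        M ∩ Set.range (fun x : ProjLim π => x.1 i) = ∅ → μ i M = 0) ∧
      (∃! ν : @Measure (ProjLim π) (borel (ProjLim π)),
        ν Set.univ = 1 ∧
          ∀ i : ι,
            @Measure.map (ProjLim π) (X i) (borel (ProjLim π)) _
              (fun x : ProjLim π => x.1 i) ν = μ i) := by
  let : MeasurableSpace (ProjLim π) := borel (ProjLim π)
  have : BorelSpace (ProjLim π) := ⟨rfl⟩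
  rcases isEmpty_or_nonempty ι with hι | hι
  · have hunique : ∀ x y : ProjLim π, x = y := fun x y ↦ Subtype.ext (Subsingleton.elim _ _)
    let x₀ : ProjLim π := ⟨isEmptyElim, fun i ↦ isEmptyElim i⟩
    refine ⟨isEmptyElim, Measure.dirac x₀, ⟨measure_univ, isEmptyElim⟩, fun ν hν ↦ ?_⟩
    ext A -
    rcases A.eq_empty_or_nonempty with rfl | ⟨a, ha⟩
    · simp
    · obtain rfl : A = Set.univ := Set.eq_univ_of_forall fun x ↦ hunique a x ▸ ha
      exact hν.1.trans measure_univ.symm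
  · have := fun i ↦ (hRadon i).2
    obtain ⟨ν, hν, hmap⟩ := exists_measure_map_apply_eq π μ hcont hexact hid hcomp hJc hJcof
    refine ⟨fun i M hM hdisj ↦ ?_, ν, ⟨hν, hmap⟩, fun ν' hν' ↦ ?_⟩
    · rw [← hmap i, Measure.map_apply (continuous_projLim_apply π i).measurable hM,
        Set.preimage_eq_empty (Set.disjoint_iff_inter_eq_empty.2 hdisj), measure_empty]
    · have : IsFiniteMeasure ν' := ⟨hν'.1.trans_lt ENNReal.one_lt_top⟩
      exact ext_of_map_apply_eq π hcont hJc hJcof ν' ν fun i ↦ (hν'.2 i).trans (hmap i).symm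

end Stmt4
end

section
/- Let (I, ≤) be a directed partially ordered set, {(X_i, τ_i), π_{i,j}, I} a projective system of Hausdorff topological spaces with projective limit X_I, and {μ_i : i ∈ I} an exact projective system of Radon probability measures. Let Λ be the set of all subsets λ ⊆ I containing a countable directed subset cofinal in λ; for λ ∈ Λ let X_λ be the projective limit of {(X_i, τ_i), π_{i,j}, λ} with projections π_i^λ : X_λ → X_i and π^λ : X_I → X_λ the induced map, and let μ_λ be the unique probability measure on the Borel σ-algebra of X_λ with (π_i^λ)_# μ_λ = μ_i for all i ∈ λ. Then there exists a unique probability measure ν on the cylinder σ-algebra Σ_I of X_I with (π_i)_# ν = μ_i for all i ∈ I if and only if the family {μ_λ : λ ∈ Λ} is thick, i.e. for each λ ∈ Λ, μ_λ(M) = 0 for every Borel set M ⊆ X_λ with M ∩ π^λ(X_I) = ∅. -/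
open MeasureTheory
open scoped ENNReal

namespace Stmt5

variable {ι : Type*} {X : ι → Type*}

/-- The projective (inverse) limit of a projective system of spaces `X i`. -/
def ProjLim [Preorder ι] (π : ∀ ⦃i j : ι⦄, i ≤ j → X j → X i) : Set (∀ i, X i) :=
  {x | ∀ ⦃i j : ι⦄ (h : i ≤ j), π h (x j) = x i}

/-- The projective limit of the subsystem indexed by a subset `lam ⊆ ι`. -/
def ProjLimOn [Preorder ι] (π : ∀ ⦃i j : ι⦄, i ≤ j → X j → X i) (lam : Set ι) :
    Set (∀ i : lam, X i) :=
  {x | ∀ (i j : lam) (h : (i : ι) ≤ (j : ι)), π h (x j) = x i}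

/-- The canonical map `π^λ` from the full projective limit to the projective limit of the
subsystem indexed by `lam`. -/
def restrictToSub [Preorder ι] (π : ∀ ⦃i j : ι⦄, i ≤ j → X j → X i) (lam : Set ι)
    (x : ProjLim π) : ProjLimOn π lam :=
  ⟨fun i => x.1 i, fun _ _ h => x.2 h⟩

/-- `lam` is in `Λ`: it contains a countable directed subset cofinal in `lam`. -/
def MemLambda [Preorder ι] (lam : Set ι) : Prop :=
  ∃ D : Set ι, D ⊆ lam ∧ D.Countable ∧ DirectedOn (· ≤ ·) D ∧ ∀ i ∈ lam, ∃ j ∈ D, i ≤ j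

/-- A Radon measure: locally finite and inner regular w.r.t. compact sets. -/
def IsRadon {α : Type*} [TopologicalSpace α] [MeasurableSpace α] (μ : Measure α) : Prop :=
  IsLocallyFiniteMeasure μ ∧ μ.InnerRegular

lemma _root_.Continuous.measurable_borel {α β : Type*} [TopologicalSpace α] [TopologicalSpace β]
    [MeasurableSpace β] [BorelSpace β] {f : α → β} (hf : Continuous f) :
    @Measurable α β (borel α) _ f := by
  borelize α
  exact hf.measurable

/-- A measure extends to every σ-algebra consisting of null-measurable sets. -/
lemma exists_measure_apply_eq_of_nullMeasurableSet {α : Type*}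
    (m : MeasurableSpace α) [MeasurableSpace α] (P : Measure α)
    (hm : ∀ s, MeasurableSet[m] s → NullMeasurableSet s P) :
    ∃ Q : @Measure α m, ∀ s, MeasurableSet[m] s → Q s = P s := by
  have hle : m ≤ NullMeasurableSpace.instMeasurableSpace (α := α) (μ := P) := hm
  exact ⟨@Measure.trim (NullMeasurableSpace α P) m _ P.completion hle, fun s hs =>
    (@trim_measurableSet_eq (NullMeasurableSpace α P) m _ P.completion s hle hs).trans
      (Measure.completion_apply P s)⟩

lemma measurable_projLimOn_eval [Preorder ι] [∀ i, MeasurableSpace (X i)]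
    (π : ∀ ⦃i j : ι⦄, i ≤ j → X j → X i) (lam : Set ι) (i : lam) :
    Measurable (fun x : ProjLimOn π lam => x.1 i) :=
  (measurable_pi_apply i).comp measurable_subtype_coe

lemma measurable_projLim_eval [Preorder ι] [∀ i, MeasurableSpace (X i)]
    (π : ∀ ⦃i j : ι⦄, i ≤ j → X j → X i) (i : ι) :
    Measurable (fun x : ProjLim π => x.1 i) :=
  (measurable_pi_apply i).comp measurable_subtype_coe

lemma measurable_restrictToSub [Preorder ι] [∀ i, MeasurableSpace (X i)]
    (π : ∀ ⦃i j : ι⦄, i ≤ j → X j → X i) (lam : Set ι) :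
    Measurable (restrictToSub π lam) :=
  (measurable_pi_lambda (fun (x : ProjLim π) (i : lam) => x.1 i)
    fun i => measurable_projLim_eval π i).subtype_mk

lemma continuous_projLimOn_eval [Preorder ι] [∀ i, TopologicalSpace (X i)]
    (π : ∀ ⦃i j : ι⦄, i ≤ j → X j → X i) (lam : Set ι) (i : lam) :
    Continuous (fun x : ProjLimOn π lam => x.1 i) :=
  (continuous_apply i).comp continuous_subtype_val

lemma isClosed_projLimOn [Preorder ι] [∀ i, TopologicalSpace (X i)] [∀ i, T2Space (X i)]
    (π : ∀ ⦃i j : ι⦄, i ≤ j → X j → X i) (hcont : ∀ ⦃i j : ι⦄ (h : i ≤ j), Continuous (π h))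
    (lam : Set ι) : IsClosed (ProjLimOn π lam) := by
  simp only [ProjLimOn, Set.ofPred_forall]
  exact isClosed_iInter fun i => isClosed_iInter fun j => isClosed_iInter fun h =>
    isClosed_eq ((hcont h).comp (continuous_apply j)) (continuous_apply i)

/-- In a projective limit with a countable cofinal directed set of indices, compact sets belong
to the cylinder σ-algebra. -/
lemma measurableSet_of_isCompact_projLimOn [Preorder ι]
    [∀ i, TopologicalSpace (X i)] [∀ i, T2Space (X i)]
    [∀ i, MeasurableSpace (X i)] [∀ i, BorelSpace (X i)]
    (π : ∀ ⦃i j : ι⦄, i ≤ j → X j → X i) {lam : Set ι} (hlam : MemLambda lam)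
    {K : Set (ProjLimOn π lam)} (hK : IsCompact K) : MeasurableSet K := by
  obtain ⟨D, hDl, hDc, hDd, hcof⟩ := hlam
  rcases K.eq_empty_or_nonempty with rfl | hne
  · exact MeasurableSet.empty
  have : Countable D := hDc
  have key : K = ⋂ d : D, (fun x : ProjLimOn π lam => x.1 ⟨d, hDl d.2⟩) ⁻¹'
      ((fun x : ProjLimOn π lam => x.1 ⟨d, hDl d.2⟩) '' K) := by
    refine Set.Subset.antisymm
      (Set.subset_iInter fun d => Set.subset_preimage_image _ _) fun x hx => ?_
    have hinter : (K ∩ ⋂ d : D, {y : ProjLimOn π lam |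
        y.1 ⟨d, hDl d.2⟩ = x.1 ⟨d, hDl d.2⟩}).Nonempty := by
      refine hK.inter_iInter_nonempty _
        (fun d => isClosed_eq (continuous_projLimOn_eval π lam _) continuous_const) fun u => ?_
      rcases u.eq_empty_or_nonempty with rfl | ⟨d₀, _⟩
      · simpa using hne
      have : Nonempty D := ⟨d₀⟩
      obtain ⟨e, he⟩ := (directedOn_iff_directed.1 hDd).finset_le u
      obtain ⟨y, hyK, hy⟩ := Set.mem_iInter.1 hx e
      refine ⟨y, hyK, Set.mem_iInter₂.2 fun d hd => ?_⟩
      have hde : (d : ι) ≤ e := he d hd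
      have h1 := y.2 ⟨d, hDl d.2⟩ ⟨e, hDl e.2⟩ hde
      have h2 := x.2 ⟨d, hDl d.2⟩ ⟨e, hDl e.2⟩ hde
      change y.1 _ = x.1 _
      rw [← h1, ← h2]
      exact congrArg _ hy
    obtain ⟨y, hyK, hy⟩ := hinter
    have hyx : y = x := by
      refine Subtype.ext (funext fun i => ?_)
      obtain ⟨d, hd, hid⟩ := hcof i i.2
      rw [← y.2 i ⟨d, hDl hd⟩ hid, ← x.2 i ⟨d, hDl hd⟩ hid]
      exact congrArg _ (Set.mem_iInter.1 hy ⟨d, hd⟩)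
    exact hyx ▸ hyK
  rw [key]
  exact MeasurableSet.iInter fun d => measurable_projLimOn_eval π lam _
    (hK.image (continuous_projLimOn_eval π lam _)).isClosed.measurableSet

/-- Tightness of a cylinder measure with Radon marginals, for countable cofinality. -/
lemma exists_isCompact_projLimOn_compl_lt [Preorder ι]
    [∀ i, TopologicalSpace (X i)] [∀ i, T2Space (X i)]
    [∀ i, MeasurableSpace (X i)] [∀ i, BorelSpace (X i)]
    (π : ∀ ⦃i j : ι⦄, i ≤ j → X j → X i) (hcont : ∀ ⦃i j : ι⦄ (h : i ≤ j), Continuous (π h))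
    (μ : ∀ i, Measure (X i)) (hprob : ∀ i, IsProbabilityMeasure (μ i))
    (hRadon : ∀ i, IsRadon (μ i)) {lam : Set ι} (hlam : MemLambda lam)
    (P : Measure (ProjLimOn π lam)) (hP : ∀ i : lam, P.map (fun x => x.1 i) = μ i)
    {ε : ℝ≥0∞} (hε : ε ≠ 0) :
    ∃ K : Set (ProjLimOn π lam), IsCompact K ∧ P Kᶜ < ε := by
  obtain ⟨D, hDl, hDc, -, hcof⟩ := hlam
  have : Countable D := hDc
  obtain ⟨δ, hδ, hδε⟩ := ENNReal.exists_pos_sum_of_countable' hε D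
  have hex : ∀ d : D, ∃ C : Set (X d), IsCompact C ∧ μ d Cᶜ ≤ δ d := fun d => by
    have := (hRadon d).2
    obtain ⟨C, -, hC, h⟩ := MeasurableSet.univ.exists_isCompact_sdiff_lt
      (μ := μ d) (measure_ne_top _ _) (hδ d).ne'
    exact ⟨C, hC, by rw [Set.compl_eq_univ_sdiff]; exact h.le⟩
  choose C hC hCδ using hex
  refine ⟨{x | ∀ d : D, x.1 ⟨d, hDl d.2⟩ ∈ C d}, ?_, ?_⟩
  · choose d hd hid using hcof
    refine (isClosed_projLimOn π hcont lam).isClosedEmbedding_subtypeVal.isCompact_preimage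
      (isCompact_univ_pi fun i : lam =>
        (hC ⟨d i i.2, hd i i.2⟩).image (hcont (hid i i.2))) |>.of_isClosed_subset ?_ ?_
    · simp only [Set.ofPred_forall]
      exact isClosed_iInter fun d => (hC d).isClosed.preimage (continuous_projLimOn_eval π lam _)
    · exact fun x hx i _ => ⟨_, hx ⟨d i i.2, hd i i.2⟩, x.2 i ⟨d i i.2, hDl (hd i i.2)⟩ _⟩
  · refine lt_of_le_of_lt ?_ hδε
    have : {x : ProjLimOn π lam | ∀ d : D, x.1 ⟨d, hDl d.2⟩ ∈ C d}ᶜ =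
        ⋃ d : D, (fun x : ProjLimOn π lam => x.1 ⟨d, hDl d.2⟩) ⁻¹' (C d)ᶜ := by
      ext x; simp
    rw [this]
    refine (measure_iUnion_le _).trans (ENNReal.tsum_le_tsum fun d => ?_)
    rw [← Measure.map_apply (measurable_projLimOn_eval π lam _)
      (hC d).isClosed.measurableSet.compl, hP]
    exact hCδ d

/-- A finite cylinder measure with Radon marginals measures all Borel sets up to null sets, for
countable cofinality. -/
lemma nullMeasurableSet_projLimOn_of_borel [Preorder ι]
    [∀ i, TopologicalSpace (X i)] [∀ i, T2Space (X i)]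
    [∀ i, MeasurableSpace (X i)] [∀ i, BorelSpace (X i)]
    (π : ∀ ⦃i j : ι⦄, i ≤ j → X j → X i) (hcont : ∀ ⦃i j : ι⦄ (h : i ≤ j), Continuous (π h))
    (μ : ∀ i, Measure (X i)) (hprob : ∀ i, IsProbabilityMeasure (μ i))
    (hRadon : ∀ i, IsRadon (μ i)) {lam : Set ι} (hlam : MemLambda lam)
    (P : Measure (ProjLimOn π lam)) (hP : ∀ i : lam, P.map (fun x => x.1 i) = μ i) :
    ∀ M, MeasurableSet[borel (ProjLimOn π lam)] M → NullMeasurableSet M P := by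
  change borel (ProjLimOn π lam) ≤ (inferInstance : MeasurableSpace (NullMeasurableSpace _ P))
  rw [borel_eq_generateFrom_isClosed]
  refine MeasurableSpace.generateFrom_le fun F hF => ?_
  choose K hK hKε using fun n : ℕ => exists_isCompact_projLimOn_compl_lt π hcont μ hprob hRadon
    hlam P hP (ε := ((n : ℝ≥0∞) + 1)⁻¹) (by simp)
  have hnull : P (⋃ n, K n)ᶜ = 0 := by
    refine le_antisymm (ENNReal.le_of_forall_pos_le_add fun ε hε _ => ?_) zero_le
    obtain ⟨n, hn⟩ := ENNReal.exists_inv_nat_lt (a := (ε : ℝ≥0∞)) (by simpa using hε.ne')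
    rw [zero_add]
    calc P (⋃ n, K n)ᶜ ≤ P (K n)ᶜ :=
          measure_mono (Set.compl_subset_compl.2 (Set.subset_iUnion K n))
      _ ≤ ((n : ℝ≥0∞) + 1)⁻¹ := (hKε n).le
      _ ≤ (n : ℝ≥0∞)⁻¹ := ENNReal.inv_le_inv.2 le_self_add
      _ ≤ ε := hn.le
  have hsplit : F = (⋃ n, F ∩ K n) ∪ F ∩ (⋃ n, K n)ᶜ := by
    rw [← Set.inter_iUnion, Set.inter_union_compl]
  change NullMeasurableSet F P
  rw [hsplit]
  refine NullMeasurableSet.union ?_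
    (NullMeasurableSet.of_null (measure_mono_null Set.inter_subset_right hnull))
  exact (MeasurableSet.iUnion fun n => measurableSet_of_isCompact_projLimOn π hlam
    ((hK n).inter_left hF)).nullMeasurableSet

/-- `μlam` is a Borel probability measure on the projective limit over `lam` with marginals `μ`
that does not charge Borel sets missing the image of the full projective limit. -/
def IsThickExtension [Preorder ι] [∀ i, TopologicalSpace (X i)] [∀ i, MeasurableSpace (X i)]
    (π : ∀ ⦃i j : ι⦄, i ≤ j → X j → X i) (μ : ∀ i, Measure (X i)) (lam : Set ι)
    (μlam : @Measure (ProjLimOn π lam) (borel (ProjLimOn π lam))) : Prop :=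
  μlam Set.univ = 1 ∧
    (∀ i : lam,
      @Measure.map (ProjLimOn π lam) (X i) (borel (ProjLimOn π lam)) _
        (fun x : ProjLimOn π lam => x.1 i) μlam = μ i) ∧
    (∀ M : Set (ProjLimOn π lam), MeasurableSet[borel (ProjLimOn π lam)] M →
      M ∩ Set.range (restrictToSub π lam) = ∅ → μlam M = 0)

lemma exists_isThickExtension_of_cylinderMeasure [Preorder ι]
    [∀ i, TopologicalSpace (X i)] [∀ i, T2Space (X i)]
    [∀ i, MeasurableSpace (X i)] [∀ i, BorelSpace (X i)]
    (π : ∀ ⦃i j : ι⦄, i ≤ j → X j → X i) (hcont : ∀ ⦃i j : ι⦄ (h : i ≤ j), Continuous (π h))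
    (μ : ∀ i, Measure (X i)) (hprob : ∀ i, IsProbabilityMeasure (μ i))
    (hRadon : ∀ i, IsRadon (μ i)) (ν : Measure (ProjLim π)) (hν : ν Set.univ = 1)
    (hmarg : ∀ i : ι, ν.map (fun x : ProjLim π => x.1 i) = μ i)
    {lam : Set ι} (hlam : MemLambda lam) : ∃ μlam, IsThickExtension π μ lam μlam := by
  have hr := measurable_restrictToSub π lam
  set P := ν.map (restrictToSub π lam) with hPdef
  have hP : ∀ i : lam, P.map (fun x => x.1 i) = μ i := fun i => by
    rw [hPdef, Measure.map_map (measurable_projLimOn_eval π lam i) hr]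
    exact hmarg i
  have hnull := nullMeasurableSet_projLimOn_of_borel π hcont μ hprob hRadon hlam P hP
  obtain ⟨Q, happ⟩ := exists_measure_apply_eq_of_nullMeasurableSet (borel _) P hnull
  refine ⟨Q, ?_, fun i => ?_, fun M hM hdisj => ?_⟩
  · rw [happ _ (@MeasurableSet.univ _ (borel _)), hPdef, Measure.map_apply hr MeasurableSet.univ,
      Set.preimage_univ, hν]
  · have hmeas : @Measurable _ _ (borel (ProjLimOn π lam)) _
        (fun x : ProjLimOn π lam => x.1 i) :=
      (continuous_projLimOn_eval π lam i).measurable_borel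
    refine Measure.ext fun B hB => ?_
    rw [@Measure.map_apply _ _ (borel _) _ _ _ hmeas _ hB, happ _ (hmeas hB), ← hP i,
      Measure.map_apply (measurable_projLimOn_eval π lam i) hB]
  · rw [happ M hM]
    obtain ⟨N, hNM, hN, hae⟩ := (hnull M hM).exists_measurable_subset_ae_eq
    rw [← measure_congr hae, hPdef, Measure.map_apply hr hN]
    have : restrictToSub π lam ⁻¹' N = ∅ := Set.eq_empty_of_forall_notMem fun x hx =>
      Set.eq_empty_iff_forall_notMem.1 hdisj _ ⟨hNM hx, x, rfl⟩
    rw [this, measure_empty]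

/-- The cylinder sets of the projective limit. -/
def cylinders [Preorder ι] [∀ i, MeasurableSpace (X i)]
    (π : ∀ ⦃i j : ι⦄, i ≤ j → X j → X i) : Set (Set (ProjLim π)) :=
  {A | ∃ (i : ι) (B : Set (X i)), MeasurableSet B ∧ A = (fun x : ProjLim π => x.1 i) ⁻¹' B}

lemma generateFrom_cylinders [Preorder ι] [∀ i, MeasurableSpace (X i)]
    (π : ∀ ⦃i j : ι⦄, i ≤ j → X j → X i) :
    (inferInstance : MeasurableSpace (ProjLim π)) =
      MeasurableSpace.generateFrom (cylinders π) := by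
  refine le_antisymm ?_ (MeasurableSpace.generateFrom_le ?_)
  · change MeasurableSpace.comap _ (⨆ i, MeasurableSpace.comap _ _) ≤ _
    rw [MeasurableSpace.comap_iSup, iSup_le_iff]
    intro i
    rw [MeasurableSpace.comap_comp]
    rintro _ ⟨B, hB, rfl⟩
    exact MeasurableSpace.measurableSet_generateFrom ⟨i, B, hB, rfl⟩
  · rintro _ ⟨i, B, hB, rfl⟩
    exact measurable_projLim_eval π i hB

lemma preimage_eval_eq [Preorder ι] (π : ∀ ⦃i j : ι⦄, i ≤ j → X j → X i) {i j : ι} (h : i ≤ j)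
    (B : Set (X i)) :
    (fun x : ProjLim π => x.1 i) ⁻¹' B = (fun x : ProjLim π => x.1 j) ⁻¹' (π h ⁻¹' B) := by
  ext x
  simp only [Set.mem_preimage, x.2 h]

lemma isPiSystem_cylinders [Preorder ι] [IsDirected ι (· ≤ ·)] [∀ i, MeasurableSpace (X i)]
    (π : ∀ ⦃i j : ι⦄, i ≤ j → X j → X i) (hmeas : ∀ ⦃i j : ι⦄ (h : i ≤ j), Measurable (π h)) :
    IsPiSystem (cylinders π) := by
  rintro _ ⟨i, B, hB, rfl⟩ _ ⟨j, C, hC, rfl⟩ -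
  obtain ⟨k, hik, hjk⟩ := directed_of (· ≤ ·) i j
  exact ⟨k, π hik ⁻¹' B ∩ π hjk ⁻¹' C, (hmeas hik hB).inter (hmeas hjk hC), by
    rw [preimage_eval_eq π hik, preimage_eval_eq π hjk, Set.preimage_inter]⟩

lemma cylinderMeasure_ext [Preorder ι] [IsDirected ι (· ≤ ·)] [∀ i, MeasurableSpace (X i)]
    (π : ∀ ⦃i j : ι⦄, i ≤ j → X j → X i) (hmeas : ∀ ⦃i j : ι⦄ (h : i ≤ j), Measurable (π h))
    {ν₁ ν₂ : Measure (ProjLim π)} (h₁ : ν₁ Set.univ = 1) (h₂ : ν₂ Set.univ = 1)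
    (h : ∀ i : ι, ν₁.map (fun x : ProjLim π => x.1 i) = ν₂.map (fun x => x.1 i)) :
    ν₁ = ν₂ := by
  have : IsFiniteMeasure ν₁ := ⟨by simp [h₁]⟩
  refine ext_of_generate_finite _ (generateFrom_cylinders π) (isPiSystem_cylinders π hmeas) ?_
    (h₁.trans h₂.symm)
  rintro _ ⟨i, B, hB, rfl⟩
  rw [← Measure.map_apply (measurable_projLim_eval π i) hB, h,
    Measure.map_apply (measurable_projLim_eval π i) hB]

lemma exists_seq_forall_le [Preorder ι] [IsDirected ι (· ≤ ·)] (i : ι) (j : ℕ → ι) :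
    ∃ s : ℕ → ι, Monotone s ∧ i ≤ s 0 ∧ ∀ n, j n ≤ s n := by
  choose ub hl hr using fun a b : ι => directed_of (· ≤ ·) a b
  let s : ℕ → ι := fun n => n.rec (ub i (j 0)) fun n t => ub t (j (n + 1))
  refine ⟨s, monotone_nat_of_le_succ fun n => hl _ _, hl _ _, fun n => ?_⟩
  cases n <;> exact hr _ _

/-- Countable subadditivity of the marginals along covers of cylinder sets. -/
lemma measure_le_tsum_of_cylinder_cover [Preorder ι] [IsDirected ι (· ≤ ·)]
    [∀ i, TopologicalSpace (X i)] [∀ i, MeasurableSpace (X i)] [∀ i, BorelSpace (X i)]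
    (π : ∀ ⦃i j : ι⦄, i ≤ j → X j → X i) (μ : ∀ i, Measure (X i))
    (hthick : ∀ lam : Set ι, MemLambda lam → ∃ μlam, IsThickExtension π μ lam μlam)
    {i : ι} {B : Set (X i)} (hB : MeasurableSet B) (j : ℕ → ι) (C : ∀ n, Set (X (j n)))
    (hC : ∀ n, MeasurableSet (C n))
    (hcover : (fun x : ProjLim π => x.1 i) ⁻¹' B ⊆
      ⋃ n, (fun x : ProjLim π => x.1 (j n)) ⁻¹' C n) :
    μ i B ≤ ∑' n, μ (j n) (C n) := by
  obtain ⟨s, hs, his, hjs⟩ := exists_seq_forall_le i j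
  let lam : Set ι := {k | ∃ n, k ≤ s n}
  have hlam : MemLambda lam := by
    refine ⟨Set.range s, ?_, Set.countable_range s, ?_, ?_⟩
    · rintro _ ⟨n, rfl⟩
      exact ⟨n, le_rfl⟩
    · exact directedOn_range.2 hs.directed_le
    · rintro k ⟨n, hn⟩
      exact ⟨s n, ⟨n, rfl⟩, hn⟩
  obtain ⟨P, -, hP, hPnull⟩ := hthick lam hlam
  have hmeas : ∀ k : lam, @Measurable _ _ (borel (ProjLimOn π lam)) _
      (fun x : ProjLimOn π lam => x.1 k) :=
    fun k => (continuous_projLimOn_eval π lam k).measurable_borel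
  have happ : ∀ (k : lam) (A : Set (X k)), MeasurableSet A →
      μ k A = P ((fun x : ProjLimOn π lam => x.1 k) ⁻¹' A) := fun k A hA => by
    rw [← hP k, @Measure.map_apply _ _ (borel _) _ _ _ (hmeas k) _ hA]
  let i' : lam := ⟨i, 0, his⟩
  let j' : ℕ → lam := fun n => ⟨j n, n, hjs n⟩
  let E := (fun x : ProjLimOn π lam => x.1 i') ⁻¹' B
  let F := ⋃ n, (fun x : ProjLimOn π lam => x.1 (j' n)) ⁻¹' C n
  have hdiff : P (E \ F) = 0 := by
    refine hPnull _ (@MeasurableSet.diff _ (borel _) _ _ (hmeas i' hB)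
      (@MeasurableSet.iUnion _ _ (borel _) _ _ fun n => hmeas (j' n) (hC n))) ?_
    refine Set.eq_empty_of_forall_notMem ?_
    rintro _ ⟨⟨hx, hx'⟩, x, rfl⟩
    obtain ⟨n, hn⟩ := Set.mem_iUnion.1 (hcover (show x ∈ _ from hx))
    exact hx' (Set.mem_iUnion.2 ⟨n, hn⟩)
  calc μ i B = P E := happ i' B hB
    _ ≤ P (E \ F ∪ F) := measure_mono (by rw [Set.sdiff_union_self]; exact Set.subset_union_left)
    _ ≤ P (E \ F) + P F := measure_union_le _ _
    _ = P F := by rw [hdiff, zero_add]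
    _ ≤ ∑' n, P ((fun x : ProjLimOn π lam => x.1 (j' n)) ⁻¹' C n) := measure_iUnion_le _
    _ = ∑' n, μ (j n) (C n) := tsum_congr fun n => (happ (j' n) _ (hC n)).symm

/-- The infimum of the marginal measures of the cylinder sets containing a given set. -/
noncomputable def cylinderContent [Preorder ι] [∀ i, MeasurableSpace (X i)]
    (π : ∀ ⦃i j : ι⦄, i ≤ j → X j → X i) (μ : ∀ i, Measure (X i)) (t : Set (ProjLim π)) : ℝ≥0∞ :=
  ⨅ (i : ι) (B : Set (X i)) (_ : MeasurableSet B ∧ t ⊆ (fun x : ProjLim π => x.1 i) ⁻¹' B), μ i B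

lemma cylinderContent_le [Preorder ι] [∀ i, MeasurableSpace (X i)]
    (π : ∀ ⦃i j : ι⦄, i ≤ j → X j → X i) (μ : ∀ i, Measure (X i)) {t : Set (ProjLim π)}
    {i : ι} {B : Set (X i)} (hB : MeasurableSet B)
    (ht : t ⊆ (fun x : ProjLim π => x.1 i) ⁻¹' B) : cylinderContent π μ t ≤ μ i B :=
  iInf_le_of_le i (iInf₂_le B ⟨hB, ht⟩)

lemma cylinderContent_empty [Preorder ι] [Nonempty ι] [∀ i, MeasurableSpace (X i)]
    (π : ∀ ⦃i j : ι⦄, i ≤ j → X j → X i) (μ : ∀ i, Measure (X i)) :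
    cylinderContent π μ ∅ = 0 := by
  obtain ⟨i⟩ := ‹Nonempty ι›
  exact le_antisymm ((cylinderContent_le π μ (MeasurableSet.empty (α := X i))
    (Set.empty_subset _)).trans_eq measure_empty) zero_le

lemma exists_measure_lt_cylinderContent_add [Preorder ι] [Nonempty ι]
    [∀ i, MeasurableSpace (X i)]
    (π : ∀ ⦃i j : ι⦄, i ≤ j → X j → X i) (μ : ∀ i, Measure (X i))
    (hprob : ∀ i, IsProbabilityMeasure (μ i)) (t : Set (ProjLim π)) {ε : ℝ≥0∞} (hε : ε ≠ 0) :
    ∃ (i : ι) (B : Set (X i)), MeasurableSet B ∧ t ⊆ (fun x : ProjLim π => x.1 i) ⁻¹' B ∧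
      μ i B < cylinderContent π μ t + ε := by
  have hfin : cylinderContent π μ t ≠ ∞ := by
    obtain ⟨i⟩ := ‹Nonempty ι›
    exact ((cylinderContent_le π μ (MeasurableSet.univ (α := X i))
      (Set.subset_univ _)).trans_lt (measure_lt_top _ _)).ne
  have hlt := ENNReal.lt_add_right hfin hε
  conv_lhs at hlt => rw [cylinderContent]
  simp only [iInf_lt_iff] at hlt
  obtain ⟨i, B, ⟨hB, ht⟩, h⟩ := hlt
  exact ⟨i, B, hB, ht, h⟩

lemma exists_cylinderMeasure [Preorder ι] [Nonempty ι] [IsDirected ι (· ≤ ·)]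
    [∀ i, TopologicalSpace (X i)] [∀ i, MeasurableSpace (X i)] [∀ i, BorelSpace (X i)]
    (π : ∀ ⦃i j : ι⦄, i ≤ j → X j → X i) (hmeas : ∀ ⦃i j : ι⦄ (h : i ≤ j), Measurable (π h))
    (μ : ∀ i, Measure (X i)) (hprob : ∀ i, IsProbabilityMeasure (μ i))
    (hexact : ∀ ⦃i j : ι⦄ (h : i ≤ j), (μ j).map (π h) = μ i)
    (hthick : ∀ lam : Set ι, MemLambda lam → ∃ μlam, IsThickExtension π μ lam μlam) :
    ∃ ν : Measure (ProjLim π), ∀ i : ι, ν.map (fun x : ProjLim π => x.1 i) = μ i := by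
  let O := OuterMeasure.ofFunction (cylinderContent π μ) (cylinderContent_empty π μ)
  have hcar : (inferInstance : MeasurableSpace (ProjLim π)) ≤ O.caratheodory := by
    rw [generateFrom_cylinders π]
    refine MeasurableSpace.generateFrom_le ?_
    rintro _ ⟨i, B, hB, rfl⟩
    refine OuterMeasure.ofFunction_caratheodory fun t => ?_
    refine le_iInf fun j => le_iInf₂ fun C hC => ?_
    obtain ⟨k, hik, hjk⟩ := directed_of (· ≤ ·) i j
    have hB' := hmeas hik hB
    have hC' := hmeas hjk hC.1
    have ht := hC.2
    rw [preimage_eval_eq π hjk] at ht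
    rw [preimage_eval_eq π hik]
    calc _ ≤ μ k (π hjk ⁻¹' C ∩ π hik ⁻¹' B) + μ k (π hjk ⁻¹' C \ π hik ⁻¹' B) :=
          add_le_add
            (cylinderContent_le π μ (hC'.inter hB') (Set.inter_subset_inter_left _ ht))
            (cylinderContent_le π μ (hC'.diff hB') (Set.sdiff_subset_sdiff_left ht))
      _ = μ j C := by
          rw [measure_inter_add_sdiff _ hB', ← hexact hjk, Measure.map_apply (hmeas hjk) hC.1]
  refine ⟨O.toMeasure hcar, fun i => Measure.ext fun B hB => ?_⟩
  have hev := measurable_projLim_eval π i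
  rw [Measure.map_apply hev hB, toMeasure_apply O hcar (hev hB)]
  refine le_antisymm ((OuterMeasure.ofFunction_le _).trans
    (cylinderContent_le π μ hB subset_rfl)) ?_
  rw [OuterMeasure.ofFunction_apply]
  refine le_iInf₂ fun t ht => ENNReal.le_of_forall_pos_le_add fun ε hε _ => ?_
  obtain ⟨δ, hδ, hδε⟩ := ENNReal.exists_pos_sum_of_countable' (ε := (ε : ℝ≥0∞))
    (by simpa using hε.ne') ℕ
  choose j C hC htC hlt using fun n =>
    exists_measure_lt_cylinderContent_add π μ hprob (t n) (hδ n).ne'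
  calc μ i B ≤ ∑' n, μ (j n) (C n) := measure_le_tsum_of_cylinder_cover π μ hthick hB j C hC
        (ht.trans (Set.iUnion_mono htC))
    _ ≤ ∑' n, (cylinderContent π μ (t n) + δ n) := ENNReal.tsum_le_tsum fun n => (hlt n).le
    _ = ∑' n, cylinderContent π μ (t n) + ∑' n, δ n := ENNReal.tsum_add
    _ ≤ ∑' n, cylinderContent π μ (t n) + ε := by gcongr

/-- There is a unique probability measure on the cylinder σ-algebra of the projective limit
with the prescribed pushforwards iff the family `{μ_λ : λ ∈ Λ}` of the (unique) Borel
extensions to the countably-cofinal subsystems is thick. -/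
theorem unique_cylinder_extension_iff_thick
    [PartialOrder ι] [IsDirected ι (· ≤ ·)]
    [∀ i, TopologicalSpace (X i)] [∀ i, T2Space (X i)]
    [∀ i, MeasurableSpace (X i)] [∀ i, BorelSpace (X i)]
    (π : ∀ ⦃i j : ι⦄, i ≤ j → X j → X i)
    (hcont : ∀ ⦃i j : ι⦄ (h : i ≤ j), Continuous (π h))
    (hid : ∀ (i : ι) (x : X i), π (le_refl i) x = x)
    (hcomp : ∀ ⦃i j k : ι⦄ (hij : i ≤ j) (hjk : j ≤ k) (x : X k),
      π hij (π hjk x) = π (hij.trans hjk) x)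
    (μ : ∀ i, Measure (X i))
    (hprob : ∀ i, IsProbabilityMeasure (μ i))
    (hRadon : ∀ i, IsRadon (μ i))
    (hexact : ∀ ⦃i j : ι⦄ (h : i ≤ j), (μ j).map (π h) = μ i) :
    (∃! ν : Measure (ProjLim π),
        ν Set.univ = 1 ∧ ∀ i : ι, ν.map (fun x : ProjLim π => x.1 i) = μ i) ↔
      (∀ lam : Set ι, MemLambda lam →
        ∃ μlam : @Measure (ProjLimOn π lam) (borel (ProjLimOn π lam)),
          μlam Set.univ = 1 ∧
            (∀ i : lam,
              @Measure.map (ProjLimOn π lam) (X i) (borel (ProjLimOn π lam)) _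
                (fun x : ProjLimOn π lam => x.1 i) μlam = μ i) ∧
            (∀ M : Set (ProjLimOn π lam), MeasurableSet[borel (ProjLimOn π lam)] M →
              M ∩ Set.range (restrictToSub π lam) = ∅ → μlam M = 0)) := by
  have hmeas : ∀ ⦃i j : ι⦄ (h : i ≤ j), Measurable (π h) := fun _ _ h => (hcont h).measurable
  constructor
  · rintro ⟨ν, ⟨hν, hmarg⟩, -⟩ lam hlam
    exact exists_isThickExtension_of_cylinderMeasure π hcont μ hprob hRadon ν hν hmarg hlam
  · intro hthick
    refine existsUnique_of_exists_of_unique ?_ fun ν₁ ν₂ h₁ h₂ =>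
      cylinderMeasure_ext π hmeas h₁.1 h₂.1 fun i => (h₁.2 i).trans (h₂.2 i).symm
    rcases isEmpty_or_nonempty ι with hι | ⟨⟨i⟩⟩
    · exact ⟨Measure.dirac ⟨isEmptyElim, fun i => isEmptyElim i⟩, measure_univ, isEmptyElim⟩
    · have : Nonempty ι := ⟨i⟩
      obtain ⟨ν, hν⟩ := exists_cylinderMeasure π hmeas μ hprob hexact hthick
      refine ⟨ν, ?_, hν⟩
      have := hprob i
      rw [← measure_univ (μ := μ i), ← hν i,
        Measure.map_apply (measurable_projLim_eval π i) MeasurableSet.univ, Set.preimage_univ]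

end Stmt5
end

section
/- Let (I, ≤) be a directed partially ordered set, {(X_i, τ_i), π_{i,j}, I} a projective system of Hausdorff topological spaces with projective limit X_I, and {μ_i : i ∈ I} an exact projective system of Radon probability measures. Then there exists a unique Radon probability measure ν on X_I (on the Borel σ-algebra of the projective limit topology) such that (π_i)_# ν = μ_i for all i ∈ I if and only if {μ_i : i ∈ I} fulfills Prokhorov's condition: for every ε > 0 there exists a compact set C_ε ⊆ X_I such that μ_i(π_i(C_ε)) ≥ 1 − ε for all i ∈ I. -/
open MeasureTheory
open scoped ENNReal

namespace Stmt6

variable {ι : Type*} {X : ι → Type*}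

/-- The projective (inverse) limit of a projective system of spaces `X i`. -/
def ProjLim [Preorder ι] (π : ∀ ⦃i j : ι⦄, i ≤ j → X j → X i) : Set (∀ i, X i) :=
  {x | ∀ ⦃i j : ι⦄ (h : i ≤ j), π h (x j) = x i}

/-- A Radon measure: locally finite and inner regular w.r.t. compact sets. -/
def IsRadon {α : Type*} [TopologicalSpace α] [MeasurableSpace α] (μ : Measure α) : Prop :=
  IsLocallyFiniteMeasure μ ∧ μ.InnerRegular

/-- A tight outer regular finite measure is inner regular with respect to compact sets. -/
theorem innerRegular_of_outerRegular_of_tight {Y : Type*} [TopologicalSpace Y]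
    [MeasurableSpace Y] (ν : Measure Y) [IsFiniteMeasure ν] [ν.OuterRegular]
    (h : ∀ ε : ℝ≥0∞, 0 < ε → ∃ C : Set Y, IsCompact C ∧ ν Cᶜ ≤ ε) : ν.InnerRegular := by
  refine ⟨fun A hA r hr => ?_⟩
  have hε : 0 < (ν A - r) / 2 := ENNReal.half_pos (tsub_pos_of_lt hr).ne'
  obtain ⟨U, hAU, hU, -, hUA⟩ := hA.compl.exists_isOpen_sdiff_lt (measure_ne_top ν _) hε.ne'
  obtain ⟨C, hC, hCε⟩ := h _ hε
  refine ⟨C \ U, fun x hx => by_contra fun hxA => hx.2 (hAU hxA), hC.diff hU, ?_⟩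
  by_contra! hle
  have hcover : A ⊆ (C \ U) ∪ ((U \ Aᶜ) ∪ Cᶜ) := by
    intro x hx
    by_cases hxU : x ∈ U <;> by_cases hxC : x ∈ C <;> simp [hx, hxU, hxC]
  have : ν A < ν A := calc
    ν A ≤ ν (C \ U) + (ν (U \ Aᶜ) + ν Cᶜ) := (measure_mono hcover).trans <|
      (measure_union_le _ _).trans (add_le_add_right (measure_union_le _ _) _)
    _ < r + ((ν A - r) / 2 + (ν A - r) / 2) :=
      ENNReal.add_lt_add_of_le_of_lt (measure_ne_top ν _) hle
        (ENNReal.add_lt_add_of_lt_of_le (measure_ne_top ν _) hUA hCε)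
    _ = ν A := by rw [ENNReal.add_halves, add_tsub_cancel_of_le hr.le]
  exact this.false

section Cone

variable {Y : Type*} {p : ∀ i, Y → X i}

/-- The infimum over all indices of the masses of the projections of `K`. -/
noncomputable def infProjMass [∀ i, MeasurableSpace (X i)] (p : ∀ i, Y → X i)
    (μ : ∀ i, Measure (X i)) (K : Set Y) : ℝ≥0∞ :=
  ⨅ i, μ i (p i '' K)

theorem infProjMass_mono [∀ i, MeasurableSpace (X i)] {μ : ∀ i, Measure (X i)}
    {K L : Set Y} (h : K ⊆ L) : infProjMass p μ K ≤ infProjMass p μ L :=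
  iInf_mono fun _ => measure_mono (Set.image_mono h)

theorem infProjMass_ne_top [Nonempty ι] [∀ i, MeasurableSpace (X i)] {μ : ∀ i, Measure (X i)}
    [∀ i, IsProbabilityMeasure (μ i)] (K : Set Y) :
    infProjMass p μ K ≠ ∞ :=
  ne_top_of_le_ne_top (measure_ne_top _ _) (iInf_le _ (Classical.arbitrary ι))

variable [Preorder ι] {π : ∀ ⦃i j : ι⦄, i ≤ j → X j → X i}
  [TopologicalSpace Y] [∀ i, TopologicalSpace (X i)] [∀ i, T2Space (X i)]

/-- If the projections separate points, disjoint compact sets have disjoint projections from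
some index on. -/
theorem exists_forall_le_disjoint_image [IsDirected ι (· ≤ ·)] [Nonempty ι]
    (hp : ∀ i, Continuous (p i)) (hπp : ∀ ⦃i j⦄ (h : i ≤ j) y, π h (p j y) = p i y)
    (hsep : ∀ x y, (∀ i, p i x = p i y) → x = y)
    {K L : Set Y} (hK : IsCompact K) (hL : IsCompact L) (hKL : Disjoint K L) :
    ∃ i, ∀ j, i ≤ j → Disjoint (p j '' K) (p j '' L) := by
  have mono : ∀ ⦃i j⦄, i ≤ j → ∀ x y, p j x = p j y → p i x = p i y := fun i j h x y e => by
    rw [← hπp h x, ← hπp h y, e]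
  obtain ⟨i, hi⟩ := (hK.prod hL).elim_directed_family_closed
    (fun i => {z : Y × Y | p i z.1 = p i z.2})
    (fun i => isClosed_eq ((hp i).comp continuous_fst) ((hp i).comp continuous_snd))
    (by
      rw [Set.eq_empty_iff_forall_notMem]
      rintro ⟨x, y⟩ ⟨⟨hx, hy⟩, hxy⟩
      have : x = y := hsep x y fun i => Set.mem_iInter.1 hxy i
      exact Set.disjoint_left.1 hKL hx (this ▸ hy))
    (fun i j => by
      obtain ⟨k, hik, hjk⟩ := exists_ge_ge i j
      exact ⟨k, fun z hz => mono hik _ _ hz, fun z hz => mono hjk _ _ hz⟩)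
  refine ⟨i, fun j hij => Set.disjoint_left.2 ?_⟩
  rintro _ ⟨x, hx, rfl⟩ ⟨y, hy, hxy⟩
  exact (Set.eq_empty_iff_forall_notMem.1 hi) (x, y) ⟨⟨hx, hy⟩, mono hij _ _ hxy.symm⟩

variable [∀ i, MeasurableSpace (X i)] [∀ i, BorelSpace (X i)] {μ : ∀ i, Measure (X i)}

theorem antitone_measure_image (hcont : ∀ ⦃i j⦄ (h : i ≤ j), Continuous (π h))
    (hπp : ∀ ⦃i j⦄ (h : i ≤ j) y, π h (p j y) = p i y) (hp : ∀ i, Continuous (p i))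
    (hexact : ∀ ⦃i j : ι⦄ (h : i ≤ j), (μ j).map (π h) = μ i) {K : Set Y} (hK : IsCompact K) :
    Antitone fun i => μ i (p i '' K) := by
  intro i j h
  dsimp only
  rw [← hexact h, Measure.map_apply (hcont h).measurable (hK.image (hp i)).measurableSet]
  refine measure_mono ?_
  rintro _ ⟨y, hy, rfl⟩
  exact ⟨y, hy, (hπp h y).symm⟩

theorem infProjMass_union_le [IsDirected ι (· ≤ ·)]
    (hcont : ∀ ⦃i j⦄ (h : i ≤ j), Continuous (π h))
    (hπp : ∀ ⦃i j⦄ (h : i ≤ j) y, π h (p j y) = p i y) (hp : ∀ i, Continuous (p i))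
    (hexact : ∀ ⦃i j : ι⦄ (h : i ≤ j), (μ j).map (π h) = μ i) {K L : Set Y} (hK : IsCompact K)
    (hL : IsCompact L) :
    infProjMass p μ (K ∪ L) ≤ infProjMass p μ K + infProjMass p μ L := by
  refine ENNReal.le_iInf_add_iInf fun i j => ?_
  obtain ⟨k, hik, hjk⟩ := exists_ge_ge i j
  calc infProjMass p μ (K ∪ L) ≤ μ k (p k '' (K ∪ L)) := iInf_le _ k
    _ ≤ μ k (p k '' K) + μ k (p k '' L) := by rw [Set.image_union]; exact measure_union_le _ _
    _ ≤ μ i (p i '' K) + μ j (p j '' L) :=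
      add_le_add (antitone_measure_image hcont hπp hp hexact hK hik)
        (antitone_measure_image hcont hπp hp hexact hL hjk)

theorem infProjMass_union [IsDirected ι (· ≤ ·)] [Nonempty ι]
    (hcont : ∀ ⦃i j⦄ (h : i ≤ j), Continuous (π h))
    (hπp : ∀ ⦃i j⦄ (h : i ≤ j) y, π h (p j y) = p i y) (hp : ∀ i, Continuous (p i))
    (hsep : ∀ x y, (∀ i, p i x = p i y) → x = y)
    (hexact : ∀ ⦃i j : ι⦄ (h : i ≤ j), (μ j).map (π h) = μ i) {K L : Set Y} (hK : IsCompact K)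
    (hL : IsCompact L) (hKL : Disjoint K L) :
    infProjMass p μ (K ∪ L) = infProjMass p μ K + infProjMass p μ L := by
  refine (infProjMass_union_le hcont hπp hp hexact hK hL).antisymm (le_iInf fun j => ?_)
  obtain ⟨i, hi⟩ := exists_forall_le_disjoint_image hp hπp hsep hK hL hKL
  obtain ⟨k, hik, hjk⟩ := exists_ge_ge i j
  calc infProjMass p μ K + infProjMass p μ L ≤ μ k (p k '' K) + μ k (p k '' L) :=
        add_le_add (iInf_le _ k) (iInf_le _ k)
    _ = μ k (p k '' (K ∪ L)) := by
      rw [Set.image_union, measure_union (hi k hik) (hL.image (hp k)).measurableSet]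
    _ ≤ μ j (p j '' (K ∪ L)) := antitone_measure_image hcont hπp hp hexact (hK.union hL) hjk

/-- The content on the compact subsets of a cone given by `infProjMass`. -/
noncomputable def projContent [IsDirected ι (· ≤ ·)] [Nonempty ι]
    [∀ i, IsProbabilityMeasure (μ i)]
    (hcont : ∀ ⦃i j⦄ (h : i ≤ j), Continuous (π h))
    (hπp : ∀ ⦃i j⦄ (h : i ≤ j) y, π h (p j y) = p i y) (hp : ∀ i, Continuous (p i))
    (hsep : ∀ x y, (∀ i, p i x = p i y) → x = y)
    (hexact : ∀ ⦃i j : ι⦄ (h : i ≤ j), (μ j).map (π h) = μ i) : Content Y where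
  toFun K := (infProjMass p μ K).toNNReal
  mono' K L h := ENNReal.toNNReal_mono (infProjMass_ne_top _) (infProjMass_mono h)
  sup_disjoint' K L h _ _ := by
    rw [← ENNReal.toNNReal_add (infProjMass_ne_top _) (infProjMass_ne_top _),
      ← infProjMass_union hcont hπp hp hsep hexact K.isCompact L.isCompact h,
      TopologicalSpace.Compacts.coe_sup]
  sup_le' K L := by
    rw [← ENNReal.toNNReal_add (infProjMass_ne_top _) (infProjMass_ne_top _),
      TopologicalSpace.Compacts.coe_sup]
    exact ENNReal.toNNReal_mono
      (ENNReal.add_ne_top.2 ⟨infProjMass_ne_top _, infProjMass_ne_top _⟩)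
      (infProjMass_union_le hcont hπp hp hexact K.isCompact L.isCompact)

variable [T2Space Y] [MeasurableSpace Y] [BorelSpace Y]

/-- Under the tightness condition, the compatible measures extend to a Radon measure. -/
theorem exists_radon_extension [IsDirected ι (· ≤ ·)] [Nonempty ι]
    (hμ : ∀ i, IsProbabilityMeasure (μ i)) (hRadon : ∀ i, (μ i).InnerRegular)
    (hcont : ∀ ⦃i j⦄ (h : i ≤ j), Continuous (π h))
    (hπp : ∀ ⦃i j⦄ (h : i ≤ j) y, π h (p j y) = p i y) (hp : ∀ i, Continuous (p i))
    (hsep : ∀ x y, (∀ i, p i x = p i y) → x = y)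
    (hexact : ∀ ⦃i j : ι⦄ (h : i ≤ j), (μ j).map (π h) = μ i)
    (htight : ∀ ε : ℝ≥0∞, 0 < ε → ∃ C : Set Y, IsCompact C ∧ ∀ i, 1 - ε ≤ μ i (p i '' C)) :
    ∃ ν : Measure Y, IsProbabilityMeasure ν ∧ ν.InnerRegular ∧ ∀ i, ν.map (p i) = μ i := by
  set c := projContent hcont hπp hp hsep hexact
  have c_apply : ∀ K : TopologicalSpace.Compacts Y, c K = infProjMass p μ K := fun K =>
    ENNReal.coe_toNNReal (infProjMass_ne_top _)
  have le_open : ∀ i (U : Set (X i)), IsOpen U → c.measure (p i ⁻¹' U) ≤ μ i U := by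
    intro i U hU
    have hU' := hU.preimage (hp i)
    rw [c.measure_apply hU'.measurableSet, c.outerMeasure_of_isOpen _ hU']
    refine iSup₂_le fun K hK => ?_
    rw [c_apply]
    exact (iInf_le _ i).trans (measure_mono (Set.image_subset_iff.2 hK))
  have tight : ∀ ε : ℝ≥0∞, 0 < ε → ∃ C : Set Y, IsCompact C ∧ 1 - ε ≤ c.measure C := by
    intro ε hε
    obtain ⟨C, hC, h⟩ := htight ε hε
    refine ⟨C, hC, ?_⟩
    rw [c.measure_apply hC.measurableSet]
    refine le_trans ?_ (c.le_outerMeasure_compacts ⟨C, hC⟩)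
    rw [c_apply]
    exact le_iInf h
  have hprob : IsProbabilityMeasure c.measure := by
    refine ⟨le_antisymm ?_ ?_⟩
    · simpa using le_open (Classical.arbitrary ι) Set.univ isOpen_univ
    · refine ENNReal.le_of_forall_pos_le_add fun ε hε _ => ?_
      obtain ⟨C, hC, h⟩ := tight ε (by exact_mod_cast hε)
      exact tsub_le_iff_right.1 (h.trans (measure_mono (Set.subset_univ C)))
  refine ⟨c.measure, hprob, innerRegular_of_outerRegular_of_tight _ fun ε hε => ?_, fun i => ?_⟩
  · obtain ⟨C, hC, h⟩ := tight ε hε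
    refine ⟨C, hC, ?_⟩
    rw [prob_compl_eq_one_sub hC.measurableSet]
    exact tsub_le_iff_tsub_le.1 h
  · have := Measure.isProbabilityMeasure_map (μ := c.measure) (hp i).measurable.aemeasurable
    refine Measure.eq_of_le_of_isProbabilityMeasure (Measure.le_iff.2 fun A hA => ?_)
    rw [A.measure_eq_iInf_isOpen (μ i)]
    refine le_iInf₂ fun U hAU => le_iInf fun hU => ?_
    refine (measure_mono hAU).trans ?_
    rw [Measure.map_apply (hp i).measurable hU.measurableSet]
    exact le_open i U hU

/-- A Radon probability measure gives mass `infProjMass` to every compact set. -/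
theorem measure_eq_infProjMass [IsDirected ι (· ≤ ·)] [Nonempty ι]
    (hπp : ∀ ⦃i j⦄ (h : i ≤ j) y, π h (p j y) = p i y) (hp : ∀ i, Continuous (p i))
    (hsep : ∀ x y, (∀ i, p i x = p i y) → x = y) (ν : Measure Y)
    [IsProbabilityMeasure ν] [ν.InnerRegular] [∀ i, IsProbabilityMeasure (μ i)]
    (hν : ∀ i, ν.map (p i) = μ i) {K : Set Y}
    (hK : IsCompact K) : ν K = infProjMass p μ K := by
  have le_image : ∀ {L : Set Y}, IsCompact L → ∀ i, ν L ≤ μ i (p i '' L) := fun {L} hL i => by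
    rw [← hν i, Measure.map_apply (hp i).measurable (hL.image (hp i)).measurableSet]
    exact measure_mono (Set.subset_preimage_image _ _)
  refine le_antisymm (le_iInf (le_image hK)) ?_
  have compl_le : ν Kᶜ ≤ 1 - infProjMass p μ K := by
    rw [hK.measurableSet.compl.measure_eq_iSup_isCompact]
    refine iSup₂_le fun L hLK => iSup_le fun hL => ENNReal.le_sub_of_add_le_left
      (infProjMass_ne_top _) ?_
    obtain ⟨i, hi⟩ := exists_forall_le_disjoint_image hp hπp hsep hK hL
      (Set.disjoint_left.2 fun x hxK hxL => hLK hxL hxK)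
    calc infProjMass p μ K + ν L ≤ μ i (p i '' K) + μ i (p i '' L) :=
          add_le_add (iInf_le _ i) (le_image hL i)
      _ = μ i (p i '' K ∪ p i '' L) :=
        (measure_union (hi i le_rfl) (hL.image (hp i)).measurableSet).symm
      _ ≤ 1 := prob_le_one
  rw [prob_compl_eq_one_sub hK.measurableSet] at compl_le
  exact (ENNReal.sub_le_sub_iff_left
    ((iInf_le _ (Classical.arbitrary ι)).trans prob_le_one) ENNReal.one_ne_top).1 compl_le

/-- Radon probability measures with the same projections agree. -/
theorem radon_extension_unique [IsDirected ι (· ≤ ·)] [Nonempty ι]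
    (hπp : ∀ ⦃i j⦄ (h : i ≤ j) y, π h (p j y) = p i y) (hp : ∀ i, Continuous (p i))
    (hsep : ∀ x y, (∀ i, p i x = p i y) → x = y) (ν ν' : Measure Y)
    [IsProbabilityMeasure ν] [ν.InnerRegular] [IsProbabilityMeasure ν'] [ν'.InnerRegular]
    [∀ i, IsProbabilityMeasure (μ i)]
    (hν : ∀ i, ν.map (p i) = μ i) (hν' : ∀ i, ν'.map (p i) = μ i) : ν = ν' := by
  ext A hA
  refine Measure.InnerRegularWRT.eq_of_innerRegularWRT_of_forall_eq
    Measure.InnerRegular.innerRegular Measure.InnerRegular.innerRegular (fun K hK => ?_) hA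
  rw [measure_eq_infProjMass hπp hp hsep ν hν hK, measure_eq_infProjMass hπp hp hsep ν' hν' hK]

end Cone

/-- The projections of a Radon probability measure are uniformly tight. -/
theorem tight_of_radon_extension {Y : Type*} [TopologicalSpace Y] [MeasurableSpace Y]
    [BorelSpace Y] [∀ i, TopologicalSpace (X i)] [∀ i, T2Space (X i)] [∀ i, MeasurableSpace (X i)]
    [∀ i, BorelSpace (X i)] {p : ∀ i, Y → X i} {μ : ∀ i, Measure (X i)}
    (hp : ∀ i, Continuous (p i)) (ν : Measure Y) [IsProbabilityMeasure ν] [ν.InnerRegular]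
    (hν : ∀ i, ν.map (p i) = μ i) {ε : ℝ≥0∞}
    (hε : 0 < ε) : ∃ C : Set Y, IsCompact C ∧ ∀ i, 1 - ε ≤ μ i (p i '' C) := by
  obtain ⟨C, -, hC, h⟩ := MeasurableSet.univ.exists_isCompact_lt_add (measure_ne_top ν _) hε.ne'
  refine ⟨C, hC, fun i => ?_⟩
  rw [measure_univ] at h
  rw [← hν i, Measure.map_apply (hp i).measurable (hC.image (hp i)).measurableSet]
  exact (tsub_le_iff_right.2 h.le).trans (measure_mono (Set.subset_preimage_image _ _))

/-- Prokhorov's theorem: an exact projective system of Radon probability measures extends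
to a (unique) Radon probability measure on the Borel σ-algebra of the projective limit
iff it fulfills Prokhorov's condition. -/
theorem unique_radon_extension_iff_prokhorov
    [PartialOrder ι] [IsDirected ι (· ≤ ·)]
    [∀ i, TopologicalSpace (X i)] [∀ i, T2Space (X i)]
    [∀ i, MeasurableSpace (X i)] [∀ i, BorelSpace (X i)]
    (π : ∀ ⦃i j : ι⦄, i ≤ j → X j → X i)
    (hcont : ∀ ⦃i j : ι⦄ (h : i ≤ j), Continuous (π h))
    (hid : ∀ (i : ι) (x : X i), π (le_refl i) x = x)
    (hcomp : ∀ ⦃i j k : ι⦄ (hij : i ≤ j) (hjk : j ≤ k) (x : X k),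
      π hij (π hjk x) = π (hij.trans hjk) x)
    (μ : ∀ i, Measure (X i))
    (hprob : ∀ i, IsProbabilityMeasure (μ i))
    (hRadon : ∀ i, IsRadon (μ i))
    (hexact : ∀ ⦃i j : ι⦄ (h : i ≤ j), (μ j).map (π h) = μ i) :
    (∃! ν : @Measure (ProjLim π) (borel (ProjLim π)),
        ν Set.univ = 1 ∧
          (@IsRadon (ProjLim π) _ (borel (ProjLim π)) ν) ∧
          ∀ i : ι,
            @Measure.map (ProjLim π) (X i) (borel (ProjLim π)) _
              (fun x : ProjLim π => x.1 i) ν = μ i) ↔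
      (∀ ε : ℝ≥0∞, 0 < ε →
        ∃ C : Set (ProjLim π), IsCompact C ∧
          ∀ i : ι, 1 - ε ≤ μ i ((fun x : ProjLim π => x.1 i) '' C)) := by
  let : MeasurableSpace (ProjLim π) := borel (ProjLim π)
  have : BorelSpace (ProjLim π) := ⟨rfl⟩
  have hp : ∀ i, Continuous fun x : ProjLim π => x.1 i := fun i =>
    (continuous_apply i).comp continuous_subtype_val
  have hπp : ∀ ⦃i j : ι⦄ (h : i ≤ j) (x : ProjLim π), π h (x.1 j) = x.1 i := fun i j h x => x.2 h
  have hsep : ∀ x y : ProjLim π, (∀ i, x.1 i = y.1 i) → x = y := fun x y h =>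
    Subtype.ext (funext h)
  constructor
  · rintro ⟨ν, ⟨hν1, hν, hνμ⟩, -⟩ ε hε
    have : IsProbabilityMeasure ν := ⟨hν1⟩
    have := hν.2
    exact tight_of_radon_extension hp ν hνμ hε
  · intro h
    rcases isEmpty_or_nonempty ι with hι | hι
    · have : Subsingleton (ProjLim π) := ⟨fun x y => hsep x y fun i => isEmptyElim i⟩
      let x₀ : ProjLim π := ⟨fun i => isEmptyElim i, fun i => isEmptyElim i⟩
      refine ⟨Measure.dirac x₀, ⟨measure_univ, ⟨inferInstance, ⟨fun A _ r hr => ?_⟩⟩,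
        fun i => isEmptyElim i⟩, fun ν hν => ?_⟩
      · exact ⟨A, subset_rfl, A.toFinite.isCompact, hr⟩
      · ext A _
        rcases A.eq_empty_or_nonempty with rfl | hA
        · simp
        · rw [hA.eq_univ, hν.1, measure_univ]
    · obtain ⟨ν, hν1, hν, hνμ⟩ :=
        exists_radon_extension hprob (fun i => (hRadon i).2) hcont hπp hp hsep hexact h
      refine ⟨ν, ⟨hν1.measure_univ, ⟨inferInstance, hν⟩, hνμ⟩, ?_⟩
      rintro ν' ⟨hν'1, hν', hν'μ⟩
      have : IsProbabilityMeasure ν' := ⟨hν'1⟩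
      have := hν'.2
      exact radon_extension_unique hπp hp hsep ν' ν hν'μ hνμ

end Stmt6
end

section
/- Let A be a unital commutative real algebra with nonempty character space X(A), and Σ_I the cylinder σ-algebra on X(A). Then every finite measure μ on Σ_I is constructibly Radon: for every countably generated unital subalgebra T of A, the pushforward (π_T)_# μ is a Radon measure on the Borel σ-algebra of X(T), i.e. it is locally finite and inner regular with respect to compact subsets of X(T). -/
open MeasureTheory
open scoped ENNReal

namespace Stmt8

/-- The weak topology on the character space `B →ₐ[ℝ] ℝ`. -/
instance charTopology (B : Type*) [CommRing B] [Algebra ℝ B] :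
    TopologicalSpace (B →ₐ[ℝ] ℝ) :=
  TopologicalSpace.induced (fun φ : B →ₐ[ℝ] ℝ => (φ : B → ℝ)) inferInstance

/-- The Borel σ-algebra of the weak topology on the character space. -/
instance charMeasurableSpace (B : Type*) [CommRing B] [Algebra ℝ B] :
    MeasurableSpace (B →ₐ[ℝ] ℝ) := borel _

instance charBorelSpace (B : Type*) [CommRing B] [Algebra ℝ B] :
    BorelSpace (B →ₐ[ℝ] ℝ) := ⟨rfl⟩

/-- The restriction map `π_S : X(A) → X(S)` for a subalgebra `S` of `A`. -/
def resMap {A : Type*} [CommRing A] [Algebra ℝ A] (S : Subalgebra ℝ A) :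
    (A →ₐ[ℝ] ℝ) → (S →ₐ[ℝ] ℝ) := fun φ => φ.comp S.val

/-- The cylinder σ-algebra `Σ_I` on `X(A)`: the smallest σ-algebra making the restriction
map to every finitely generated subalgebra measurable. -/
def cylSigma (A : Type*) [CommRing A] [Algebra ℝ A] : MeasurableSpace (A →ₐ[ℝ] ℝ) :=
  ⨆ S ∈ {S : Subalgebra ℝ A | S.FG},
    MeasurableSpace.comap (resMap S) (charMeasurableSpace ↥S)

/-- A Radon measure: locally finite and inner regular w.r.t. compact sets. -/
def IsRadon {α : Type*} [TopologicalSpace α] [MeasurableSpace α] (μ : Measure α) : Prop :=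
  IsLocallyFiniteMeasure μ ∧ μ.InnerRegular

open Topology in
/-- A character of a quotient of `MvPolynomial σ ℝ` is determined, topologically as well, by its
values at the images of the variables, and these values form a closed set. -/
lemma isClosedEmbedding_eval_X {σ B : Type*} [CommRing B] [Algebra ℝ B]
    (f : MvPolynomial σ ℝ →ₐ[ℝ] B) (hf : Function.Surjective f) :
    IsClosedEmbedding (fun (φ : B →ₐ[ℝ] ℝ) (i : σ) => φ (f (MvPolynomial.X i))) := by
  have eval_eq (φ : B →ₐ[ℝ] ℝ) (p : MvPolynomial σ ℝ) :
      φ (f p) = MvPolynomial.aeval (fun i => φ (f (MvPolynomial.X i))) p := by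
    have h : φ.comp f = MvPolynomial.aeval (fun i => φ (f (MvPolynomial.X i))) :=
      MvPolynomial.algHom_ext fun i => by simp
    exact DFunLike.congr_fun h p
  have continuous_aeval (p : MvPolynomial σ ℝ) :
      Continuous fun x : σ → ℝ => MvPolynomial.aeval x p := by
    simpa [MvPolynomial.aeval_eq_eval] using MvPolynomial.continuous_eval p
  have continuous_apply_char (b : B) : Continuous fun φ : B →ₐ[ℝ] ℝ => φ b :=
    (continuous_apply b).comp continuous_induced_dom
  refine ⟨⟨⟨le_antisymm ?_ ?_⟩, ?_⟩, ?_⟩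
  · exact (continuous_pi fun i => continuous_apply_char _).le_induced
  · change _ ≤ TopologicalSpace.induced _ _
    rw [← continuous_iff_le_induced]
    let := TopologicalSpace.induced
      (fun (φ : B →ₐ[ℝ] ℝ) (i : σ) => φ (f (MvPolynomial.X i))) inferInstance
    refine continuous_pi fun b => ?_
    obtain ⟨p, rfl⟩ := hf b
    exact (continuous_congr fun φ => eval_eq φ p).2 <|
      (continuous_aeval p).comp continuous_induced_dom
  · intro φ ψ h
    ext b
    obtain ⟨p, rfl⟩ := hf b
    rw [eval_eq φ, eval_eq ψ]
    exact congrArg (MvPolynomial.aeval · p) h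
  · have range_eq : Set.range (fun (φ : B →ₐ[ℝ] ℝ) (i : σ) => φ (f (MvPolynomial.X i))) =
        ⋂ p ∈ RingHom.ker f, {x : σ → ℝ | MvPolynomial.aeval x p = (0 : ℝ)} := by
      ext x
      simp only [Set.mem_range, Set.mem_iInter, Set.mem_ofPred_eq]
      constructor
      · rintro ⟨φ, rfl⟩ p hp
        rw [← eval_eq, (RingHom.mem_ker).1 hp, map_zero]
      · intro hx
        refine ⟨f.liftOfSurjective hf (MvPolynomial.aeval x) hx, funext fun i => ?_⟩
        exact (f.liftOfSurjective_apply hf _ hx _).trans (MvPolynomial.aeval_X x i)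
    rw [range_eq]
    exact isClosed_biInter fun p _ => isClosed_eq (continuous_aeval p) continuous_const

lemma polishSpace_char_of_countably_generated {A : Type*} [CommRing A] [Algebra ℝ A]
    {s : Set A} (hs : s.Countable) : PolishSpace (Algebra.adjoin ℝ s →ₐ[ℝ] ℝ) := by
  have := hs.to_subtype
  rw [Algebra.adjoin_eq_range]
  exact (isClosedEmbedding_eval_X _ (AlgHom.rangeRestrict_surjective _)).polishSpace

/-- Every finite measure on the cylinder σ-algebra `Σ_I` of `X(A)` is constructibly Radon:
its pushforward to `X(T)` is a Radon measure for every countably generated subalgebra `T`. -/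
theorem finite_cylinder_measure_constructibly_radon
    (A : Type*) [CommRing A] [Algebra ℝ A] [Nonempty (A →ₐ[ℝ] ℝ)]
    (μ : @Measure (A →ₐ[ℝ] ℝ) (cylSigma A)) (hfin : μ Set.univ < ⊤) :
    ∀ T : Subalgebra ℝ A, (∃ s : Set A, s.Countable ∧ Algebra.adjoin ℝ s = T) →
      IsRadon (@Measure.map (A →ₐ[ℝ] ℝ) (↥T →ₐ[ℝ] ℝ) (cylSigma A)
        (charMeasurableSpace ↥T) (resMap T) μ) := by
  rintro T ⟨s, hs, rfl⟩
  have := polishSpace_char_of_countably_generated hs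
  let := cylSigma A
  have : IsFiniteMeasure μ := ⟨hfin⟩
  have : IsFiniteMeasure (μ.map (resMap (Algebra.adjoin ℝ s))) := Measure.isFiniteMeasure_map μ _
  exact ⟨IsFiniteMeasure.toIsLocallyFiniteMeasure _, inferInstance⟩

end Stmt8
end

section
/- Let S be a finitely generated unital commutative real algebra with nonempty character space X(S) (weak topology, Borel σ-algebra), L_S : S → ℝ linear with L_S(1) = 1, K^(S) ⊆ X(S) closed, ε > 0 and C_ε ⊆ X(S) closed. Then the set R(L_S, K^(S), C_ε) of all Radon probability measures μ on X(S) such that μ(X(S) \ K^(S)) = 0, μ(C_ε) ≥ 1 − ε, and for every a ∈ S the function â is μ-integrable with L_S(a) = ∫ â dμ, is a compact subset of the space of Radon probability measures on X(S) equipped with the weak (vague) topology, i.e. the coarsest topology making μ ↦ ∫ f dμ continuous for every bounded continuous f : X(S) → ℝ. In particular, the set R(L_S, K^(S)) of all K^(S)-representing Radon measures for L_S is compact in this topology. -/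
open MeasureTheory
open scoped ENNReal

namespace Stmt9

/-- The weak topology on the character space `B →ₐ[ℝ] ℝ`. -/
instance charTopology (B : Type*) [CommRing B] [Algebra ℝ B] :
    TopologicalSpace (B →ₐ[ℝ] ℝ) :=
  TopologicalSpace.induced (fun φ : B →ₐ[ℝ] ℝ => (φ : B → ℝ)) inferInstance

/-- The Borel σ-algebra of the weak topology on the character space. -/
instance charMeasurableSpace (B : Type*) [CommRing B] [Algebra ℝ B] :
    MeasurableSpace (B →ₐ[ℝ] ℝ) := borel _

instance charBorelSpace (B : Type*) [CommRing B] [Algebra ℝ B] :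
    BorelSpace (B →ₐ[ℝ] ℝ) := ⟨rfl⟩

/-- A Radon measure: locally finite and inner regular w.r.t. compact sets. -/
def IsRadon {α : Type*} [TopologicalSpace α] [MeasurableSpace α] (μ : Measure α) : Prop :=
  IsLocallyFiniteMeasure μ ∧ μ.InnerRegular

/-- `μ` is a `K`-representing Radon measure for the linear functional `L` on `B`. -/
def IsRepr {B : Type*} [CommRing B] [Algebra ℝ B] (L : B →ₗ[ℝ] ℝ)
    (K : Set (B →ₐ[ℝ] ℝ)) (μ : Measure (B →ₐ[ℝ] ℝ)) : Prop :=
  IsRadon μ ∧ μ Kᶜ = 0 ∧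
    ∀ b : B, Integrable (fun φ : B →ₐ[ℝ] ℝ => φ b) μ ∧
      L b = ∫ φ : B →ₐ[ℝ] ℝ, φ b ∂μ

open Filter Topology

section Generators

variable {B : Type*} [CommRing B] [Algebra ℝ B]

lemma continuous_eval (b : B) : Continuous fun φ : B →ₐ[ℝ] ℝ => φ b :=
  (continuous_apply b).comp continuous_induced_dom

/-- The closed embedding of the character space into the product of all evaluations. -/
lemma isClosedEmbedding_coe : IsClosedEmbedding fun φ : B →ₐ[ℝ] ℝ => (φ : B → ℝ) := by
  refine ⟨⟨⟨rfl⟩, DFunLike.coe_injective⟩, ?_⟩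
  have h : Set.range (fun φ : B →ₐ[ℝ] ℝ => (φ : B → ℝ)) =
      {f | (∀ r, f (algebraMap ℝ B r) = r) ∧ (∀ a b, f (a + b) = f a + f b) ∧
        ∀ a b, f (a * b) = f a * f b} := by
    ext f
    constructor
    · rintro ⟨φ, rfl⟩
      exact ⟨fun r => φ.commutes r, map_add φ, map_mul φ⟩
    · rintro ⟨hc, ha, hm⟩
      exact ⟨⟨⟨⟨⟨f, by simpa using hc 1⟩, hm⟩, by simpa using hc 0, ha⟩, hc⟩, rfl⟩
  rw [h]
  simp only [Set.ofPred_and, Set.ofPred_forall]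
  refine .inter (isClosed_iInter fun r => isClosed_eq (by fun_prop) (by fun_prop)) (.inter ?_ ?_)
  all_goals exact isClosed_iInter fun a => isClosed_iInter fun b =>
    isClosed_eq (by fun_prop) (by fun_prop)

/-- A closed set of characters that is bounded on generators is compact. -/
lemma isCompact_of_bounded_generators {G : Set B} (hG : Algebra.adjoin ℝ G = ⊤)
    {s : Set (B →ₐ[ℝ] ℝ)} (hs : IsClosed s) (hb : ∀ g ∈ G, ∃ C, ∀ φ ∈ s, |φ g| ≤ C) :
    IsCompact s := by
  have h (b : B) : ∃ C, ∀ φ ∈ s, |φ b| ≤ C := by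
    have hb' : b ∈ Algebra.adjoin ℝ G := hG ▸ Algebra.mem_top
    induction hb' using Algebra.adjoin_induction with
    | mem x hx => exact hb x hx
    | algebraMap r => exact ⟨|r|, fun φ _ => by simp⟩
    | add x y _ _ hx hy =>
      obtain ⟨C, hC⟩ := hx
      obtain ⟨D, hD⟩ := hy
      refine ⟨C + D, fun φ hφ => ?_⟩
      rw [map_add]
      exact (abs_add_le _ _).trans (add_le_add (hC φ hφ) (hD φ hφ))
    | mul x y _ _ hx hy =>
      obtain ⟨C, hC⟩ := hx
      obtain ⟨D, hD⟩ := hy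
      refine ⟨C * D, fun φ hφ => ?_⟩
      rw [map_mul, abs_mul]
      exact mul_le_mul (hC φ hφ) (hD φ hφ) (abs_nonneg _) ((abs_nonneg _).trans (hC φ hφ))
  choose C hC using h
  refine (isClosedEmbedding_coe.isCompact_preimage
    (isCompact_univ_pi fun b => isCompact_Icc (a := -C b) (b := C b))).of_isClosed_subset hs ?_
  exact fun φ hφ b _ => abs_le.1 (hC b φ hφ)

lemma polishSpace_of_fg (hfg : (⊤ : Subalgebra ℝ B).FG) : PolishSpace (B →ₐ[ℝ] ℝ) := by
  obtain ⟨G, hG⟩ := hfg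
  let e : (B →ₐ[ℝ] ℝ) → (G → ℝ) := fun φ g => φ g
  have he : Continuous e := continuous_pi fun g => continuous_eval _
  have hinj : Function.Injective e := fun φ ψ h =>
    AlgHom.ext_of_adjoin_eq_top hG fun g hg => congrFun h ⟨g, hg⟩
  have hproper : IsProperMap e := by
    refine isProperMap_iff_isCompact_preimage.2 ⟨he, fun K hK => ?_⟩
    refine isCompact_of_bounded_generators hG (hK.isClosed.preimage he) fun g hg => ?_
    obtain ⟨C, hC⟩ := hK.exists_bound_of_continuousOn
      (f := fun x : G → ℝ => x ⟨g, hg⟩) (by fun_prop)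
    exact ⟨C, fun φ hφ => hC _ hφ⟩
  exact (IsClosedEmbedding.of_continuous_injective_isClosedMap he hinj
    hproper.isClosedMap).polishSpace

/-- Sublevel sets of the sum of squares of the generators are compact. -/
lemma exists_isCompact_sublevel (hfg : (⊤ : Subalgebra ℝ B).FG) :
    ∃ p : B, (∀ φ : B →ₐ[ℝ] ℝ, 0 ≤ φ p) ∧ ∀ c : ℝ, IsCompact {φ : B →ₐ[ℝ] ℝ | φ p ≤ c} := by
  obtain ⟨G, hG⟩ := hfg
  refine ⟨∑ g ∈ G, g ^ 2, fun φ => ?_, fun c => ?_⟩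
  · simp only [map_sum, map_pow]
    positivity
  · refine isCompact_of_bounded_generators hG
      (isClosed_le (continuous_eval _) continuous_const) fun g hg => ⟨√c, fun φ hφ => ?_⟩
    simp only [Set.mem_ofPred_eq, map_sum, map_pow] at hφ
    exact Real.abs_le_sqrt ((Finset.single_le_sum (f := fun g => φ g ^ 2)
      (fun _ _ => sq_nonneg _) hg).trans hφ)

end Generators

section Truncation

variable {X : Type*} [MeasurableSpace X] {ν : Measure X} [IsFiniteMeasure ν] {f : X → ℝ}

lemma integrable_min_natCast (hf : Measurable f) (h0 : 0 ≤ f) (n : ℕ) :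
    Integrable (fun x => min (f x) n) ν :=
  .of_bound (by fun_prop) n (ae_of_all _ fun x => by
    rw [Real.norm_of_nonneg (le_min (h0 x) n.cast_nonneg)]
    exact min_le_right _ _)

lemma integrable_of_integral_min_le (hf : Measurable f) (h0 : 0 ≤ f) {C : ℝ}
    (h : ∀ n : ℕ, ∫ x, min (f x) n ∂ν ≤ C) : Integrable f ν := by
  refine ⟨hf.aestronglyMeasurable, ?_⟩
  rw [hasFiniteIntegral_iff_ofReal (ae_of_all _ h0)]
  refine lt_of_le_of_lt ?_ (ENNReal.ofReal_lt_top (r := C))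
  refine le_of_tendsto' (lintegral_tendsto_of_tendsto_of_monotone
    (f := fun (n : ℕ) x => ENNReal.ofReal (min (f x) n)) (fun n => by fun_prop) ?_ ?_) fun n => ?_
  · exact ae_of_all _ fun x m n hmn =>
      ENNReal.ofReal_le_ofReal (min_le_min_left _ (Nat.cast_le.2 hmn))
  · refine ae_of_all _ fun x => tendsto_atTop_of_eventually_const (i₀ := ⌈f x⌉₊) fun n hn => ?_
    rw [min_eq_left ((Nat.le_ceil _).trans (Nat.cast_le.2 hn))]
  · rw [← ofReal_integral_eq_lintegral_ofReal (integrable_min_natCast hf h0 n)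
      (ae_of_all _ fun x => le_min (h0 x) n.cast_nonneg)]
    exact ENNReal.ofReal_le_ofReal (h n)

lemma integral_le_of_integral_min_le (hf : Measurable f) (h0 : 0 ≤ f) {C : ℝ}
    (h : ∀ n : ℕ, ∫ x, min (f x) n ∂ν ≤ C) : ∫ x, f x ∂ν ≤ C := by
  have hint := integrable_of_integral_min_le hf h0 h
  refine le_of_tendsto' (tendsto_integral_of_dominated_convergence
    (F := fun (n : ℕ) x => min (f x) n) f (fun n => by fun_prop) hint ?_ ?_) h
  · exact fun n => ae_of_all _ fun x => by
      rw [Real.norm_of_nonneg (le_min (h0 x) n.cast_nonneg)]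
      exact min_le_left _ _
  · refine ae_of_all _ fun x => tendsto_atTop_of_eventually_const (i₀ := ⌈f x⌉₊) fun n hn => ?_
    rw [min_eq_left ((Nat.le_ceil _).trans (Nat.cast_le.2 hn))]

/-- Truncation of a real number to `[-n, n]`. -/
def trunc (n : ℕ) (y : ℝ) : ℝ := max (-n) (min n y)

@[fun_prop]
lemma continuous_trunc (n : ℕ) : Continuous (trunc n) := by
  unfold trunc
  fun_prop

lemma abs_trunc_le (n : ℕ) (y : ℝ) : |trunc n y| ≤ n :=
  abs_le.2 ⟨le_max_left _ _, max_le (by linarith [n.cast_nonneg (α := ℝ)]) (min_le_left _ _)⟩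

lemma mul_abs_sub_trunc_le (n : ℕ) (y : ℝ) : n * |y - trunc n y| ≤ y ^ 2 := by
  have hn : (0 : ℝ) ≤ n := n.cast_nonneg
  unfold trunc
  rcases le_total (n : ℝ) y with h | h
  · rw [min_eq_left h, max_eq_right (by linarith), abs_of_nonneg (by linarith)]
    nlinarith
  · rw [min_eq_right h]
    rcases le_total (-(n : ℝ)) y with h' | h'
    · rw [max_eq_right h']
      simpa using sq_nonneg y
    · rw [max_eq_left h', abs_of_nonpos (by linarith)]
      nlinarith

lemma integrable_trunc (hf : Measurable f) (n : ℕ) : Integrable (fun x => trunc n (f x)) ν :=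
  .of_bound ((continuous_trunc n).measurable.comp hf).aestronglyMeasurable n
    (ae_of_all _ fun _ => abs_trunc_le n _)

lemma mul_abs_integral_sub_le (hf : Measurable f) (hint : Integrable f ν)
    (hsq : Integrable (fun x => f x ^ 2) ν) (n : ℕ) :
    n * |∫ x, f x ∂ν - ∫ x, trunc n (f x) ∂ν| ≤ ∫ x, f x ^ 2 ∂ν := by
  rw [← integral_sub hint (integrable_trunc hf n)]
  calc n * |∫ x, f x - trunc n (f x) ∂ν|
      ≤ n * ∫ x, |f x - trunc n (f x)| ∂ν :=
        mul_le_mul_of_nonneg_left abs_integral_le_integral_abs n.cast_nonneg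
    _ = ∫ x, n * |f x - trunc n (f x)| ∂ν := (integral_const_mul _ _).symm
    _ ≤ _ := integral_mono ((hint.sub (integrable_trunc hf n)).abs.const_mul _) hsq
        fun x => mul_abs_sub_trunc_le n (f x)

end Truncation

section Weak

variable {X : Type*} [TopologicalSpace X] [MeasurableSpace X] [OpensMeasurableSpace X]

lemma continuous_integral_of_bounded {f : X → ℝ} (hf : Continuous f) (C : ℝ)
    (h : ∀ x, |f x| ≤ C) : Continuous fun μ : ProbabilityMeasure X => ∫ x, f x ∂μ.toMeasure :=
  ProbabilityMeasure.continuous_integral_boundedContinuousFunction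
    (BoundedContinuousFunction.ofNormedAddCommGroup f hf C h)

/-- Evaluation on a closed set is upper semicontinuous for the weak topology. -/
lemma isClosed_setOf_le_measure [HasOuterApproxClosed X] {F : Set X} (hF : IsClosed F)
    (c : ℝ≥0∞) : IsClosed {μ : ProbabilityMeasure X | c ≤ μ.toMeasure F} := by
  rw [isClosed_iff_ultrafilter]
  intro μ u hu hs
  refine le_trans ?_ (ProbabilityMeasure.limsup_measure_closed_le_of_tendsto
    (L := (u : Filter (ProbabilityMeasure X))) (μs := id) hu hF)
  exact le_limsup_of_frequently_le (Eventually.frequently hs)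

end Weak

section Moments

variable {B : Type*} [CommRing B] [Algebra ℝ B]

/-- The moment conditions are equivalent to conditions on integrals of bounded continuous
functions. -/
lemma moments_iff_truncated (L : B →ₗ[ℝ] ℝ) (μ : Measure (B →ₐ[ℝ] ℝ)) [IsProbabilityMeasure μ] :
    (∀ b : B, Integrable (fun φ : B →ₐ[ℝ] ℝ => φ b) μ ∧ L b = ∫ φ : B →ₐ[ℝ] ℝ, φ b ∂μ) ↔
      ∀ (b : B) (n : ℕ), ∫ φ : B →ₐ[ℝ] ℝ, min (φ b ^ 2) n ∂μ ≤ L (b ^ 2) ∧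
        n * |L b - ∫ φ : B →ₐ[ℝ] ℝ, trunc n (φ b) ∂μ| ≤ L (b ^ 2) := by
  have hm (b : B) : Measurable fun φ : B →ₐ[ℝ] ℝ => φ b := (continuous_eval b).measurable
  constructor
  · intro h b n
    obtain ⟨h2, h2'⟩ := h (b ^ 2)
    simp only [map_pow] at h2 h2'
    constructor
    · rw [h2']
      exact integral_mono (integrable_min_natCast ((hm b).pow_const 2) (fun _ => sq_nonneg _) n)
        h2 fun _ => min_le_left _ _
    · rw [h2', (h b).2]
      exact mul_abs_integral_sub_le (hm b) (h b).1 h2 n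
  · intro h b
    have hs := (hm b).pow_const 2
    have h0 : (0 : (B →ₐ[ℝ] ℝ) → ℝ) ≤ fun φ => φ b ^ 2 := fun _ => sq_nonneg _
    have hsq := integrable_of_integral_min_le hs h0 fun n => (h b n).1
    have hle := integral_le_of_integral_min_le hs h0 fun n => (h b n).1
    have hint : Integrable (fun φ : B →ₐ[ℝ] ℝ => φ b) μ :=
      ((memLp_two_iff_integrable_sq (hm b).aestronglyMeasurable).2 hsq).integrable one_le_two
    refine ⟨hint, ?_⟩
    by_contra hne
    have hpos : 0 < |L b - ∫ φ : B →ₐ[ℝ] ℝ, φ b ∂μ| := abs_pos.2 (sub_ne_zero.2 hne)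
    obtain ⟨n, hn⟩ := exists_nat_gt (2 * L (b ^ 2) / |L b - ∫ φ : B →ₐ[ℝ] ℝ, φ b ∂μ|)
    rw [div_lt_iff₀ hpos] at hn
    have h1 := mul_abs_integral_sub_le (hm b) hint hsq n
    have h2 := (h b n).2
    have h3 := mul_le_mul_of_nonneg_left (abs_sub_le (L b)
      (∫ φ : B →ₐ[ℝ] ℝ, trunc n (φ b) ∂μ) (∫ φ : B →ₐ[ℝ] ℝ, φ b ∂μ)) n.cast_nonneg
    rw [abs_sub_comm (∫ φ : B →ₐ[ℝ] ℝ, trunc n (φ b) ∂μ)] at h3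
    linarith

lemma isClosed_setOf_moments (L : B →ₗ[ℝ] ℝ) :
    IsClosed {μ : ProbabilityMeasure (B →ₐ[ℝ] ℝ) | ∀ b : B,
      Integrable (fun φ : B →ₐ[ℝ] ℝ => φ b) μ.toMeasure ∧
        L b = ∫ φ : B →ₐ[ℝ] ℝ, φ b ∂μ.toMeasure} := by
  simp only [moments_iff_truncated, Set.ofPred_forall, Set.ofPred_and]
  refine isClosed_iInter fun b => isClosed_iInter fun n => .inter ?_ ?_
  · refine isClosed_le (continuous_integral_of_bounded
      (((continuous_eval b).pow 2).min continuous_const) n fun φ => ?_) continuous_const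
    rw [abs_of_nonneg (le_min (sq_nonneg _) n.cast_nonneg)]
    exact min_le_right _ _
  · have := continuous_integral_of_bounded ((continuous_trunc n).comp (continuous_eval b)) n
      fun φ => abs_trunc_le n (φ b)
    exact isClosed_le (continuous_const.mul (continuous_const.sub this).abs) continuous_const

lemma isTightMeasureSet_moments (hfg : (⊤ : Subalgebra ℝ B).FG) (L : B →ₗ[ℝ] ℝ) :
    IsTightMeasureSet {μ : Measure (B →ₐ[ℝ] ℝ) | IsFiniteMeasure μ ∧ ∀ b : B,
      Integrable (fun φ : B →ₐ[ℝ] ℝ => φ b) μ ∧ L b = ∫ φ : B →ₐ[ℝ] ℝ, φ b ∂μ} := by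
  obtain ⟨p, hp, hK⟩ := exists_isCompact_sublevel hfg
  rw [isTightMeasureSet_iff_exists_isCompact_measure_compl_le]
  intro δ hδ
  obtain ⟨r, hr, hrδ⟩ := ENNReal.lt_iff_exists_nnreal_btwn.1 hδ
  have hr : (0 : ℝ) < r := by exact_mod_cast hr
  refine ⟨_, hK (L p / r), fun μ ⟨_, hμ⟩ => ?_⟩
  refine le_trans ?_ hrδ.le
  rw [← ENNReal.ofReal_coe_nnreal, ← ofReal_measureReal]
  refine ENNReal.ofReal_le_ofReal ?_
  have hL : 0 ≤ L p := (hμ p).2 ▸ integral_nonneg hp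
  have hmarkov := mul_meas_ge_le_integral_of_nonneg (ae_of_all _ hp) (hμ p).1 (L p / r)
  rw [← (hμ p).2] at hmarkov
  rcases hL.eq_or_lt with h0 | hpos
  · have hae := (integral_eq_zero_iff_of_nonneg hp (hμ p).1).1 ((hμ p).2.symm.trans h0.symm)
    have : μ {φ : B →ₐ[ℝ] ℝ | φ p ≤ L p / r}ᶜ = 0 := by
      refine mem_ae_iff.1 (hae.mono fun φ hφ => ?_)
      simp only [Pi.zero_apply] at hφ
      simp [hφ, ← h0]
    simp [measureReal_def, this]
  · have hsub : {φ : B →ₐ[ℝ] ℝ | φ p ≤ L p / r}ᶜ ⊆ {φ | L p / r ≤ φ p} := by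
      intro φ hφ
      simp only [Set.mem_compl_iff, Set.mem_ofPred_eq, not_le] at hφ ⊢
      exact hφ.le
    refine (measureReal_mono hsub).trans ?_
    rw [div_mul_eq_mul_div, div_le_iff₀ hr] at hmarkov
    exact le_of_mul_le_mul_left hmarkov hpos

lemma isCompact_setOf_isRepr (hfg : (⊤ : Subalgebra ℝ B).FG) (L : B →ₗ[ℝ] ℝ)
    {K : Set (B →ₐ[ℝ] ℝ)} (hK : IsClosed K) :
    IsCompact {μ : ProbabilityMeasure (B →ₐ[ℝ] ℝ) | IsRepr L K μ.toMeasure} := by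
  have := polishSpace_of_fg hfg
  let := TopologicalSpace.upgradeIsCompletelyMetrizable (B →ₐ[ℝ] ℝ)
  have heq : {μ : ProbabilityMeasure (B →ₐ[ℝ] ℝ) | IsRepr L K μ.toMeasure} =
      {μ | 1 ≤ μ.toMeasure K} ∩ {μ | ∀ b : B,
        Integrable (fun φ : B →ₐ[ℝ] ℝ => φ b) μ.toMeasure ∧
          L b = ∫ φ : B →ₐ[ℝ] ℝ, φ b ∂μ.toMeasure} := by
    ext μ
    have hR : IsRadon μ.toMeasure := ⟨inferInstance, inferInstance⟩
    have hc : μ.toMeasure Kᶜ = 0 ↔ 1 ≤ μ.toMeasure K := by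
      rw [prob_compl_eq_zero_iff hK.measurableSet, one_le_prob_iff]
    simp only [Set.mem_ofPred_eq, Set.mem_inter_iff, IsRepr, hR, hc, true_and]
  have hclosed : IsClosed {μ : ProbabilityMeasure (B →ₐ[ℝ] ℝ) | IsRepr L K μ.toMeasure} :=
    heq ▸ (isClosed_setOf_le_measure hK 1).inter (isClosed_setOf_moments L)
  rw [← hclosed.closure_eq]
  refine isCompact_closure_of_isTightMeasureSet ((isTightMeasureSet_moments hfg L).subset ?_)
  rintro _ ⟨μ, hμ, rfl⟩
  exact ⟨inferInstance, hμ.2.2⟩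

end Moments

/-- The set `R(L_S, K, C_ε)` of `K`-representing Radon probability measures `μ` for `L_S`
with `μ(C_ε) ≥ 1 - ε` is compact in the weak (vague) topology on probability measures on
the character space of a finitely generated algebra; in particular so is `R(L_S, K)`. -/
theorem representing_measures_compact
    (S : Type*) [CommRing S] [Algebra ℝ S] [Nonempty (S →ₐ[ℝ] ℝ)]
    (hfg : (⊤ : Subalgebra ℝ S).FG)
    (L : S →ₗ[ℝ] ℝ) (hL1 : L 1 = 1)
    (K : Set (S →ₐ[ℝ] ℝ)) (hK : IsClosed K)
    (ε : ℝ≥0∞) (hε : 0 < ε)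
    (Cε : Set (S →ₐ[ℝ] ℝ)) (hCε : IsClosed Cε) :
    IsCompact {μ : ProbabilityMeasure (S →ₐ[ℝ] ℝ) |
        IsRepr L K μ.toMeasure ∧ 1 - ε ≤ μ.toMeasure Cε} ∧
      IsCompact {μ : ProbabilityMeasure (S →ₐ[ℝ] ℝ) | IsRepr L K μ.toMeasure} := by
  have hR := isCompact_setOf_isRepr hfg L hK
  have := polishSpace_of_fg hfg
  let := TopologicalSpace.upgradeIsCompletelyMetrizable (S →ₐ[ℝ] ℝ)
  exact ⟨hR.inter_right (isClosed_setOf_le_measure hCε (1 - ε)), hR⟩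

end Stmt9
end

section
/- Let A be a unital commutative real algebra with nonempty character space X(A), L : A → ℝ linear with L(1) = 1, and I the set of all finitely generated unital subalgebras of A. For each S ∈ I let K^(S) ⊆ X(S) be closed with π_{S,T}(K^(T)) ⊆ K^(S) for all T ∈ I containing S. If for each S ∈ I there exists a unique K^(S)-representing Radon measure ν_S for L|_S, then {ν_S : S ∈ I} is an exact projective system: (π_{S,T})_# ν_T = ν_S for all S, T ∈ I with S ⊆ T. -/
open MeasureTheory
open scoped ENNReal

namespace Stmt10

/-- The weak topology on the character space `B →ₐ[ℝ] ℝ`. -/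
instance charTopology (B : Type*) [CommRing B] [Algebra ℝ B] :
    TopologicalSpace (B →ₐ[ℝ] ℝ) :=
  TopologicalSpace.induced (fun φ : B →ₐ[ℝ] ℝ => (φ : B → ℝ)) inferInstance

/-- The Borel σ-algebra of the weak topology on the character space. -/
instance charMeasurableSpace (B : Type*) [CommRing B] [Algebra ℝ B] :
    MeasurableSpace (B →ₐ[ℝ] ℝ) := borel _

instance charBorelSpace (B : Type*) [CommRing B] [Algebra ℝ B] :
    BorelSpace (B →ₐ[ℝ] ℝ) := ⟨rfl⟩

/-- The restriction map `π_S : X(A) → X(S)` for a subalgebra `S` of `A`. -/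
def resMap {A : Type*} [CommRing A] [Algebra ℝ A] (S : Subalgebra ℝ A) :
    (A →ₐ[ℝ] ℝ) → (S →ₐ[ℝ] ℝ) := fun φ => φ.comp S.val

/-- The restriction map `π_{S,T} : X(T) → X(S)` for subalgebras `S ≤ T` of `A`. -/
def resTrans {A : Type*} [CommRing A] [Algebra ℝ A] {S T : Subalgebra ℝ A} (h : S ≤ T) :
    (T →ₐ[ℝ] ℝ) → (S →ₐ[ℝ] ℝ) := fun φ => φ.comp (Subalgebra.inclusion h)

/-- The restriction `L|_S` of a linear functional `L : A → ℝ` to a subalgebra `S`. -/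
def resL {A : Type*} [CommRing A] [Algebra ℝ A] (L : A →ₗ[ℝ] ℝ) (S : Subalgebra ℝ A) :
    (↥S) →ₗ[ℝ] ℝ := L.comp (Subalgebra.val S).toLinearMap

/-- A Radon measure: locally finite and inner regular w.r.t. compact sets. -/
def IsRadon {α : Type*} [TopologicalSpace α] [MeasurableSpace α] (μ : Measure α) : Prop :=
  IsLocallyFiniteMeasure μ ∧ μ.InnerRegular

/-- `μ` is a `K`-representing Radon measure for the linear functional `L` on `B`. -/
def IsRepr {B : Type*} [CommRing B] [Algebra ℝ B] (L : B →ₗ[ℝ] ℝ)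
    (K : Set (B →ₐ[ℝ] ℝ)) (μ : Measure (B →ₐ[ℝ] ℝ)) : Prop :=
  IsRadon μ ∧ μ Kᶜ = 0 ∧
    ∀ b : B, Integrable (fun φ : B →ₐ[ℝ] ℝ => φ b) μ ∧
      L b = ∫ φ : B →ₐ[ℝ] ℝ, φ b ∂μ

/-- Prokhorov's condition for a family of measures indexed by the finitely generated
subalgebras of `A`. -/
def Prokh {A : Type*} [CommRing A] [Algebra ℝ A]
    (μf : ∀ S : Subalgebra ℝ A, Measure (↥S →ₐ[ℝ] ℝ)) : Prop :=
  ∀ ε : ℝ≥0∞, 0 < ε → ∃ C : Set (A →ₐ[ℝ] ℝ), IsCompact C ∧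
    ∀ S : Subalgebra ℝ A, S.FG → 1 - ε ≤ μf S (resMap S '' C)


/-- Evaluation at a point is continuous on the character space. -/
lemma continuous_eval {B : Type*} [CommRing B] [Algebra ℝ B] (b : B) :
    Continuous (fun φ : B →ₐ[ℝ] ℝ => φ b) :=
  (continuous_apply b).comp continuous_induced_dom

/-- The restriction map between character spaces is continuous. -/
lemma continuous_resTrans {A : Type*} [CommRing A] [Algebra ℝ A] {S T : Subalgebra ℝ A}
    (h : S ≤ T) : Continuous (resTrans h) :=
  continuous_induced_rng.2 <| continuous_pi fun b => continuous_eval (Subalgebra.inclusion h b)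

/-- A representing measure is finite, since the constant function `1` is integrable. -/
lemma IsRepr.isFiniteMeasure {B : Type*} [CommRing B] [Algebra ℝ B] {L : B →ₗ[ℝ] ℝ}
    {K : Set (B →ₐ[ℝ] ℝ)} {μ : Measure (B →ₐ[ℝ] ℝ)} (hμ : IsRepr L K μ) :
    IsFiniteMeasure μ := by
  have h1 := (hμ.2.2 1).1
  simp only [map_one] at h1
  exact (integrable_const_iff_isFiniteMeasure one_ne_zero).1 h1

/-- The pushforward of a representing measure under restriction is representing. -/
lemma IsRepr.map_resTrans {A : Type*} [CommRing A] [Algebra ℝ A] {L : A →ₗ[ℝ] ℝ}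
    {S T : Subalgebra ℝ A} (h : S ≤ T) {K : Set (S →ₐ[ℝ] ℝ)} {K' : Set (T →ₐ[ℝ] ℝ)}
    (hK : IsClosed K) (hKK' : resTrans h '' K' ⊆ K) {μ : Measure (T →ₐ[ℝ] ℝ)}
    (hμ : IsRepr (resL L T) K' μ) : IsRepr (resL L S) K (μ.map (resTrans h)) := by
  have hc := continuous_resTrans h
  have := hμ.isFiniteMeasure
  have := hμ.1.2
  have : IsFiniteMeasure (μ.map (resTrans h)) := Measure.isFiniteMeasure_map μ _
  refine ⟨⟨IsFiniteMeasure.toIsLocallyFiniteMeasure _, Measure.InnerRegular.map_of_continuous hc⟩, ?_, fun b => ?_⟩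
  · rw [Measure.map_apply hc.measurable hK.measurableSet.compl]
    exact measure_mono_null
      (fun φ hφ hφK' => hφ (hKK' (Set.mem_image_of_mem _ hφK'))) hμ.2.1
  · have hb := (continuous_eval b).aestronglyMeasurable (μ := μ.map (resTrans h))
    obtain ⟨hint, hL⟩ := hμ.2.2 (Subalgebra.inclusion h b)
    exact ⟨(integrable_map_measure hb hc.aemeasurable).2 hint,
      hL.trans (integral_map hc.aemeasurable hb).symm⟩

/-- If for each finitely generated subalgebra `S` there is a *unique* `K S`-representing
Radon measure for `L|_S`, then any choice of such representing measures is an exact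
projective system. -/
theorem unique_representing_measures_exact
    (A : Type*) [CommRing A] [Algebra ℝ A] [Nonempty (A →ₐ[ℝ] ℝ)]
    (L : A →ₗ[ℝ] ℝ) (hL1 : L 1 = 1)
    (K : ∀ S : Subalgebra ℝ A, Set (↥S →ₐ[ℝ] ℝ))
    (hKclosed : ∀ S : Subalgebra ℝ A, S.FG → IsClosed (K S))
    (hKcompat : ∀ (S T : Subalgebra ℝ A), S.FG → T.FG → ∀ h : S ≤ T,
      resTrans h '' K T ⊆ K S)
    (huniq : ∀ S : Subalgebra ℝ A, S.FG →
      ∃! μ : Measure (↥S →ₐ[ℝ] ℝ), IsRepr (resL L S) (K S) μ)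
    (ν : ∀ S : Subalgebra ℝ A, Measure (↥S →ₐ[ℝ] ℝ))
    (hν : ∀ S : Subalgebra ℝ A, S.FG → IsRepr (resL L S) (K S) (ν S)) :
    ∀ (S T : Subalgebra ℝ A), S.FG → T.FG → ∀ h : S ≤ T,
      (ν T).map (resTrans h) = ν S := by
  intro S T hS hT h
  exact (huniq S hS).unique
    ((hν T hT).map_resTrans h (hKclosed S hS) (hKcompat S T hS hT h)) (hν S hS)

end Stmt10
end

section
/- Let A be a unital commutative real algebra with nonempty character space X(A), L : A → ℝ linear with L(1) = 1, and I the set of all finitely generated unital subalgebras of A. For each S ∈ I let K^(S) ⊆ X(S) be closed with π_{S,T}(K^(T)) ⊆ K^(S) for all T ∈ I containing S. (i) If for each S ∈ I there exists some K^(S)-representing Radon measure ν_S for L|_S, then there exists a family {μ_S : S ∈ I} such that each μ_S is a K^(S)-representing Radon measure for L|_S and (π_{S,T})_# μ_T = μ_S for all S ⊆ T in I. (ii) If moreover the family {ν_S : S ∈ I} fulfills Prokhorov's condition, then the exact projective system {μ_S : S ∈ I} can be chosen to also fulfill Prokhorov's condition. -/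
open MeasureTheory
open scoped ENNReal

namespace Stmt11

/-- The weak topology on the character space `B →ₐ[ℝ] ℝ`. -/
instance charTopology (B : Type*) [CommRing B] [Algebra ℝ B] :
    TopologicalSpace (B →ₐ[ℝ] ℝ) :=
  TopologicalSpace.induced (fun φ : B →ₐ[ℝ] ℝ => (φ : B → ℝ)) inferInstance

/-- The Borel σ-algebra of the weak topology on the character space. -/
instance charMeasurableSpace (B : Type*) [CommRing B] [Algebra ℝ B] :
    MeasurableSpace (B →ₐ[ℝ] ℝ) := borel _

instance charBorelSpace (B : Type*) [CommRing B] [Algebra ℝ B] :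
    BorelSpace (B →ₐ[ℝ] ℝ) := ⟨rfl⟩

/-- The restriction map `π_S : X(A) → X(S)` for a subalgebra `S` of `A`. -/
def resMap {A : Type*} [CommRing A] [Algebra ℝ A] (S : Subalgebra ℝ A) :
    (A →ₐ[ℝ] ℝ) → (S →ₐ[ℝ] ℝ) := fun φ => φ.comp S.val

/-- The restriction map `π_{S,T} : X(T) → X(S)` for subalgebras `S ≤ T` of `A`. -/
def resTrans {A : Type*} [CommRing A] [Algebra ℝ A] {S T : Subalgebra ℝ A} (h : S ≤ T) :
    (T →ₐ[ℝ] ℝ) → (S →ₐ[ℝ] ℝ) := fun φ => φ.comp (Subalgebra.inclusion h)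

/-- The restriction `L|_S` of a linear functional `L : A → ℝ` to a subalgebra `S`. -/
def resL {A : Type*} [CommRing A] [Algebra ℝ A] (L : A →ₗ[ℝ] ℝ) (S : Subalgebra ℝ A) :
    (↥S) →ₗ[ℝ] ℝ := L.comp (Subalgebra.val S).toLinearMap

/-- A Radon measure: locally finite and inner regular w.r.t. compact sets. -/
def IsRadon {α : Type*} [TopologicalSpace α] [MeasurableSpace α] (μ : Measure α) : Prop :=
  IsLocallyFiniteMeasure μ ∧ μ.InnerRegular

/-- `μ` is a `K`-representing Radon measure for the linear functional `L` on `B`. -/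
def IsRepr {B : Type*} [CommRing B] [Algebra ℝ B] (L : B →ₗ[ℝ] ℝ)
    (K : Set (B →ₐ[ℝ] ℝ)) (μ : Measure (B →ₐ[ℝ] ℝ)) : Prop :=
  IsRadon μ ∧ μ Kᶜ = 0 ∧
    ∀ b : B, Integrable (fun φ : B →ₐ[ℝ] ℝ => φ b) μ ∧
      L b = ∫ φ : B →ₐ[ℝ] ℝ, φ b ∂μ

/-- Prokhorov's condition for a family of measures indexed by the finitely generated
subalgebras of `A`. -/
def Prokh {A : Type*} [CommRing A] [Algebra ℝ A]
    (μf : ∀ S : Subalgebra ℝ A, Measure (↥S →ₐ[ℝ] ℝ)) : Prop :=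
  ∀ ε : ℝ≥0∞, 0 < ε → ∃ C : Set (A →ₐ[ℝ] ℝ), IsCompact C ∧
    ∀ S : Subalgebra ℝ A, S.FG → 1 - ε ≤ μf S (resMap S '' C)

open Filter Topology

section WeakLimits

variable {X ι : Type*} [TopologicalSpace X] [MeasurableSpace X] [BorelSpace X]
  {F : Filter ι} {P : ι → ProbabilityMeasure X} {Q : ProbabilityMeasure X}

lemma tendsto_integral_of_bounded (h : Tendsto P F (𝓝 Q)) {f : X → ℝ} (hf : Continuous f)
    {M : ℝ} (hM : ∀ x, ‖f x‖ ≤ M) :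
    Tendsto (fun i => ∫ x, f x ∂(P i : Measure X)) F (𝓝 (∫ x, f x ∂(Q : Measure X))) :=
  ProbabilityMeasure.tendsto_iff_forall_integral_tendsto.1 h
    (BoundedContinuousFunction.ofNormedAddCommGroup f hf M hM)

/-- Fatou's lemma for a nonnegative continuous function under weak convergence. -/
lemma integrable_and_integral_le_of_tendsto [F.NeBot] (h : Tendsto P F (𝓝 Q)) {f : X → ℝ}
    (hf : Continuous f) (h0 : ∀ x, 0 ≤ f x) {C : ℝ}
    (hi : ∀ i, Integrable f (P i : Measure X)) (hC : ∀ i, ∫ x, f x ∂(P i : Measure X) ≤ C) :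
    Integrable f (Q : Measure X) ∧ ∫ x, f x ∂(Q : Measure X) ≤ C := by
  have hcont (M : ℕ) : Continuous fun x => min (f x) (M : ℝ) := hf.min continuous_const
  have hnn (M : ℕ) (x : X) : 0 ≤ min (f x) (M : ℝ) := le_min (h0 x) M.cast_nonneg
  have hbdd (M : ℕ) (x : X) : ‖min (f x) (M : ℝ)‖ ≤ M := by
    rw [Real.norm_of_nonneg (hnn M x)]; exact min_le_right _ _
  have hint (R : ProbabilityMeasure X) (M : ℕ) :
      Integrable (fun x => min (f x) (M : ℝ)) (R : Measure X) :=
    Integrable.of_bound (hcont M).measurable.aestronglyMeasurable M (ae_of_all _ (hbdd M))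
  have htrunc (M : ℕ) : ∫ x, min (f x) (M : ℝ) ∂(Q : Measure X) ≤ C :=
    le_of_tendsto' (tendsto_integral_of_bounded h (hcont M) (hbdd M)) fun i =>
      (integral_mono (hint _ M) (hi i) fun x => min_le_left _ _).trans (hC i)
  have hlim : Tendsto (fun M : ℕ => ∫⁻ x, ENNReal.ofReal (min (f x) (M : ℝ)) ∂(Q : Measure X))
      atTop (𝓝 (∫⁻ x, ENNReal.ofReal (f x) ∂(Q : Measure X))) := by
    refine lintegral_tendsto_of_tendsto_of_monotone
      (fun M => (hcont M).measurable.ennreal_ofReal.aemeasurable)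
      (ae_of_all _ fun x M N hMN => ENNReal.ofReal_le_ofReal <|
        min_le_min_left _ (Nat.cast_le.2 hMN))
      (ae_of_all _ fun x => tendsto_const_nhds.congr' ?_)
    filter_upwards [eventually_ge_atTop ⌈f x⌉₊] with M hM
    rw [min_eq_left (Nat.ceil_le.1 hM)]
  have hle : ∫⁻ x, ENNReal.ofReal (f x) ∂(Q : Measure X) ≤ ENNReal.ofReal C :=
    le_of_tendsto' hlim fun M => by
      rw [← ofReal_integral_eq_lintegral_ofReal (hint Q M) (ae_of_all _ (hnn M))]
      exact ENNReal.ofReal_le_ofReal (htrunc M)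
  have hfi : Integrable f (Q : Measure X) :=
    (lintegral_ofReal_ne_top_iff_integrable hf.measurable.aestronglyMeasurable
      (ae_of_all _ h0)).1 (ne_top_of_le_ne_top ENNReal.ofReal_ne_top hle)
  refine ⟨hfi, ?_⟩
  rw [← ofReal_integral_eq_lintegral_ofReal hfi (ae_of_all _ h0)] at hle
  obtain ⟨i⟩ : Nonempty ι := F.nonempty_of_neBot
  exact (ENNReal.ofReal_le_ofReal_iff ((integral_nonneg h0).trans (hC i))).1 hle

lemma abs_sub_truncation_le (y : ℝ) {M : ℝ} (hM : 0 < M) :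
    |y - max (-M) (min y M)| ≤ y ^ 2 / M := by
  rw [le_div_iff₀ hM]
  rcases le_total y M with h | h
  · rw [min_eq_left h]
    rcases le_total (-M) y with h' | h'
    · simp only [max_eq_right h', sub_self, abs_zero, zero_mul]; positivity
    · rw [max_eq_left h', abs_of_nonpos (by linarith)]; nlinarith
  · rw [min_eq_right h, max_eq_right (by linarith), abs_of_nonneg (by linarith)]; nlinarith

lemma integrable_of_integrable_sq {μ : Measure X} [IsFiniteMeasure μ] {f : X → ℝ}
    (hf : Continuous f) (h : Integrable (fun x => f x ^ 2) μ) : Integrable f μ :=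
  ((memLp_two_iff_integrable_sq hf.measurable.aestronglyMeasurable).2 h).integrable one_le_two

lemma abs_integral_sub_truncation_le {μ : Measure X} [IsFiniteMeasure μ] {f : X → ℝ}
    (hf : Continuous f) (h : Integrable (fun x => f x ^ 2) μ) {M : ℝ} (hM : 0 < M) :
    |∫ x, f x ∂μ - ∫ x, max (-M) (min (f x) M) ∂μ| ≤ (∫ x, f x ^ 2 ∂μ) / M := by
  have htr : Integrable (fun x => max (-M) (min (f x) M)) μ :=
    Integrable.of_bound (C := M) (by fun_prop) <| ae_of_all _ fun x =>
      abs_le.2 ⟨le_max_left _ _, max_le (by linarith) (min_le_right _ _)⟩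
  rw [← integral_sub (integrable_of_integrable_sq hf h) htr, ← integral_div]
  exact (abs_integral_le_integral_abs).trans <| integral_mono_of_nonneg
    (ae_of_all _ fun x => abs_nonneg _) (h.div_const M)
    (ae_of_all _ fun x => abs_sub_truncation_le _ hM)

/-- Weak convergence with bounded second moments preserves first moments. -/
lemma integrable_and_integral_eq_of_tendsto [F.NeBot] (h : Tendsto P F (𝓝 Q)) {f : X → ℝ}
    (hf : Continuous f) {c C : ℝ} (hi : ∀ i, Integrable (fun x => f x ^ 2) (P i : Measure X))
    (hC : ∀ i, ∫ x, f x ^ 2 ∂(P i : Measure X) ≤ C)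
    (hc : ∀ i, ∫ x, f x ∂(P i : Measure X) = c) :
    Integrable f (Q : Measure X) ∧ c = ∫ x, f x ∂(Q : Measure X) := by
  obtain ⟨hQi, hQC⟩ := integrable_and_integral_le_of_tendsto h (hf.pow 2)
    (fun x => sq_nonneg (f x)) hi hC
  refine ⟨integrable_of_integrable_sq hf hQi, ?_⟩
  have hbound (M : ℕ) : |c - ∫ x, f x ∂(Q : Measure X)| ≤ C / (M + 1 : ℝ) + C / (M + 1 : ℝ) := by
    have hM : (0 : ℝ) < M + 1 := by positivity
    have hlim := tendsto_integral_of_bounded h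
      (f := fun x => max (-(M + 1 : ℝ)) (min (f x) (M + 1))) (by fun_prop) (M := M + 1)
      fun x => abs_le.2 ⟨le_max_left _ _, max_le (by linarith) (min_le_right _ _)⟩
    have h₁ := le_of_tendsto' (hlim.const_sub c).abs fun i => by
      rw [← hc i]
      exact (abs_integral_sub_truncation_le hf (hi i) hM).trans
        (div_le_div_of_nonneg_right (hC i) hM.le)
    have h₂ := (abs_integral_sub_truncation_le hf hQi hM).trans
        (div_le_div_of_nonneg_right hQC hM.le)
    rw [abs_sub_comm] at h₂
    exact (abs_sub_le _ _ _).trans (add_le_add h₁ h₂)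
  have hzero : Tendsto (fun M : ℕ => C / (M + 1 : ℝ) + C / (M + 1 : ℝ)) atTop (𝓝 0) := by
    simpa [div_eq_mul_inv] using
      ((tendsto_one_div_add_atTop_nhds_zero_nat (𝕜 := ℝ)).const_mul C).add
        ((tendsto_one_div_add_atTop_nhds_zero_nat (𝕜 := ℝ)).const_mul C)
  exact sub_eq_zero.1 (abs_nonpos_iff.1 (ge_of_tendsto' hzero hbound))

lemma le_measure_isClosed_of_tendsto [HasOuterApproxClosed X] [F.NeBot] (h : Tendsto P F (𝓝 Q))
    {K : Set X} (hK : IsClosed K) {c : ℝ≥0∞} (hc : ∀ i, c ≤ (P i : Measure X) K) :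
    c ≤ (Q : Measure X) K :=
  (le_limsup_of_frequently_le (Frequently.of_forall hc)).trans
    (ProbabilityMeasure.limsup_measure_closed_le_of_tendsto h hK)

end WeakLimits

section CharacterSpace

variable {B : Type*} [CommRing B] [Algebra ℝ B]

lemma continuous_eval (b : B) : Continuous fun φ : B →ₐ[ℝ] ℝ => φ b :=
  (continuous_apply b).comp continuous_induced_dom

lemma continuous_of_eval {Y : Type*} [TopologicalSpace Y] {g : Y → (B →ₐ[ℝ] ℝ)}
    (h : ∀ b, Continuous fun y => g y b) : Continuous g :=
  continuous_induced_rng.2 (continuous_pi h)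

instance : T2Space (B →ₐ[ℝ] ℝ) :=
  T2Space.of_injective_continuous DFunLike.coe_injective continuous_induced_dom

/-- The character space of a quotient of a polynomial ring is an affine real variety. -/
lemma isClosedEmbedding_eval_generators {σ : Type*} (f : MvPolynomial σ ℝ →ₐ[ℝ] B)
    (hf : Function.Surjective f) :
    IsClosedEmbedding fun (φ : B →ₐ[ℝ] ℝ) (i : σ) => φ (f (MvPolynomial.X i)) := by
  have heval (φ : B →ₐ[ℝ] ℝ) (p : MvPolynomial σ ℝ) :
      MvPolynomial.eval (fun i => φ (f (MvPolynomial.X i))) p = φ (f p) := by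
    have : MvPolynomial.aeval (fun i => φ (f (MvPolynomial.X i))) = φ.comp f := by
      ext i; simp
    simpa [MvPolynomial.aeval_eq_eval] using DFunLike.congr_fun this p
  have hpoly (p : MvPolynomial σ ℝ) :
      Continuous fun x : σ → ℝ => MvPolynomial.eval x p := MvPolynomial.continuous_eval p
  refine ⟨⟨⟨le_antisymm ?_ ?_⟩, ?_⟩, ?_⟩
  · exact continuous_iff_le_induced.1 (continuous_pi fun i => continuous_eval _)
  · refine continuous_iff_le_induced.1 (@continuous_pi _ _ _ (.induced _ _) _ _ fun b => ?_)
    obtain ⟨p, rfl⟩ := hf b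
    rw [funext fun φ : B →ₐ[ℝ] ℝ => (heval φ p).symm]
    exact @Continuous.comp _ (σ → ℝ) _ (.induced _ _) _ _ _ (fun x => MvPolynomial.eval x p)
      (hpoly p) continuous_induced_dom
  · intro φ ψ h
    ext b
    obtain ⟨p, rfl⟩ := hf b
    rw [← heval, ← heval]
    exact congrArg (fun x => MvPolynomial.eval x p) h
  · have : (Set.range fun (φ : B →ₐ[ℝ] ℝ) (i : σ) => φ (f (MvPolynomial.X i))) =
        ⋂ p ∈ RingHom.ker f.toRingHom, {x | MvPolynomial.eval x p = 0} := by
      ext x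
      simp only [Set.mem_range, Set.mem_iInter]
      constructor
      · rintro ⟨φ, rfl⟩ p hp
        change MvPolynomial.eval _ p = 0
        rw [heval, show f p = 0 from hp, map_zero]
      · intro hx
        refine ⟨AlgHom.liftOfSurjective f hf (MvPolynomial.aeval x) fun p hp => ?_, ?_⟩
        · simpa [MvPolynomial.aeval_eq_eval] using hx p hp
        · ext i; simp
    rw [this]
    exact isClosed_biInter fun p _ => isClosed_eq (hpoly p) continuous_const

variable [Algebra.FiniteType ℝ B]

instance : PolishSpace (B →ₐ[ℝ] ℝ) := by
  obtain ⟨n, f, hf⟩ := Algebra.FiniteType.iff_quotient_mvPolynomial''.1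
    (inferInstance : Algebra.FiniteType ℝ B)
  exact (isClosedEmbedding_eval_generators f hf).polishSpace

instance : HasOuterApproxClosed (B →ₐ[ℝ] ℝ) :=
  letI := TopologicalSpace.upgradeIsCompletelyMetrizable (B →ₐ[ℝ] ℝ)
  inferInstance

lemma isRadon_of_isFiniteMeasure (μ : Measure (B →ₐ[ℝ] ℝ)) [IsFiniteMeasure μ] : IsRadon μ :=
  ⟨inferInstance, inferInstance⟩

variable (B) in
/-- A finitely generated real algebra has an element whose evaluation is a proper function. -/
lemma exists_nonneg_isCompact_sublevel :
    ∃ b : B, (∀ φ : B →ₐ[ℝ] ℝ, 0 ≤ φ b) ∧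
      ∀ R : ℝ, IsCompact {φ : B →ₐ[ℝ] ℝ | φ b ≤ R} := by
  obtain ⟨n, f, hf⟩ := Algebra.FiniteType.iff_quotient_mvPolynomial''.1
    (inferInstance : Algebra.FiniteType ℝ B)
  have hsum (φ : B →ₐ[ℝ] ℝ) : φ (∑ i, f (MvPolynomial.X i) ^ 2) =
      ∑ i, φ (f (MvPolynomial.X i)) ^ 2 := by simp
  refine ⟨∑ i, f (MvPolynomial.X i) ^ 2, fun φ => ?_, fun R => ?_⟩
  · rw [hsum]; positivity
  · refine ((isClosedEmbedding_eval_generators f hf).isCompact_preimage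
      (isCompact_univ_pi fun _ => isCompact_Icc (a := -√R) (b := √R))).of_isClosed_subset
      (isClosed_le (continuous_eval _) continuous_const) fun φ hφ i _ => abs_le.1 ?_
    refine Real.abs_le_sqrt (le_trans ?_ hφ)
    rw [hsum]
    exact Finset.single_le_sum (f := fun i => φ (f (MvPolynomial.X i)) ^ 2)
      (fun _ _ => sq_nonneg _) (Finset.mem_univ i)

end CharacterSpace

section Representing

variable {B : Type*} [CommRing B] [Algebra ℝ B] {L : B →ₗ[ℝ] ℝ} {K : Set (B →ₐ[ℝ] ℝ)}

lemma IsRepr.isProbabilityMeasure {μ : Measure (B →ₐ[ℝ] ℝ)} (h : IsRepr L K μ) (hL : L 1 = 1) :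
    IsProbabilityMeasure μ := by
  have h1 := (h.2.2 1).2
  simp only [map_one, hL, integral_const, smul_eq_mul, mul_one] at h1
  exact ⟨(ENNReal.toReal_eq_one_iff _).1 h1.symm⟩

variable [Algebra.FiniteType ℝ B] {ι : Type*}

lemma isRepr_of_tendsto {F : Filter ι} [F.NeBot] {P : ι → ProbabilityMeasure (B →ₐ[ℝ] ℝ)}
    {Q : ProbabilityMeasure (B →ₐ[ℝ] ℝ)} (hK : IsClosed K)
    (hP : ∀ i, IsRepr L K (P i : Measure (B →ₐ[ℝ] ℝ))) (h : Tendsto P F (𝓝 Q)) :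
    IsRepr L K (Q : Measure (B →ₐ[ℝ] ℝ)) := by
  refine ⟨isRadon_of_isFiniteMeasure _, ?_, fun b => ?_⟩
  · rw [prob_compl_eq_zero_iff hK.measurableSet]
    exact le_antisymm prob_le_one <| le_measure_isClosed_of_tendsto h hK fun i =>
      ((prob_compl_eq_zero_iff hK.measurableSet).1 (hP i).2.1).ge
  · have hsq i := (hP i).2.2 (b ^ 2)
    simp only [map_pow] at hsq
    exact integrable_and_integral_eq_of_tendsto h (continuous_eval b)
      (fun i => (hsq i).1) (fun i => (hsq i).2.ge) (fun i => ((hP i).2.2 b).2.symm)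

lemma isTightMeasureSet_isRepr (L : B →ₗ[ℝ] ℝ) (K : Set (B →ₐ[ℝ] ℝ)) :
    IsTightMeasureSet {μ : Measure (B →ₐ[ℝ] ℝ) | IsProbabilityMeasure μ ∧ IsRepr L K μ} := by
  obtain ⟨b, hb0, hb⟩ := exists_nonneg_isCompact_sublevel B
  rw [isTightMeasureSet_iff_exists_isCompact_measure_compl_le]
  intro ε hε
  obtain ⟨R, hR0, hR⟩ : ∃ R : ℝ, 0 < R ∧ ENNReal.ofReal (L b / R) ≤ ε := by
    have hlim : Tendsto (fun R : ℝ => ENNReal.ofReal (L b / R)) atTop (𝓝 0) := by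
      simpa using ENNReal.tendsto_ofReal (tendsto_id.const_div_atTop (L b))
    exact ((eventually_gt_atTop 0).and (hlim.eventually (ge_mem_nhds hε))).exists
  refine ⟨_, hb R, fun μ ⟨_, hμ⟩ => le_trans ?_ hR⟩
  have hmarkov := mul_meas_ge_le_integral_of_nonneg (ae_of_all μ hb0) (hμ.2.2 b).1 R
  rw [← (hμ.2.2 b).2, mul_comm, ← le_div_iff₀ hR0] at hmarkov
  refine (measure_mono fun φ hφ => ?_).trans
    ((ENNReal.le_ofReal_iff_toReal_le (measure_ne_top _ _) ?_).2 hmarkov)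
  · exact (not_le.1 (show ¬ φ b ≤ R from hφ)).le
  · exact measureReal_nonneg.trans hmarkov

lemma exists_tendsto_isRepr (F : Ultrafilter ι) {P : ι → ProbabilityMeasure (B →ₐ[ℝ] ℝ)}
    (hK : IsClosed K) (hP : ∀ i, IsRepr L K (P i : Measure (B →ₐ[ℝ] ℝ))) :
    ∃ Q : ProbabilityMeasure (B →ₐ[ℝ] ℝ), Tendsto P F (𝓝 Q) ∧
      IsRepr L K (Q : Measure (B →ₐ[ℝ] ℝ)) := by
  have hcomp : IsCompact (closure (Set.range P)) := by
    refine isCompact_closure_of_isTightMeasureSet ((isTightMeasureSet_isRepr L K).subset ?_)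
    rintro _ ⟨_, ⟨i, rfl⟩, rfl⟩
    exact ⟨inferInstance, hP i⟩
  obtain ⟨Q, -, hQ⟩ := hcomp.ultrafilter_le_nhds (F.map P) <| by
    rw [Ultrafilter.coe_map]
    exact tendsto_principal.2 (Eventually.of_forall fun i => subset_closure ⟨i, rfl⟩)
  exact ⟨Q, hQ, isRepr_of_tendsto (F := (F : Filter ι)) hK hP hQ⟩

end Representing

section Restriction

variable {A : Type*} [CommRing A] [Algebra ℝ A]

lemma continuous_resMap (S : Subalgebra ℝ A) : Continuous (resMap S) :=
  continuous_of_eval fun b => continuous_eval (b : A)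

lemma continuous_resTrans {S T : Subalgebra ℝ A} (h : S ≤ T) : Continuous (resTrans h) :=
  continuous_of_eval fun b => continuous_eval (Subalgebra.inclusion h b)

lemma IsRepr.map_resTrans {L : A →ₗ[ℝ] ℝ} {S T : Subalgebra ℝ A} [Algebra.FiniteType ℝ S]
    (h : S ≤ T) {KS : Set (S →ₐ[ℝ] ℝ)} {KT : Set (T →ₐ[ℝ] ℝ)} (hKS : IsClosed KS)
    (hK : resTrans h '' KT ⊆ KS) {μ : Measure (T →ₐ[ℝ] ℝ)} [IsFiniteMeasure μ]
    (hμ : IsRepr (resL L T) KT μ) :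
    IsRepr (resL L S) KS (μ.map (resTrans h)) := by
  have hm := (continuous_resTrans h).measurable
  have := Measure.isFiniteMeasure_map μ (resTrans h)
  refine ⟨isRadon_of_isFiniteMeasure _, ?_, fun b => ?_⟩
  · rw [Measure.map_apply hm hKS.measurableSet.compl]
    exact measure_mono_null (fun φ hφ hφT => hφ (hK ⟨φ, hφT, rfl⟩)) hμ.2.1
  · have hb := (continuous_eval b).measurable.aestronglyMeasurable (μ := μ.map (resTrans h))
    rw [integrable_map_measure hb hm.aemeasurable, integral_map hm.aemeasurable hb]
    exact hμ.2.2 (Subalgebra.inclusion h b)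

/-- The pushforward of `ν T` to the character space of `S`, with junk value `ν S` unless `S ≤ T`. -/
noncomputable def pushforward (ν : ∀ S : Subalgebra ℝ A, Measure (S →ₐ[ℝ] ℝ))
    (S T : Subalgebra ℝ A) : Measure (S →ₐ[ℝ] ℝ) :=
  open Classical in if h : S ≤ T then (ν T).map (resTrans h) else ν S

variable {ν : ∀ S : Subalgebra ℝ A, Measure (S →ₐ[ℝ] ℝ)} {S T U : Subalgebra ℝ A}

lemma pushforward_of_le (h : S ≤ T) : pushforward ν S T = (ν T).map (resTrans h) :=
  dif_pos h

lemma map_pushforward (hST : S ≤ T) (hTU : T ≤ U) :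
    (pushforward ν T U).map (resTrans hST) = pushforward ν S U := by
  rw [pushforward_of_le hTU, pushforward_of_le (hST.trans hTU),
    Measure.map_map (continuous_resTrans _).measurable (continuous_resTrans _).measurable]
  rfl

lemma isRepr_pushforward {L : A →ₗ[ℝ] ℝ} (hL1 : L 1 = 1)
    {K : ∀ S : Subalgebra ℝ A, Set (S →ₐ[ℝ] ℝ)} (hKclosed : IsClosed (K S))
    (hKcompat : ∀ h : S ≤ T, resTrans h '' K T ⊆ K S) [Algebra.FiniteType ℝ S]
    (hνS : IsRepr (resL L S) (K S) (ν S)) (hνT : IsRepr (resL L T) (K T) (ν T)) :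
    IsRepr (resL L S) (K S) (pushforward ν S T) := by
  rw [pushforward]
  split_ifs with h
  · have := hνT.isProbabilityMeasure hL1
    exact hνT.map_resTrans h hKclosed (hKcompat h)
  · exact hνS

lemma le_pushforward_image {C : Set (A →ₐ[ℝ] ℝ)} (hC : IsClosed (resMap S '' C)) {c : ℝ≥0∞}
    (hS : c ≤ ν S (resMap S '' C)) (hT : c ≤ ν T (resMap T '' C)) :
    c ≤ pushforward ν S T (resMap S '' C) := by
  rw [pushforward]
  split_ifs with h
  · rw [Measure.map_apply (continuous_resTrans h).measurable hC.measurableSet]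
    refine hT.trans (measure_mono ?_)
    rintro _ ⟨φ, hφ, rfl⟩
    exact ⟨φ, hφ, rfl⟩
  · exact hS

/-- Ultrafilter limits of pushforwards give an exact projective system of representing measures
which inherits Prokhorov's condition. -/
lemma exists_exact_system_inheriting_prokh (L : A →ₗ[ℝ] ℝ) (hL1 : L 1 = 1)
    (K : ∀ S : Subalgebra ℝ A, Set (S →ₐ[ℝ] ℝ))
    (hKclosed : ∀ S : Subalgebra ℝ A, S.FG → IsClosed (K S))
    (hKcompat : ∀ S T : Subalgebra ℝ A, S.FG → T.FG → ∀ h : S ≤ T, resTrans h '' K T ⊆ K S)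
    (ν : ∀ S : Subalgebra ℝ A, Measure (S →ₐ[ℝ] ℝ))
    (hν : ∀ S : Subalgebra ℝ A, S.FG → IsRepr (resL L S) (K S) (ν S)) :
    ∃ μf : ∀ S : Subalgebra ℝ A, Measure (S →ₐ[ℝ] ℝ),
      (∀ S : Subalgebra ℝ A, S.FG → IsRepr (resL L S) (K S) (μf S)) ∧
      (∀ S T : Subalgebra ℝ A, S.FG → T.FG → ∀ h : S ≤ T, (μf T).map (resTrans h) = μf S) ∧
      (Prokh ν → Prokh μf) := by
  classical
  let I := {S : Subalgebra ℝ A // S.FG}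
  have : Nonempty I := ⟨⟨⊥, Subalgebra.fg_bot⟩⟩
  have : IsDirectedOrder I :=
    ⟨fun S T => ⟨⟨S.1 ⊔ T.1, S.2.sup T.2⟩, le_sup_left (a := S.1), le_sup_right (a := S.1)⟩⟩
  let F : Ultrafilter I := .of atTop
  have hF (S : I) : ∀ᶠ T in (F : Filter I), S.1 ≤ T.1 :=
    Ultrafilter.of_le atTop (eventually_ge_atTop S)
  have hfin (S : I) : Algebra.FiniteType ℝ S.1 := S.1.fg_iff_finiteType.1 S.2
  have hrep (S T : I) : IsRepr (resL L S.1) (K S.1) (pushforward ν S.1 T.1) :=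
    isRepr_pushforward hL1 (hKclosed _ S.2) (hKcompat _ _ S.2 T.2) (hν _ S.2) (hν _ T.2)
  let P (S T : I) : ProbabilityMeasure (S.1 →ₐ[ℝ] ℝ) :=
    ⟨pushforward ν S.1 T.1, (hrep S T).isProbabilityMeasure hL1⟩
  choose Q hQlim hQ using fun S : I => exists_tendsto_isRepr F (hKclosed _ S.2)
    (P := P S) (hrep S)
  refine ⟨fun S => if hS : S.FG then Q ⟨S, hS⟩ else 0, fun S hS => ?_, fun S T hS hT h => ?_,
    fun hprokh ε hε => ?_⟩
  · simpa only [dif_pos hS] using hQ ⟨S, hS⟩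
  · simp only [dif_pos hS, dif_pos hT]
    have hmap := ProbabilityMeasure.tendsto_map_of_tendsto_of_continuous _ _ (hQlim ⟨T, hT⟩)
      (continuous_resTrans h)
    have := hfin ⟨S, hS⟩
    have : T2Space (ProbabilityMeasure (S →ₐ[ℝ] ℝ)) := ProbabilityMeasure.t2Space _
    have heq := tendsto_nhds_unique (hmap.congr' ?_) (hQlim ⟨S, hS⟩)
    · exact congrArg Subtype.val heq
    · filter_upwards [hF ⟨T, hT⟩] with U hU
      exact Subtype.ext (map_pushforward h hU)
  · obtain ⟨C, hC, hνC⟩ := hprokh ε hε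
    refine ⟨C, hC, fun S hS => ?_⟩
    simp only [dif_pos hS]
    have hclosed : IsClosed (resMap S '' C) := (hC.image (continuous_resMap S)).isClosed
    exact le_measure_isClosed_of_tendsto (hQlim ⟨S, hS⟩) hclosed fun T =>
      le_pushforward_image hclosed (hνC S hS) (hνC T.1 T.2)

end Restriction

/-- (i) If each `L|_S` admits a `K S`-representing Radon measure, then one can choose an
exact projective system of such representing measures; (ii) if the given family moreover
fulfills Prokhorov's condition, then the exact projective system can be chosen to fulfill
Prokhorov's condition as well. -/
theorem exists_exact_representing_system
    (A : Type*) [CommRing A] [Algebra ℝ A] [Nonempty (A →ₐ[ℝ] ℝ)]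
    (L : A →ₗ[ℝ] ℝ) (hL1 : L 1 = 1)
    (K : ∀ S : Subalgebra ℝ A, Set (↥S →ₐ[ℝ] ℝ))
    (hKclosed : ∀ S : Subalgebra ℝ A, S.FG → IsClosed (K S))
    (hKcompat : ∀ (S T : Subalgebra ℝ A), S.FG → T.FG → ∀ h : S ≤ T,
      resTrans h '' K T ⊆ K S)
    (ν : ∀ S : Subalgebra ℝ A, Measure (↥S →ₐ[ℝ] ℝ))
    (hν : ∀ S : Subalgebra ℝ A, S.FG → IsRepr (resL L S) (K S) (ν S)) :
    (∃ μf : ∀ S : Subalgebra ℝ A, Measure (↥S →ₐ[ℝ] ℝ),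
        (∀ S : Subalgebra ℝ A, S.FG → IsRepr (resL L S) (K S) (μf S)) ∧
        (∀ (S T : Subalgebra ℝ A), S.FG → T.FG → ∀ h : S ≤ T,
          (μf T).map (resTrans h) = μf S)) ∧
    (Prokh ν →
      ∃ μf : ∀ S : Subalgebra ℝ A, Measure (↥S →ₐ[ℝ] ℝ),
        (∀ S : Subalgebra ℝ A, S.FG → IsRepr (resL L S) (K S) (μf S)) ∧
        (∀ (S T : Subalgebra ℝ A), S.FG → T.FG → ∀ h : S ≤ T,
          (μf T).map (resTrans h) = μf S) ∧
        Prokh μf) := by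
  obtain ⟨μf, hrepr, hexact, hprokh⟩ :=
    exists_exact_system_inheriting_prokh L hL1 K hKclosed hKcompat ν hν
  exact ⟨⟨μf, hrepr, hexact⟩, fun h => ⟨μf, hrepr, hexact, hprokh h⟩⟩

end Stmt11
end
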